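/- Let τ₀ ∈ ℍ and k ∈ {1,2,3}. Equation (★_k) on E_{τ₀} has a non-even family of solutions if and only if there exists (r,s) ∈ ℝ² ∖ (1/2)ℤ² such that Z(r_k, s_k, τ₀) = 0 and Z^{(𝐦_k)}(r,s,τ₀) ≠ 0. -/

import Mathlib

open Metric Set Filter Topology

noncomputable section

/-- The lattice `Λ_τ = ℤ + τℤ` as a set of complex numbers. -/
def lat (τ : ℂ) : Set ℂ := {z | ∃ m n : ℤ, z = (m : ℂ) + (n : ℂ) * τ}

/-- The lattice point `m + nτ` attached to a pair of integers. -/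
def latPt (τ : ℂ) (p : ℤ × ℤ) : ℂ := (p.1 : ℂ) + (p.2 : ℂ) * τ

/-- The Weierstrass elliptic function `℘(z|τ)`. -/
def wp (τ z : ℂ) : ℂ :=
  1 / z ^ 2 + ∑' p : {p : ℤ × ℤ // p ≠ 0},
    (1 / (z - latPt τ p.1) ^ 2 - 1 / latPt τ p.1 ^ 2)

/-- `℘′(z|τ)`. -/
def wpd (τ z : ℂ) : ℂ := deriv (wp τ) z

/-- `℘″(z|τ)`. -/
def wpdd (τ z : ℂ) : ℂ := deriv (deriv (wp τ)) z

/-- The Weierstrass zeta function `ζ(z|τ)` (odd primitive of `-℘`). -/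
def wzeta (τ z : ℂ) : ℂ :=
  1 / z + ∑' p : {p : ℤ × ℤ // p ≠ 0},
    (1 / (z - latPt τ p.1) + 1 / latPt τ p.1 + z / latPt τ p.1 ^ 2)

/-- The Weierstrass sigma function `σ(z|τ)`. -/
def wsigma (τ z : ℂ) : ℂ :=
  z * ∏' p : {p : ℤ × ℤ // p ≠ 0},
    ((1 - z / latPt τ p.1) * Complex.exp (z / latPt τ p.1 + z ^ 2 / (2 * latPt τ p.1 ^ 2)))

/-- The periods `ω₀ = 0, ω₁ = 1, ω₂ = τ, ω₃ = 1 + τ`. -/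
def per (τ : ℂ) : ℕ → ℂ
  | 0 => 0
  | 1 => 1
  | 2 => τ
  | 3 => 1 + τ
  | _ => 0

/-- `e_k(τ) = ℘(ω_k/2|τ)`. -/
def eper (τ : ℂ) (k : ℕ) : ℂ := wp τ (per τ k / 2)

/-- The quasi-period `η₁(τ) = 2ζ(1/2|τ)`. -/
def eta1 (τ : ℂ) : ℂ := 2 * wzeta τ (1 / 2)

/-- The quasi-period `η₂(τ) = 2ζ(τ/2|τ)`. -/
def eta2 (τ : ℂ) : ℂ := 2 * wzeta τ (τ / 2)

/-- `η_k(τ)`, with `η₃ = η₁ + η₂`. -/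
def etaq (τ : ℂ) : ℕ → ℂ
  | 1 => eta1 τ
  | 2 => eta2 τ
  | 3 => eta1 τ + eta2 τ
  | _ => 0

/-- The Hecke form `Z(r,s,τ) = ζ(r+sτ|τ) - r η₁(τ) - s η₂(τ)`. -/
def heckeZ (r s τ : ℂ) : ℂ := wzeta τ (r + s * τ) - r * eta1 τ - s * eta2 τ

/-- The pre-modular form `Z^{(𝐦_k)}(r,s,τ) = Z(r,s,τ)² - ℘(r+sτ|τ) + e_k(τ)`. -/
def heckeZm (k : ℕ) (r s τ : ℂ) : ℂ := heckeZ r s τ ^ 2 - wp τ (r + s * τ) + eper τ k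

/-- First component of `(r_k, s_k)`. -/
def rkr (k : ℕ) (r : ℂ) : ℂ := if k = 2 then r else r + 1 / 2

/-- Second component of `(r_k, s_k)`. -/
def rks (k : ℕ) (s : ℂ) : ℂ := if k = 1 then s else s + 1 / 2

/-- `(r,s)` is a half-integer pair, i.e. belongs to `(1/2)ℤ²`. -/
def IsHalfIntPair (r s : ℂ) : Prop := ∃ m n : ℤ, r = (m : ℂ) / 2 ∧ s = (n : ℂ) / 2

/-- The singular set of the curvature equation: lattice translates of the points `ω_k/2`
with `m_k ≥ 1`. -/
def singSet (τ : ℂ) (m : Fin 4 → ℕ) : Set ℂ :=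
  {z | ∃ k : Fin 4, 1 ≤ m k ∧ ∃ l ∈ lat τ, z = per τ (k : ℕ) / 2 + l}

/-- The Laplacian of a real-valued function on `ℂ ≃ ℝ²`. -/
def lapl (u : ℂ → ℝ) (z : ℂ) : ℝ :=
  fderiv ℝ (fun w => fderiv ℝ u w (1 : ℂ)) z (1 : ℂ) +
  fderiv ℝ (fun w => fderiv ℝ u w Complex.I) z Complex.I

/-- `u` is a solution of the curvature equation `Δu + e^u = 8π Σ m_k δ_{ω_k/2}` on `E_τ`. -/
def IsCurvatureSolution (τ : ℂ) (m : Fin 4 → ℕ) (u : ℂ → ℝ) : Prop :=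
  (∀ z, u (z + 1) = u z) ∧ (∀ z, u (z + τ) = u z) ∧
  (∀ z ∉ singSet τ m, (∀ n : ℕ, ContDiffAt ℝ n u z) ∧ lapl u z + Real.exp (u z) = 0) ∧
  (∀ k : Fin 4, 1 ≤ m k → ∀ l ∈ lat τ,
    ∃ C ε : ℝ, 0 < ε ∧ ∀ z : ℂ, z ≠ per τ (k : ℕ) / 2 + l →
      dist z (per τ (k : ℕ) / 2 + l) < ε →
      |u z - 4 * (m k : ℝ) * Real.log (dist z (per τ (k : ℕ) / 2 + l))| ≤ C)

/-- Multiplicities for equation `(★_k)`: `m₀ = m_k = 1`, the others `0`. -/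
def starM (k : ℕ) : Fin 4 → ℕ := fun j => if (j : ℕ) = 0 ∨ (j : ℕ) = k then 1 else 0

/-- `f` is a developing map of `u`: `f` is meromorphic on `ℂ` and
`u = log (8|f′|²/(1+|f|²)²)` wherever `f` is analytic with nonvanishing derivative. -/
def IsDevelopingMapOf (u : ℂ → ℝ) (f : ℂ → ℂ) : Prop :=
  (∀ z : ℂ, MeromorphicAt f z) ∧
  ∀ z : ℂ, AnalyticAt ℂ f z → deriv f z ≠ 0 →
    u z = Real.log (8 * ‖deriv f z‖ ^ 2 / (1 + ‖f z‖ ^ 2) ^ 2)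

/-- `f` satisfies the type II constraint for the torus `E_τ`. -/
def IsTypeII (τ : ℂ) (f : ℂ → ℂ) : Prop :=
  ∃ θ₁ θ₂ : ℝ,
    (∀ z, f (z + 1) = Complex.exp (2 * Complex.I * (θ₁ : ℂ)) * f z) ∧
    (∀ z, f (z + τ) = Complex.exp (2 * Complex.I * (θ₂ : ℂ)) * f z)

/-- The one-parameter family of solutions generated by the developing map `f`
(with members `u_β` having developing map `e^β f`) contains an even solution. -/
def FamilyHasEven (τ : ℂ) (m : Fin 4 → ℕ) (f : ℂ → ℂ) : Prop :=
  ∃ (β : ℝ) (v : ℂ → ℝ), IsCurvatureSolution τ m v ∧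
    IsDevelopingMapOf v (fun z => (Real.exp β : ℂ) * f z) ∧ ∀ z, v (-z) = v z

/-- `u`, with type II developing map `f`, generates a non-even family of solutions. -/
def GeneratesNonEvenFamily (τ : ℂ) (m : Fin 4 → ℕ) (u : ℂ → ℝ) (f : ℂ → ℂ) : Prop :=
  IsCurvatureSolution τ m u ∧ IsDevelopingMapOf u f ∧ IsTypeII τ f ∧ ¬ FamilyHasEven τ m f

/-- The curvature equation has a non-even family of solutions. -/
def HasNonEvenFamily (τ : ℂ) (m : Fin 4 → ℕ) : Prop :=
  ∃ u f, GeneratesNonEvenFamily τ m u f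

/-- The curvature equation has an even family of solutions. -/
def HasEvenFamily (τ : ℂ) (m : Fin 4 → ℕ) : Prop :=
  ∃ (u : ℂ → ℝ) (f : ℂ → ℂ), IsCurvatureSolution τ m u ∧ IsDevelopingMapOf u f ∧
    IsTypeII τ f ∧ FamilyHasEven τ m f

/-- `y` is a (meromorphic, global) solution of `y″ = q·y` away from the singular set `S`. -/
def SolvesODEOn (q : ℂ → ℂ) (S : Set ℂ) (y : ℂ → ℂ) : Prop :=
  (∀ z : ℂ, MeromorphicAt y z) ∧
  ∀ z ∉ S, AnalyticAt ℂ y z ∧ deriv (deriv y) z = q z * y z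

/-- Linear independence of two functions, tested away from the singular set `S`. -/
def LinIndepOn (S : Set ℂ) (y₁ y₂ : ℂ → ℂ) : Prop :=
  ∀ a b : ℂ, (∀ z ∉ S, a * y₁ z + b * y₂ z = 0) → a = 0 ∧ b = 0

/-- The equation `y″ = q·y` (with singular set `S`) on `E_τ` has unitary monodromy: there is a
fundamental system of solutions whose monodromy matrices w.r.t. `z ↦ z+1` and `z ↦ z+τ`
lie in `SU(2)`. -/
def HasUnitaryMonodromy (q : ℂ → ℂ) (S : Set ℂ) (τ : ℂ) : Prop :=
  ∃ y₁ y₂ : ℂ → ℂ, SolvesODEOn q S y₁ ∧ SolvesODEOn q S y₂ ∧ LinIndepOn S y₁ y₂ ∧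
    ∃ M₁ M₂ : Matrix (Fin 2) (Fin 2) ℂ,
      M₁ ∈ Matrix.unitaryGroup (Fin 2) ℂ ∧ M₁.det = 1 ∧
      M₂ ∈ Matrix.unitaryGroup (Fin 2) ℂ ∧ M₂.det = 1 ∧
      (∀ z, y₁ (z + 1) = M₁ 0 0 * y₁ z + M₁ 0 1 * y₂ z) ∧
      (∀ z, y₂ (z + 1) = M₁ 1 0 * y₁ z + M₁ 1 1 * y₂ z) ∧
      (∀ z, y₁ (z + τ) = M₂ 0 0 * y₁ z + M₂ 0 1 * y₂ z) ∧
      (∀ z, y₂ (z + τ) = M₂ 1 0 * y₁ z + M₂ 1 1 * y₂ z)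

/-- The potential of the Fuchsian equation `L(𝐦_k, T, E, τ)`. -/
def LPot (k : ℕ) (T E τ : ℂ) (z : ℂ) : ℂ :=
  2 * wp τ z + 2 * wp τ (z - per τ k / 2) +
    T * (wzeta τ (z - per τ k / 2) - wzeta τ z) - E

/-- The singular set of `L(𝐦_k, T, E, τ)`: lattice translates of `0` and `ω_k/2`. -/
def LSing (τ : ℂ) (k : ℕ) : Set ℂ := {z | ∃ l ∈ lat τ, z = l ∨ z = per τ k / 2 + l}

/-- The equation `y″ = q·y` is apparent (free of logarithmic singularity) at `p`: there are two
linearly independent single-valued solutions on a punctured neighborhood of `p`, both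
meromorphic at `p`. -/
def ApparentAt (q : ℂ → ℂ) (p : ℂ) : Prop :=
  ∃ (y₁ y₂ : ℂ → ℂ) (ε : ℝ), 0 < ε ∧
    (∀ z ∈ Metric.ball p ε, z ≠ p →
      AnalyticAt ℂ y₁ z ∧ AnalyticAt ℂ y₂ z ∧
      deriv (deriv y₁) z = q z * y₁ z ∧ deriv (deriv y₂) z = q z * y₂ z) ∧
    MeromorphicAt y₁ p ∧ MeromorphicAt y₂ p ∧
    ∀ a b : ℂ, (∀ z ∈ Metric.ball p ε, z ≠ p → a * y₁ z + b * y₂ z = 0) → a = 0 ∧ b = 0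

/-- The translated (even) potential `q_k(z;T,E)` of `L(𝐦_k, T, E, τ)`. -/
def qPot (k : ℕ) (T E τ : ℂ) (z : ℂ) : ℂ :=
  2 * (wp τ (z + per τ k / 4) + wp τ (z - per τ k / 4)) +
    T * (wzeta τ (z + per τ k / 4) - wzeta τ (z - per τ k / 4)) - E

/-- The singular set of the translated potential: lattice translates of `±ω_k/4`. -/
def qSing (τ : ℂ) (k : ℕ) : Set ℂ :=
  {z | ∃ l ∈ lat τ, z = per τ k / 4 + l ∨ z = -(per τ k / 4) + l}

/-- The even elliptic solution `Φ_e(z;T,E)` of the second symmetric product equation. -/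
def PhiE (τ : ℂ) (k : ℕ) (T E : ℂ) (z : ℂ) : ℂ :=
  (wpd τ (per τ k / 4)) ^ 4 / (wp τ z - wp τ (per τ k / 4)) ^ 2 +
  (wpd τ (per τ k / 4)) ^ 2 * (wpd τ (per τ k / 4) * T + wpdd τ (per τ k / 4)) /
      (wp τ z - wp τ (per τ k / 4)) +
  (1 / 4) * (4 * (wpd τ (per τ k / 4)) ^ 2 * E + 3 * (wpd τ (per τ k / 4)) ^ 2 * T ^ 2
    - 8 * wzeta τ (per τ k / 4) * (wpd τ (per τ k / 4)) ^ 2 * T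
    + 32 * wp τ (per τ k / 4) * (wpd τ (per τ k / 4)) ^ 2
    - 3 * (wpdd τ (per τ k / 4)) ^ 2)

/-- For `k ∈ {1,2,3}`, the other two indices, so that `{k, i, i′} = {1,2,3}`. -/
def otherTwo : ℕ → ℕ × ℕ
  | 1 => (2, 3)
  | 2 => (1, 3)
  | 3 => (1, 2)
  | _ => (0, 0)

/-- The Wirtinger derivative `∂_z g = (1/2)(∂_x g - i ∂_y g)`. -/
def wirt (g : ℂ → ℂ) (z : ℂ) : ℂ :=
  (1 / 2) * (fderiv ℝ g z (1 : ℂ) - Complex.I * fderiv ℝ g z Complex.I)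

/-- The potential `q(z) = -(1/2)(u_zz - (1/2) u_z²)` associated with a solution `u`. -/
def uPot (u : ℂ → ℝ) (z : ℂ) : ℂ :=
  -(1 / 2) * (wirt (wirt (fun w => ((u w : ℝ) : ℂ))) z -
    (1 / 2) * (wirt (fun w => ((u w : ℝ) : ℂ)) z) ^ 2)

/-- All lattice translates of the four half-periods. -/
def fullSing (τ : ℂ) : Set ℂ := {z | ∃ k : Fin 4, ∃ l ∈ lat τ, z = per τ (k : ℕ) / 2 + l}

/-- The potential of the general Fuchsian equation (with residues `T₁, T₂, T₃`). -/
def q8 (τ : ℂ) (m : Fin 4 → ℕ) (T₁ T₂ T₃ E : ℂ) (z : ℂ) : ℂ :=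
  (∑ k : Fin 4, (m k : ℂ) * ((m k : ℂ) + 1) * wp τ (z - per τ (k : ℕ) / 2)) +
  T₁ * (wzeta τ (z - per τ 1 / 2) - wzeta τ z) +
  T₂ * (wzeta τ (z - per τ 2 / 2) - wzeta τ z) +
  T₃ * (wzeta τ (z - per τ 3 / 2) - wzeta τ z) - E

/-- The elliptic-of-the-second-kind ansatz built from sigma functions. -/
def sigY (τ : ℂ) (k : ℕ) (a₁ a₂ c : ℂ) (z : ℂ) : ℂ :=
  Complex.exp (c * z) * wsigma τ (z - a₁) * wsigma τ (z - a₂) /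
    (wsigma τ (z - per τ k / 4) * wsigma τ (z + per τ k / 4))

end

section

variable {f g y E F P φ U ell q U' q' ys F' B P' h : ℂ → ℂ} {a b z τ l x w c l' c' c1 c2 η ω A p κ a1 a2 a' b' d b1 b2 V μ1 μ2 ε W0 z1 μ e z0 : ℂ} {T O O' : Set ℂ} {m n : ℤ} {M L r s δ ρ C u1 u2 K : ℝ} {u v R ψ ψ' R' : ℂ → ℝ} {k : ℕ}

abbrev UP (t : ℂ) : Prop := 0 < t.im

abbrev K3 (k : ℕ) : Prop := k = 1 ∨ k = 2 ∨ k = 3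

abbrev FC : Type := ℂ → ℂ

lemma HasDerivAt.cg (h : HasDerivAt f a z) (hf : ∀ w, g w = f w)
    (ha : b = a) : HasDerivAt g b z := by
  obtain rfl : g = f := funext hf
  rw [ha]; exact h

def LP (τ : ℂ) (h : UP τ) : PeriodPair where
  ω₁ := 1
  ω₂ := τ
  indep := by
    rw [LinearIndependent.pair_iff]
    intro s t hst
    have h1 := congrArg Complex.im hst
    have h2 := congrArg Complex.re hst
    simp at h1 h2
    have ht : t = 0 := by
      rcases h1 with h1 | h1
      · exact h1
      · exact absurd h1 h.ne'
    subst ht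
    simpa using h2

lemma mem_LP (h : UP τ) : z ∈ (LP τ h).lattice ↔ z ∈ lat τ := by
  rw [PeriodPair.mem_lattice]
  simp only [lat, LP, mem_ofPred_eq, mul_one]
  exact ⟨fun ⟨m, n, e⟩ => ⟨m, n, e.symm⟩, fun ⟨m, n, e⟩ => ⟨m, n, e.symm⟩⟩

lemma lat_zero (τ : ℂ) : (0:ℂ) ∈ lat τ := ⟨0, 0, by simp⟩
lemma lat_one (τ : ℂ) : (1:ℂ) ∈ lat τ := ⟨1, 0, by simp⟩
lemma lat_tau (τ : ℂ) : τ ∈ lat τ := ⟨0, 1, by simp⟩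
lemma lat_add {τ a b : ℂ} (ha : a ∈ lat τ) (hb : b ∈ lat τ) : a + b ∈ lat τ := by
  obtain ⟨m, n, rfl⟩ := ha
  obtain ⟨m', n', rfl⟩ := hb
  exact ⟨m + m', n + n', by push_cast; ring⟩
lemma lat_neg {τ a : ℂ} (ha : a ∈ lat τ) : -a ∈ lat τ := by
  obtain ⟨m, n, rfl⟩ := ha
  exact ⟨-m, -n, by push_cast; ring⟩
lemma lat_neg_iff {τ a : ℂ} : -a ∈ lat τ ↔ a ∈ lat τ :=
  ⟨fun h => by simpa using lat_neg h, lat_neg⟩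
lemma lat_sub {τ a b : ℂ} (ha : a ∈ lat τ) (hb : b ∈ lat τ) : a - b ∈ lat τ := by
  rw [sub_eq_add_neg]; exact lat_add ha (lat_neg hb)
lemma lat_add_iff {τ a l : ℂ} (hl : l ∈ lat τ) : a + l ∈ lat τ ↔ a ∈ lat τ :=
  ⟨fun h => by simpa using lat_sub h hl, fun h => lat_add h hl⟩
lemma lat_sub_iff {τ a l : ℂ} (hl : l ∈ lat τ) : a - l ∈ lat τ ↔ a ∈ lat τ :=
  ⟨fun h => by simpa using lat_add h hl, fun h => lat_sub h hl⟩

lemma lat_closed (h : UP τ) : IsClosed (lat τ) := by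
  have : lat τ = ((LP τ h).lattice : Set ℂ) := by ext z; exact (mem_LP h).symm
  rw [this]; exact (LP τ h).isClosed_lattice

lemma lat_countable (τ : ℂ) : (lat τ).Countable := by
  have : lat τ = range (fun p : ℤ × ℤ => (p.1 : ℂ) + (p.2 : ℂ) * τ) := by
    ext z; simp [lat, eq_comm]
  rw [this]; exact countable_range _

lemma lat_punct (h : UP τ) (z : ℂ) : ∀ᶠ w in 𝓝 z, w ∈ lat τ → w = z := by
  filter_upwards [(LP τ h).compl_lattice_sdiff_singleton_mem_nhds z] with w hw hl
  by_contra hne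
  exact hw ⟨(mem_LP h).2 hl, hne⟩

lemma latPt_mem (τ : ℂ) (p : ℤ × ℤ) : latPt τ p ∈ lat τ := ⟨p.1, p.2, rfl⟩

lemma latPt_ne (h : UP τ) (p : {p : ℤ × ℤ // p ≠ 0}) : latPt τ p.1 ≠ 0 := by
  intro h0
  have h1 := congrArg Complex.im h0
  have h2 := congrArg Complex.re h0
  simp [latPt] at h1 h2
  apply p.2
  have : (p.1.2 : ℝ) = 0 := by
    rcases h1 with h1 | h1
    · exact_mod_cast h1
    · exact absurd h1 h.ne'
  have h3 : p.1.2 = 0 := by exact_mod_cast this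
  rw [h3] at h2
  simp at h2
  exact Prod.ext h2 h3

lemma latPt_inj (h : UP τ) : Function.Injective (latPt τ) := by
  intro p q hpq
  by_contra hne
  have := latPt_ne h ⟨p - q, sub_ne_zero.2 hne⟩
  apply this
  simp only [latPt] at hpq ⊢
  simp
  linear_combination hpq

lemma exists_latPt (hz : z ∈ lat τ) (h0 : z ≠ 0) :
    ∃ p : {p : ℤ × ℤ // p ≠ 0}, latPt τ p.1 = z := by
  obtain ⟨m, n, rfl⟩ := hz
  refine ⟨⟨(m, n), ?_⟩, rfl⟩
  rintro h
  simp only [Prod.mk_eq_zero] at h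
  apply h0; simp [h.1, h.2]

lemma summable_lat3 (h : UP τ) :
    Summable (fun p : {p : ℤ × ℤ // p ≠ 0} => 1 / ‖latPt τ p.1‖ ^ 3) := by
  have h1 := ZLattice.summable_norm_pow_inv (L := (LP τ h).lattice) 3 (by simp)
  have h2 := (h1.comp_injective (LP τ h).latticeEquivProd.symm.injective).comp_injective
    (Subtype.val_injective (p := fun p : ℤ × ℤ => p ≠ 0))
  refine h2.congr fun p => ?_
  simp only [Function.comp]
  rw [Submodule.coe_norm, (LP τ h).latticeEquiv_symm_apply p.1]
  simp [LP, latPt]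

lemma wp_eq (h : UP τ) (z : ℂ) : wp τ z = (LP τ h).weierstrassP z := by
  have h1 := (LP τ h).hasSum_weierstrassP z
  rw [← (LP τ h).latticeEquivProd.symm.toEquiv.hasSum_iff] at h1
  have h2 : HasSum (fun p : ℤ × ℤ => 1 / (z - latPt τ p) ^ 2 - 1 / latPt τ p ^ 2)
      ((LP τ h).weierstrassP z) := by
    convert h1 using 1
    funext p
    have := (LP τ h).latticeEquiv_symm_apply p
    simp only [LinearEquiv.coe_toEquiv, Function.comp, this]
    simp [LP, latPt]
  rw [← h2.tsum_eq, ← h2.summable.sum_add_tsum_subtype_compl {0}]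
  simp only [wp, Finset.sum_singleton]
  congr 1
  · simp [latPt]
  · rw [← (Equiv.subtypeEquivRight (p := fun x : ℤ × ℤ => x ∉ ({0} : Finset (ℤ × ℤ)))
      (q := fun p => p ≠ 0) (by simp)).tsum_eq]
    rfl

lemma wp_neg (h : UP τ) (z : ℂ) : wp τ (-z) = wp τ z := by
  rw [wp_eq h, wp_eq h, PeriodPair.weierstrassP_neg]

lemma wp_add (h : UP τ) (z : ℂ) (hl : l ∈ lat τ) :
    wp τ (z + l) = wp τ z := by
  rw [wp_eq h, wp_eq h]
  exact (LP τ h).weierstrassP_add_coe z ⟨l, (mem_LP h).2 hl⟩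

lemma lat_far (h : UP τ) (z0 : ℂ) (hz : z0 ∈ lat τ → z0 = 0) :
    ∃ r > 0, ∃ c > 0, ∃ M > 0, ∀ z ∈ ball z0 r, ‖z‖ ≤ M ∧
      ∀ p : {p : ℤ × ℤ // p ≠ 0}, c * ‖latPt τ p.1‖ ≤ ‖z - latPt τ p.1‖ := by
  obtain ⟨ε, he, hb⟩ := Metric.eventually_nhds_iff.1 (lat_punct h z0)
  refine ⟨ε / 2, by positivity, (1 + (‖z0‖ + ε) / (ε / 2))⁻¹, by positivity, ‖z0‖ + ε, by positivity,
    fun z hz' => ?_⟩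
  have hzd : ‖z - z0‖ < ε / 2 := by rwa [← dist_eq_norm, ← mem_ball]
  have hM : ‖z‖ ≤ ‖z0‖ + ε := by
    have := norm_add_le (z - z0) z0
    simp at this; linarith
  refine ⟨hM, fun p => ?_⟩
  rw [inv_mul_le_iff₀ (by positivity)]
  have h1 : ε / 2 ≤ ‖z - latPt τ p.1‖ := by
    by_contra! hlt
    have h2 : dist (latPt τ p.1) z0 < ε := by
      rw [dist_eq_norm]
      have := norm_add_le (z - z0) (-(z - latPt τ p.1))
      rw [norm_neg] at this
      calc _ = ‖z - z0 + -(z - latPt τ p.1)‖ := by congr 1; ring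
        _ < ε := by linarith
    have h3 := hb h2 (latPt_mem τ p.1)
    have h4 := hz (h3 ▸ latPt_mem τ p.1)
    exact latPt_ne h p (h3.trans h4)
  have h2 : ‖latPt τ p.1‖ ≤ ‖z - latPt τ p.1‖ + (‖z0‖ + ε) := by
    have := norm_sub_le z (z - latPt τ p.1)
    simp at this; linarith
  have h3 : ‖z0‖ + ε ≤ (‖z0‖ + ε) / (ε / 2) * ‖z - latPt τ p.1‖ := by
    rw [div_mul_eq_mul_div, le_div_iff₀ (by positivity)]
    gcongr
  linarith

/-- regular part of zeta -/
noncomputable def zh (τ z : ℂ) : ℂ := ∑' p : {p : ℤ × ℤ // p ≠ 0},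
    (1 / (z - latPt τ p.1) + 1 / latPt τ p.1 + z / latPt τ p.1 ^ 2)

lemma zh_aux (h : UP τ) (z0 : ℂ) (hz : z0 ∈ lat τ → z0 = 0) :
    ∃ r > 0, ∃ K, (∀ z ∈ ball z0 r, ∀ p : {p : ℤ × ℤ // p ≠ 0},
      z - latPt τ p.1 ≠ 0 ∧
      ‖1 / (z - latPt τ p.1) + 1 / latPt τ p.1 + z / latPt τ p.1 ^ 2‖
        ≤ K * (1 / ‖latPt τ p.1‖ ^ 3)) := by
  obtain ⟨r, hr, c, hc, M, hM, hb⟩ := lat_far h z0 hz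
  refine ⟨r, hr, M ^ 2 / c, fun z hz' p => ?_⟩
  obtain ⟨h1, h2⟩ := hb z hz'
  have hl := latPt_ne h p
  have hlp : 0 < ‖latPt τ p.1‖ := norm_pos_iff.2 hl
  have h3 : 0 < ‖z - latPt τ p.1‖ := lt_of_lt_of_le (by positivity) (h2 p)
  have h4 : z - latPt τ p.1 ≠ 0 := norm_pos_iff.1 h3
  refine ⟨h4, ?_⟩
  have : 1 / (z - latPt τ p.1) + 1 / latPt τ p.1 + z / latPt τ p.1 ^ 2
      = z ^ 2 / (latPt τ p.1 ^ 2 * (z - latPt τ p.1)) := by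
    field_simp; ring
  rw [this, norm_div, norm_mul, norm_pow, norm_pow]
  calc _ ≤ M ^ 2 / (‖latPt τ p.1‖ ^ 2 * (c * ‖latPt τ p.1‖)) := by
        gcongr; exact h2 p
    _ = _ := by field_simp

lemma zh_hasDerivAt (h : UP τ) (z0 : ℂ) (hz : z0 ∈ lat τ → z0 = 0) :
    HasDerivAt (zh τ) (-(wp τ z0 - 1 / z0 ^ 2)) z0 := by
  obtain ⟨r, hr, K, hb⟩ := zh_aux h z0 hz
  have hs := (summable_lat3 h).mul_left K
  have hd : ∀ p : {p : ℤ × ℤ // p ≠ 0}, ∀ z ∈ ball z0 r, HasDerivAt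
      (fun z => 1 / (z - latPt τ p.1) + 1 / latPt τ p.1 + z / latPt τ p.1 ^ 2)
      (-(1 / (z - latPt τ p.1) ^ 2 - 1 / latPt τ p.1 ^ 2)) z := by
    intro p z hz'
    have h1 := (hb z hz' p).1
    have := ((((hasDerivAt_id z).sub_const (latPt τ p.1)).inv h1).add_const
      (1 / latPt τ p.1)).add ((hasDerivAt_id z).div_const (latPt τ p.1 ^ 2))
    exact this.cg (fun w => by simp) (by simp; ring)
  have hd' : ∀ p : {p : ℤ × ℤ // p ≠ 0}, DifferentiableOn ℂ
      (fun z => 1 / (z - latPt τ p.1) + 1 / latPt τ p.1 + z / latPt τ p.1 ^ 2) (ball z0 r) :=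
    fun p z hz' => (hd p z hz').differentiableAt.differentiableWithinAt
  have h1 := Complex.hasSum_deriv_of_summable_norm hs hd' isOpen_ball
    (fun p w hw => (hb w hw p).2) (mem_ball_self hr)
  have h2 := Complex.differentiableOn_tsum_of_summable_norm hs hd' isOpen_ball
    (fun p w hw => (hb w hw p).2)
  have h3 := (h2.differentiableAt (isOpen_ball.mem_nhds (mem_ball_self hr))).hasDerivAt
  rw [← h1.tsum_eq] at h3
  refine h3.cg (fun w => rfl) ?_
  simp_rw [fun p => (hd p z0 (mem_ball_self hr)).deriv]
  rw [tsum_neg, wp]; ring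

lemma wzeta_eq (τ z : ℂ) : wzeta τ z = 1 / z + zh τ z := rfl

lemma zh_neg (z : ℂ) : zh τ (-z) = -zh τ z := by
  unfold zh
  rw [← tsum_neg]
  rw [← (Equiv.subtypeEquiv (p := fun x : ℤ × ℤ => x ≠ 0) (q := fun p => p ≠ 0)
    (Equiv.neg (ℤ × ℤ)) (by simp)).tsum_eq]
  congr 1
  funext p
  have : latPt τ (-p.1) = -latPt τ p.1 := by simp [latPt]; ring
  simp only [Equiv.subtypeEquiv_apply, Equiv.neg_apply, this]
  rw [show -z - -latPt τ p.1 = -(z - latPt τ p.1) by ring]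
  simp only [div_neg, neg_div, even_two.neg_pow]
  ring

lemma zh_zero : zh τ 0 = 0 := by
  have := zh_neg (τ := τ) 0
  simp at this
  linear_combination this / 2

lemma wzeta_neg (z : ℂ) : wzeta τ (-z) = -wzeta τ z := by
  rw [wzeta_eq, wzeta_eq, zh_neg, div_neg]; ring

lemma zh_analyticAt (h : UP τ) (z0 : ℂ) (hz : z0 ∈ lat τ → z0 = 0) :
    AnalyticAt ℂ (zh τ) z0 := by
  rw [Complex.analyticAt_iff_eventually_differentiableAt]
  filter_upwards [lat_punct h z0] with w hw
  by_cases hw0 : w = z0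
  · subst hw0; exact (zh_hasDerivAt h w hz).differentiableAt
  · exact (zh_hasDerivAt h w fun hl => absurd (hw hl) hw0).differentiableAt

lemma wzeta_hasDerivAt (h : UP τ) (hz : z ∉ lat τ) :
    HasDerivAt (wzeta τ) (-wp τ z) z := by
  have h0 : z ≠ 0 := fun h0 => hz (h0 ▸ lat_zero τ)
  have h1 := zh_hasDerivAt h z fun h' => absurd h' hz
  have := (hasDerivAt_inv h0).add h1
  exact this.cg (fun w => by simp [wzeta_eq]) (by simp; ring)

lemma wzeta_analyticAt (h : UP τ) (hz : z ∉ lat τ) :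
    AnalyticAt ℂ (wzeta τ) z := by
  rw [Complex.analyticAt_iff_eventually_differentiableAt]
  filter_upwards [(lat_closed h).isOpen_compl.mem_nhds hz] with w hw
  exact (wzeta_hasDerivAt h hw).differentiableAt

lemma wp_analyticAt (h : UP τ) (hz : z ∉ lat τ) :
    AnalyticAt ℂ (wp τ) z := by
  have h1 := (wzeta_analyticAt h hz).deriv.neg
  refine h1.congr ?_
  filter_upwards [(lat_closed h).isOpen_compl.mem_nhds hz] with w hw
  simp [(wzeta_hasDerivAt h hw).deriv]

lemma lat_compl_preconn (hT : T.Countable) : IsPreconnected (Tᶜ) := by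
  refine (hT.isConnected_compl_of_one_lt_rank ?_).isPreconnected
  simp [Complex.rank_real_complex]

lemma const_of_deriv_zero (hT : T.Countable) (hc : IsClosed T)
    (hf : ∀ z ∉ T, HasDerivAt f 0 z) {y : ℂ} (hx : x ∉ T) (hy : y ∉ T) : f x = f y := by
  refine hc.isOpen_compl.is_const_of_deriv_eq_zero (lat_compl_preconn hT)
    (fun z hz => (hf z hz).differentiableAt.differentiableWithinAt)
    (fun z hz => (hf z hz).deriv) hx hy

lemma half_notin (h : UP τ) (hmn : ¬ (Even m ∧ Even n)) :
    ((m : ℂ) + n * τ) / 2 ∉ lat τ := by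
  rintro ⟨a, b, hab⟩
  have : latPt τ (m, n) = latPt τ (2 * a, 2 * b) := by
    simp [latPt]; linear_combination 2 * hab
  have := latPt_inj h this
  simp at this
  exact hmn ⟨⟨a, by omega⟩, ⟨b, by omega⟩⟩

lemma one_half_notin (h : UP τ) : (1 / 2 : ℂ) ∉ lat τ := by
  have := half_notin h (m := 1) (n := 0) (by decide)
  simpa using this

lemma tau_half_notin (h : UP τ) : τ / 2 ∉ lat τ := by
  have := half_notin h (m := 0) (n := 1) (by decide)
  simpa using this

lemma wzeta_add_aux (h : UP τ) (hw : w ∈ lat τ) (hw2 : w / 2 ∉ lat τ)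
    (hz : z ∉ lat τ) : wzeta τ (z + w) = wzeta τ z + 2 * wzeta τ (w / 2) := by
  have h1 : ∀ z ∉ lat τ, HasDerivAt (fun z => wzeta τ (z + w) - wzeta τ z) 0 z := by
    intro z hz
    have hz' : z + w ∉ lat τ := by rwa [lat_add_iff hw]
    have := ((wzeta_hasDerivAt h hz').comp_add_const z w).sub (wzeta_hasDerivAt h hz)
    rw [wp_add h z hw] at this
    exact this.cg (fun w => by simp) (by simp)
  have h2 := const_of_deriv_zero (lat_countable τ) (lat_closed h) h1 hz
    (y := -(w / 2)) (by rwa [lat_neg_iff])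
  simp only [wzeta_neg] at h2
  rw [show -(w / 2) + w = w / 2 by ring] at h2
  linear_combination h2

lemma wzeta_add_one (h : UP τ) (hz : z ∉ lat τ) :
    wzeta τ (z + 1) = wzeta τ z + eta1 τ :=
  wzeta_add_aux h (lat_one τ) (one_half_notin h) hz

lemma wzeta_add_tau (h : UP τ) (hz : z ∉ lat τ) :
    wzeta τ (z + τ) = wzeta τ z + eta2 τ :=
  wzeta_add_aux h (lat_tau τ) (tau_half_notin h) hz

def RemAt (E : ℂ → ℂ) (z : ℂ) : Prop := ∃ φ : ℂ → ℂ, AnalyticAt ℂ φ z ∧ E =ᶠ[𝓝[≠] z] φ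

lemma AnalyticAt.remAt (h : AnalyticAt ℂ E z) : RemAt E z :=
  ⟨E, h, Filter.EventuallyEq.rfl⟩

lemma RemAt.congr (h : RemAt E z) (hEF : F =ᶠ[𝓝[≠] z] E) : RemAt F z := by
  obtain ⟨φ, h1, h2⟩ := h
  exact ⟨φ, h1, hEF.trans h2⟩

lemma RemAt.add (h : RemAt E z) (h' : RemAt F z) :
    RemAt (fun w => E w + F w) z := by
  obtain ⟨φ, h1, h2⟩ := h
  obtain ⟨φ', h1', h2'⟩ := h'
  exact ⟨fun w => φ w + φ' w, h1.add h1', by filter_upwards [h2, h2'] with w e e'; rw [e, e']⟩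

lemma RemAt.mul (h : RemAt E z) (h' : RemAt F z) :
    RemAt (fun w => E w * F w) z := by
  obtain ⟨φ, h1, h2⟩ := h
  obtain ⟨φ', h1', h2'⟩ := h'
  exact ⟨fun w => φ w * φ' w, h1.mul h1', by filter_upwards [h2, h2'] with w e e'; rw [e, e']⟩

lemma RemAt.sub (h : RemAt E z) (h' : RemAt F z) :
    RemAt (fun w => E w - F w) z := by
  obtain ⟨φ, h1, h2⟩ := h
  obtain ⟨φ', h1', h2'⟩ := h'
  exact ⟨fun w => φ w - φ' w, h1.sub h1', by filter_upwards [h2, h2'] with w e e'; rw [e, e']⟩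

/-- tendsto of a translate on punctured neighbourhoods -/
lemma tendsto_add_punct (z l : ℂ) : Tendsto (fun w => w + l) (𝓝[≠] z) (𝓝[≠] (z + l)) := by
  refine tendsto_nhdsWithin_iff.2 ⟨?_, ?_⟩
  · exact ((continuous_id.add continuous_const).tendsto z).mono_left nhdsWithin_le_nhds
  · filter_upwards [self_mem_nhdsWithin] with w hw
    simpa using hw

lemma tendsto_sub_punct (z l : ℂ) : Tendsto (fun w => w - l) (𝓝[≠] z) (𝓝[≠] (z - l)) := by
  simpa [sub_eq_add_neg] using tendsto_add_punct z (-l)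

lemma tendsto_neg_punct (z : ℂ) : Tendsto (fun w => -w) (𝓝[≠] z) (𝓝[≠] (-z)) := by
  refine tendsto_nhdsWithin_iff.2 ⟨?_, ?_⟩
  · exact (continuous_neg.tendsto z).mono_left nhdsWithin_le_nhds
  · filter_upwards [self_mem_nhdsWithin] with w hw
    simpa using hw

lemma RemAt.comp_sub (h : RemAt E (z - l)) : RemAt (fun w => E (w - l)) z := by
  obtain ⟨φ, h1, h2⟩ := h
  refine ⟨fun w => φ (w - l), ?_, (tendsto_sub_punct z l).eventually h2⟩
  exact AnalyticAt.fun_comp (f := fun w => w - l) h1 (by fun_prop)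

lemma RemAt.comp_neg (h : RemAt E (-z)) : RemAt (fun w => E (-w)) z := by
  obtain ⟨φ, h1, h2⟩ := h
  refine ⟨fun w => φ (-w), ?_, (tendsto_neg_punct z).eventually h2⟩
  exact AnalyticAt.fun_comp (f := fun w => -w) h1 (by fun_prop)

/-- quasi-periodicity off a discrete set -/
def QP (E : ℂ → ℂ) (l c : ℂ) : Prop := ∀ z, ∀ᶠ w in 𝓝[≠] z, E (w + l) = E w + c

lemma QP.add' (h : QP E l c) (h' : QP E l' c') :
    QP E (l + l') (c + c') := by
  intro z
  filter_upwards [h z, (tendsto_add_punct z l).eventually (h' (z + l))] with w h1 h2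
  rw [← add_assoc, h2, h1]; ring

lemma QP.neg' (h : QP E l c) : QP E (-l) (-c) := by
  intro z
  filter_upwards [(tendsto_add_punct z (-l)).eventually (h (z + -l))] with w h1
  simp only [neg_add_cancel_right] at h1
  rw [h1]; ring

lemma QP.int (h : QP E l c) (n : ℤ) : QP E (n * l) (n * c) := by
  induction n using Int.induction_on with
  | zero => intro z; simp
  | succ n ih => have := ih.add' h; push_cast; rw [add_mul, add_mul, one_mul, one_mul]; exact this
  | pred n ih =>
    have := ih.add' h.neg'
    push_cast; rw [sub_mul, sub_mul, one_mul, one_mul, sub_eq_add_neg, sub_eq_add_neg]; exact_mod_cast this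

lemma QP.lat (h1 : QP E 1 c1) (h2 : QP E τ c2) (hl : l ∈ lat τ) :
    ∃ c, QP E l c := by
  obtain ⟨m, n, rfl⟩ := hl
  have := (h1.int m).add' (h2.int n)
  rw [mul_one] at this
  exact ⟨_, this⟩

lemma RemAt.transl (h : RemAt E z) (hq : QP E l c) : RemAt E (z + l) := by
  have h0 : RemAt E (z + l - l) := by simpa using h
  have h1 := h0.comp_sub
  refine (h1.add (F := fun _ => c) (analyticAt_const).remAt).congr ?_
  filter_upwards [(tendsto_sub_punct (z + l) l).eventually (hq (z + l - l))] with w hw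
  simpa using hw

lemma off_lat (h : UP τ) (z : ℂ) : ∀ᶠ w in 𝓝[≠] z, w ∉ lat τ := by
  filter_upwards [(lat_punct h z).filter_mono nhdsWithin_le_nhds, self_mem_nhdsWithin] with w h1 h2 h3
  exact h2 (h1 h3)

lemma off_lat_sub (h : UP τ) (a z : ℂ) : ∀ᶠ w in 𝓝[≠] z, w - a ∉ lat τ :=
  (tendsto_sub_punct z a).eventually (off_lat h (z - a))

lemma ev_lat (h : UP τ) {P : ℂ → Prop} (a b : ℂ)
    (hP : ∀ w, w - a ∉ lat τ → w - b ∉ lat τ → P w) (z : ℂ) : ∀ᶠ w in 𝓝[≠] z, P w := by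
  filter_upwards [off_lat_sub h a z, off_lat_sub h b z] with w h1 h2 using hP w h1 h2

/-- the limit extension -/
noncomputable def lext (E : ℂ → ℂ) (z : ℂ) : ℂ := limUnder (𝓝[≠] z) E

lemma lext_spec (h : RemAt E z) : Tendsto E (𝓝[≠] z) (𝓝 (lext E z)) := by
  obtain ⟨φ, h1, h2⟩ := h
  have : Tendsto E (𝓝[≠] z) (𝓝 (φ z)) :=
    (h1.continuousAt.tendsto.mono_left nhdsWithin_le_nhds).congr' h2.symm
  exact tendsto_nhds_limUnder ⟨_, this⟩

lemma lext_eq (h1 : AnalyticAt ℂ φ z) (h2 : E =ᶠ[𝓝[≠] z] φ) :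
    φ =ᶠ[𝓝 z] lext E := by
  have h3 : ∀ᶠ w in 𝓝 z, E =ᶠ[𝓝[≠] w] φ := by
    rw [EventuallyEq, eventually_nhdsWithin_iff, ← eventually_eventually_nhds] at h2
    filter_upwards [h2] with w hw
    by_cases hwz : w = z
    · subst hwz; rw [EventuallyEq, eventually_nhdsWithin_iff]; exact hw
    · have : ∀ᶠ x in 𝓝 w, x ≠ z := isOpen_ne.mem_nhds hwz
      filter_upwards [(hw.and this).filter_mono nhdsWithin_le_nhds] with x hx
      exact hx.1 hx.2
  filter_upwards [h3, h1.eventually_analyticAt] with w h4 h5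
  have : Tendsto E (𝓝[≠] w) (𝓝 (φ w)) :=
    (h5.continuousAt.tendsto.mono_left nhdsWithin_le_nhds).congr' h4.symm
  exact this.limUnder_eq.symm

lemma lext_analytic (h : RemAt E z) : AnalyticAt ℂ (lext E) z := by
  obtain ⟨φ, h1, h2⟩ := h
  exact h1.congr (lext_eq h1 h2)

lemma lext_punct (h : RemAt E z) : E =ᶠ[𝓝[≠] z] lext E := by
  obtain ⟨φ, h1, h2⟩ := h
  exact h2.trans ((lext_eq h1 h2).filter_mono nhdsWithin_le_nhds)

lemma lext_qp (h : ∀ z, RemAt E z) (hq : QP E l c) (z : ℂ) :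
    lext E (z + l) = lext E z + c := by
  have h1 := (lext_spec (h (z + l))).comp (tendsto_add_punct z l)
  have h2 := (lext_spec (h z)).add_const c
  refine tendsto_nhds_unique h1 (h2.congr' ?_)
  filter_upwards [hq z] with w hw
  simp [hw]

lemma entire_periodic_const (h : UP τ) (hF : Differentiable ℂ F)
    (h1 : ∀ z, F (z + 1) = F z) (h2 : ∀ z, F (z + τ) = F z) (z w : ℂ) : F z = F w := by
  have q1 : QP F 1 0 := fun z => Eventually.of_forall fun w => by simp [h1]
  have q2 : QP F τ 0 := fun z => Eventually.of_forall fun w => by simp [h2]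
  have hr := IsZLattice.isCompact_range_of_periodic (LP τ h).lattice F hF.continuous ?_
  · exact hF.apply_eq_apply_of_bounded hr.isBounded z w
  · intro z l hl
    obtain ⟨m, n, rfl⟩ := (mem_LP h).1 hl
    have := (q1.int m).add' (q2.int n)
    simp only [mul_one, mul_zero, add_zero] at this
    have h3 : ∀ᶠ w in 𝓝[≠] z, F (w + (m + n * τ)) = F w := by simpa using this z
    refine tendsto_nhds_unique (f := fun w => F (w + (m + n * τ))) (l := 𝓝[≠] z) ?_
      (((hF.continuous.tendsto z).mono_left nhdsWithin_le_nhds).congr' ?_)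
    · exact ((hF.continuous.comp (continuous_id.add continuous_const)).tendsto z).mono_left
        nhdsWithin_le_nhds
    · filter_upwards [h3] with w hw using hw.symm

lemma liouville (h : UP τ) (h1 : QP E 1 c1) (h2 : QP E τ c2)
    (hr : ∀ z, RemAt E z) :
    c2 = c1 * τ ∧ ∃ b, (∀ z, lext E z = c1 * z + b) ∧ ∀ z, ∀ᶠ w in 𝓝[≠] z, E w = c1 * w + b := by
  have ha : ∀ z, AnalyticAt ℂ (lext E) z := fun z => lext_analytic (hr z)
  have hd : Differentiable ℂ (lext E) := fun z => (ha z).differentiableAt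
  have hdd : Differentiable ℂ (deriv (lext E)) := fun z => (ha z).deriv.differentiableAt
  have hp : ∀ l c, QP E l c → ∀ z, deriv (lext E) (z + l) = deriv (lext E) z := by
    intro l c hq z
    have e : (fun z => lext E (z + l)) = fun z => lext E z + c := funext (lext_qp hr hq)
    have := congrArg (fun f => deriv f z) e
    simpa [deriv_comp_add_const] using this
  have hc := entire_periodic_const h hdd (hp _ _ h1) (hp _ _ h2)
  set a := deriv (lext E) 0 with ha0
  have hz : ∀ z, lext E z = a * z + lext E 0 := by
    intro z
    have : ∀ w, HasDerivAt (fun w => lext E w - a * w) 0 w := by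
      intro w
      have := (hd w).hasDerivAt.sub ((hasDerivAt_id w).const_mul a)
      refine this.cg (fun w => by simp) ?_
      rw [hc w 0]; simp [ha0]
    have := is_const_of_deriv_eq_zero (fun w => (this w).differentiableAt)
      (fun w => (this w).deriv) z 0
    simp at this; linear_combination this
  have e1 := lext_qp hr h1 0
  have e2 := lext_qp hr h2 0
  rw [hz, hz 0] at e1 e2
  have e3 : c1 = a := by linear_combination -e1
  subst e3
  refine ⟨by linear_combination -e2, _, hz, fun z => ?_⟩
  filter_upwards [lext_punct (hr z)] with w hw
  rw [hw, hz]

/-! sigma -/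

noncomputable def sP (τ z : ℂ) : ℂ := ∏' p : {p : ℤ × ℤ // p ≠ 0},
    ((1 - z / latPt τ p.1) * Complex.exp (z / latPt τ p.1 + z ^ 2 / (2 * latPt τ p.1 ^ 2)))

lemma wsigma_eq (τ z : ℂ) : wsigma τ z = z * sP τ z := rfl

lemma factor_deriv (w : ℂ) : HasDerivAt (fun w : ℂ => (1 - w) * Complex.exp (w + w ^ 2 / 2))
    (-(w ^ 2) * Complex.exp (w + w ^ 2 / 2)) w := by
  have h1 : HasDerivAt (fun w : ℂ => 1 - w) (-1) w := (hasDerivAt_id w).const_sub 1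
  have h2 : HasDerivAt (fun w : ℂ => w + w ^ 2 / 2) (1 + w) w :=
    ((hasDerivAt_id w).add ((hasDerivAt_pow 2 w).div_const 2)).cg (fun _ => rfl) (by simp)
  exact (h1.mul h2.cexp).cg (fun _ => rfl) (by ring)

lemma factor_bound (hw : ‖w‖ ≤ M) :
    ‖(1 - w) * Complex.exp (w + w ^ 2 / 2) - 1‖ ≤ Real.exp (M + M ^ 2 / 2) * ‖w‖ ^ 3 := by
  have hM : 0 ≤ M := (norm_nonneg _).trans hw
  have h := Convex.norm_image_sub_le_of_norm_hasDerivWithin_le (𝕜 := ℂ)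
    (f := fun w : ℂ => (1 - w) * Complex.exp (w + w ^ 2 / 2)) (s := closedBall 0 ‖w‖)
    (C := ‖w‖ ^ 2 * Real.exp (M + M ^ 2 / 2)) (x := 0) (y := w)
    (fun x _ => (factor_deriv x).hasDerivWithinAt) ?_ (convex_closedBall _ _) (by simp) (by simp)
  · simp only [sub_zero, ne_eq, OfNat.ofNat_ne_zero, not_false_eq_true, zero_pow, zero_div, add_zero,
      Complex.exp_zero, mul_one] at h
    calc _ ≤ _ := h
      _ = _ := by ring
  · intro x hx
    have hx : ‖x‖ ≤ ‖w‖ := by simpa using hx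
    rw [norm_mul, norm_neg, norm_pow]
    gcongr
    rw [Complex.norm_exp]
    apply Real.exp_le_exp.2
    calc _ ≤ ‖x + x ^ 2 / 2‖ := Complex.re_le_norm _
      _ ≤ ‖x‖ + ‖x‖ ^ 2 / 2 := by
        refine (norm_add_le _ _).trans ?_
        simp
      _ ≤ _ := by
        have := hx.trans hw
        gcongr

lemma sP_bound (h : UP τ) (r : ℝ) : ∃ K, ∀ z ∈ ball (0:ℂ) r, ∀ p : {p : ℤ × ℤ // p ≠ 0},
    ‖(1 - z / latPt τ p.1) * Complex.exp (z / latPt τ p.1 + z ^ 2 / (2 * latPt τ p.1 ^ 2)) - 1‖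
      ≤ K * (1 / ‖latPt τ p.1‖ ^ 3) := by
  obtain ⟨r', hr', c, hc, M, hM, hb⟩ := lat_far h 0 (fun _ => rfl)
  obtain ⟨δ, hδ, hδ'⟩ : ∃ δ > 0, ∀ p : {p : ℤ × ℤ // p ≠ 0}, δ ≤ ‖latPt τ p.1‖ := by
    obtain ⟨ε, he, hb⟩ := Metric.eventually_nhds_iff.1 (lat_punct h 0)
    refine ⟨ε, he, fun p => ?_⟩
    by_contra! hlt
    exact latPt_ne h p (hb (by simpa using hlt) (latPt_mem τ p.1))
  refine ⟨Real.exp (r / δ + (r / δ) ^ 2 / 2) * r ^ 3, fun z hz p => ?_⟩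
  have hz : ‖z‖ < r := by simpa using hz
  have hr : 0 < r := (norm_nonneg _).trans_lt hz
  have hl := latPt_ne h p
  have hlp : 0 < ‖latPt τ p.1‖ := norm_pos_iff.2 hl
  have h1 : ‖z / latPt τ p.1‖ ≤ r / δ := by
    rw [norm_div]; gcongr; exact hδ' p
  have h2 := factor_bound h1
  rw [show z ^ 2 / (2 * latPt τ p.1 ^ 2) = (z / latPt τ p.1) ^ 2 / 2 by field_simp]
  refine h2.trans ?_
  rw [norm_div, div_pow ‖z‖, mul_assoc, mul_one_div]
  have := hz.le
  gcongr

lemma sfac_diff (p : {p : ℤ × ℤ // p ≠ 0}) : Differentiable ℂ (fun z => 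
    (1 - z / latPt τ p.1) * Complex.exp (z / latPt τ p.1 + z ^ 2 / (2 * latPt τ p.1 ^ 2))) := by
  fun_prop

lemma prod_aux {ι : Type} {f : ι → ℂ → ℂ} {u : ι → ℝ} {U : Set ℂ} (hU : IsOpen U) (hu : Summable u)
    (hb : ∀ z ∈ U, ∀ i, ‖f i z - 1‖ ≤ u i) (hf : ∀ i, Differentiable ℂ (f i)) :
    HasProdLocallyUniformlyOn f (fun z => ∏' i, f i z) U := by
  have := Summable.hasProdLocallyUniformlyOn_one_add (K := U) hU hu
    (f := fun i z => f i z - 1) (Eventually.of_forall fun p x hx => hb x hx p)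
    (fun p => ((hf p).sub_const 1).continuous.continuousOn)
  simp only [add_sub_cancel] at this
  exact this

lemma sP_prod (h : UP τ) (r : ℝ) : HasProdLocallyUniformlyOn
    (fun (p : {p : ℤ × ℤ // p ≠ 0}) z =>
    (1 - z / latPt τ p.1) * Complex.exp (z / latPt τ p.1 + z ^ 2 / (2 * latPt τ p.1 ^ 2)))
    (sP τ) (ball 0 r) := by
  obtain ⟨K, hK⟩ := sP_bound h r
  exact prod_aux isOpen_ball ((summable_lat3 h).mul_left K) hK sfac_diff

lemma sP_diff (h : UP τ) : Differentiable ℂ (sP τ) := by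
  intro z
  have h1 := hasProdLocallyUniformlyOn_iff_tendstoLocallyUniformlyOn.1 (sP_prod h (‖z‖ + 1))
  have h2 := h1.differentiableOn (Eventually.of_forall fun s => ?_) isOpen_ball
  · exact h2.differentiableAt (isOpen_ball.mem_nhds (by simp))
  · exact DifferentiableOn.fun_finsetProd fun p _ => (sfac_diff p).differentiableOn

lemma sP_ne (h : UP τ) (hz : z ∈ lat τ → z = 0) : sP τ z ≠ 0 := by
  obtain ⟨K, hK⟩ := sP_bound h (‖z‖ + 1)
  have := tprod_one_add_ne_zero_of_summable (R := ℂ)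
    (f := fun p : {p : ℤ × ℤ // p ≠ 0} => (1 - z / latPt τ p.1) *
      Complex.exp (z / latPt τ p.1 + z ^ 2 / (2 * latPt τ p.1 ^ 2)) - 1) ?_ ?_
  · simp only [add_sub_cancel] at this
    exact this
  · intro p
    rw [add_sub_cancel]
    refine mul_ne_zero ?_ (Complex.exp_ne_zero _)
    have hl := latPt_ne h p
    intro h0
    have h1 : z = latPt τ p.1 := by
      field_simp at h0
      linear_combination -h0
    have := hz (h1 ▸ latPt_mem τ p.1)
    exact hl (h1 ▸ this)
  · exact Summable.of_nonneg_of_le (fun _ => norm_nonneg _) (hK z (by simp))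
      ((summable_lat3 h).mul_left K)

lemma sP_logDeriv (h : UP τ) (hz : z ∈ lat τ → z = 0) :
    deriv (sP τ) z = zh τ z * sP τ z := by
  have hl := latPt_ne h
  have hne : ∀ p : {p : ℤ × ℤ // p ≠ 0}, z - latPt τ p.1 ≠ 0 := by
    intro p h0
    have h1 : z = latPt τ p.1 := by linear_combination h0
    have := hz (h1 ▸ latPt_mem τ p.1)
    exact hl p (h1 ▸ this)
  have hlog : ∀ p : {p : ℤ × ℤ // p ≠ 0}, logDeriv (fun z => (1 - z / latPt τ p.1) *
      Complex.exp (z / latPt τ p.1 + z ^ 2 / (2 * latPt τ p.1 ^ 2))) z =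
      1 / (z - latPt τ p.1) + 1 / latPt τ p.1 + z / latPt τ p.1 ^ 2 := by
    intro p
    have hl := hl p
    have hne := hne p
    have hne' : latPt τ p.1 - z ≠ 0 := by intro h0; apply hne; linear_combination -h0
    have h1 := (factor_deriv (z / latPt τ p.1)).comp z ((hasDerivAt_id z).div_const (latPt τ p.1))
    have h2 : HasDerivAt (fun z => (1 - z / latPt τ p.1) *
      Complex.exp (z / latPt τ p.1 + z ^ 2 / (2 * latPt τ p.1 ^ 2))) _ z :=
      h1.cg (fun w => by
        simp only [Function.comp, id]
        rw [show w ^ 2 / (2 * latPt τ p.1 ^ 2) = (w / latPt τ p.1) ^ 2 / 2 by field_simp]) rfl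
    rw [logDeriv_apply, h2.deriv]
    have he := Complex.exp_ne_zero (z / latPt τ p.1 + z ^ 2 / (2 * latPt τ p.1 ^ 2))
    rw [show z ^ 2 / (2 * latPt τ p.1 ^ 2) = (z / latPt τ p.1) ^ 2 / 2 by field_simp] at he ⊢
    have e1 : 1 - z / latPt τ p.1 = (latPt τ p.1 - z) / latPt τ p.1 := by field_simp
    rw [e1]
    have e2 : z - latPt τ p.1 = -(latPt τ p.1 - z) := by ring
    rw [e2]
    field_simp
    ring
  have hsum : Summable fun p : {p : ℤ × ℤ // p ≠ 0} => 
      (1 / (z - latPt τ p.1) + 1 / latPt τ p.1 + z / latPt τ p.1 ^ 2) := by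
    obtain ⟨r, hr, K, hb⟩ := zh_aux h z hz
    exact Summable.of_norm_bounded ((summable_lat3 h).mul_left K)
      (fun p => (hb z (mem_ball_self hr) p).2)
  have := logDeriv_tprod_eq_tsum (s := ball (0:ℂ) (‖z‖ + 1)) isOpen_ball (x := z) (by simp)
    (f := fun (p : {p : ℤ × ℤ // p ≠ 0}) z => (1 - z / latPt τ p.1) *
      Complex.exp (z / latPt τ p.1 + z ^ 2 / (2 * latPt τ p.1 ^ 2))) ?_
      (fun p => (sfac_diff p).differentiableOn) ?_ (sP_prod h _).multipliableLocallyUniformlyOn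
      (sP_ne h hz)
  · simp_rw [hlog] at this
    change logDeriv (sP τ) z = zh τ z at this
    rw [logDeriv_apply] at this
    have h0 := sP_ne h hz
    field_simp at this
    linear_combination this
  · intro p
    refine mul_ne_zero ?_ (Complex.exp_ne_zero _)
    have hl := hl p
    have hne := hne p
    intro h0; apply hne
    field_simp at h0; linear_combination -h0
  · simp_rw [hlog]; exact hsum

lemma wsigma_diff (h : UP τ) : Differentiable ℂ (wsigma τ) :=
  differentiable_id.mul (sP_diff h)

lemma wsigma_ne (h : UP τ) (hz : z ∉ lat τ) : wsigma τ z ≠ 0 :=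
  mul_ne_zero (fun h0 => hz (h0 ▸ lat_zero τ)) (sP_ne h fun h' => absurd h' hz)

lemma wsigma_hasDerivAt (h : UP τ) (hz : z ∉ lat τ) :
    HasDerivAt (wsigma τ) (wzeta τ z * wsigma τ z) z := by
  have h0 : z ≠ 0 := fun h0 => hz (h0 ▸ lat_zero τ)
  have h1 := (hasDerivAt_id z).mul (sP_diff h z).hasDerivAt
  refine h1.cg (fun w => rfl) ?_
  rw [sP_logDeriv h fun h' => absurd h' hz, wzeta_eq, wsigma_eq]
  simp only [id]; field_simp

lemma sP_neg (z : ℂ) : sP τ (-z) = sP τ z := by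
  unfold sP
  rw [← (Equiv.subtypeEquiv (p := fun x : ℤ × ℤ => x ≠ 0) (q := fun p => p ≠ 0)
    (Equiv.neg (ℤ × ℤ)) (by simp)).tprod_eq]
  congr 1
  funext p
  have : latPt τ (-p.1) = -latPt τ p.1 := by simp [latPt]; ring
  simp only [Equiv.subtypeEquiv_apply, Equiv.neg_apply, this]
  simp

lemma wsigma_neg (z : ℂ) : wsigma τ (-z) = -wsigma τ z := by
  rw [wsigma_eq, wsigma_eq, sP_neg]; ring

lemma lat_dense (τ : ℂ) : Dense (lat τ)ᶜ := by
  exact (lat_countable τ).dense_compl ℂ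

lemma wsigma_add_aux (h : UP τ) (hw : w ∈ lat τ) (hw2 : w / 2 ∉ lat τ)
    (hη : η = 2 * wzeta τ (w / 2)) (z : ℂ) :
    wsigma τ (z + w) = -Complex.exp (η * (z + w / 2)) * wsigma τ z := by
  have h1 : ∀ z ∉ lat τ, HasDerivAt
      (fun z => wsigma τ (z + w) / wsigma τ z * Complex.exp (-(η * z))) 0 z := by
    intro z hz
    have hz' : z + w ∉ lat τ := by rwa [lat_add_iff hw]
    have e1 := ((wsigma_hasDerivAt h hz').comp_add_const z w).div (wsigma_hasDerivAt h hz)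
      (wsigma_ne h hz)
    have e2 := ((hasDerivAt_id z).const_mul η).neg.cexp
    refine (e1.mul e2).cg (fun _ => rfl) ?_
    have := wsigma_ne h hz
    rw [wzeta_add_aux h hw hw2 hz, ← hη]
    simp only [Pi.div_apply, Pi.neg_apply, id]
    field_simp
    ring
  have h2 : ∀ z ∉ lat τ, wsigma τ (z + w) = -Complex.exp (η * (z + w / 2)) * wsigma τ z := by
    intro z hz
    have h2 := const_of_deriv_zero (lat_countable τ) (lat_closed h) h1 hz
      (y := -(w / 2)) (by rwa [lat_neg_iff])
    simp only [wsigma_neg] at h2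
    rw [show -(w / 2) + w = w / 2 by ring] at h2
    have e1 := wsigma_ne h hz
    have e2 := wsigma_ne h hw2
    rw [div_neg, div_self e2] at h2
    have e3 : Complex.exp (η * (z + w / 2)) = Complex.exp (-(η * -(w/2))) / Complex.exp (-(η * z)) := by
      rw [← Complex.exp_sub]; congr 1; ring
    rw [e3]
    have e4 := Complex.exp_ne_zero (-(η * z))
    field_simp at h2 ⊢
    linear_combination h2
  have hd := wsigma_diff h
  have hs := hd.continuous
  have c1 : Continuous fun z => wsigma τ (z + w) := by fun_prop
  have c2 : Continuous fun z => -Complex.exp (η * (z + w / 2)) * wsigma τ z := by fun_prop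
  exact congrFun (c1.ext_on (lat_dense τ) c2 fun z hz => h2 z hz) z

lemma wsigma_add_one (h : UP τ) (z : ℂ) :
    wsigma τ (z + 1) = -Complex.exp (eta1 τ * (z + 1 / 2)) * wsigma τ z :=
  wsigma_add_aux h (lat_one τ) (one_half_notin h) rfl z

lemma wsigma_add_tau (h : UP τ) (z : ℂ) :
    wsigma τ (z + τ) = -Complex.exp (eta2 τ * (z + τ / 2)) * wsigma τ z :=
  wsigma_add_aux h (lat_tau τ) (tau_half_notin h) rfl z

lemma legendre (h : UP τ) :
    ∃ n : ℤ, n ≠ 0 ∧ eta1 τ * τ - eta2 τ = 2 * Real.pi * Complex.I * n := by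
  have hz := one_half_notin h
  have h0 := wsigma_ne h hz
  have e1 := wsigma_add_tau h (1 / 2 + 1)
  have e2 := wsigma_add_one h (1 / 2 + τ)
  rw [wsigma_add_one h (1 / 2)] at e1
  rw [wsigma_add_tau h (1 / 2), show (1 / 2 + τ + 1 : ℂ) = 1 / 2 + 1 + τ by ring, e1] at e2
  have e3 : Complex.exp (eta2 τ * (1 / 2 + 1 + τ / 2) + eta1 τ * (1 / 2 + 1 / 2)) =
      Complex.exp (eta1 τ * (1 / 2 + τ + 1 / 2) + eta2 τ * (1 / 2 + τ / 2)) := by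
    rw [Complex.exp_add, Complex.exp_add]
    apply mul_right_cancel₀ h0
    linear_combination e2
  obtain ⟨n, hn⟩ := Complex.exp_eq_exp_iff_exists_int.1 e3
  refine ⟨-n, ?_, by push_cast; linear_combination -hn⟩
  intro hn0
  have hη : eta2 τ = eta1 τ * τ := by
    have : n = 0 := by omega
    rw [this] at hn; push_cast at hn; linear_combination hn
  have hd := wsigma_diff h
  have := entire_periodic_const h
    (F := fun z => (wsigma τ z * Complex.exp (-(eta1 τ * z ^ 2 / 2))) ^ 2) (by fun_prop) ?_ ?_ (1 / 2) 0
  · simp [wsigma_eq τ 0] at this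
    rw [one_div] at h0
    exact h0 this
  · intro z
    rw [wsigma_add_one h]
    have : Complex.exp (-(eta1 τ * (z + 1) ^ 2 / 2)) =
      Complex.exp (-(eta1 τ * z ^ 2 / 2)) / Complex.exp (eta1 τ * (z + 1 / 2)) := by
      rw [← Complex.exp_sub]; congr 1; ring
    rw [this]
    have := Complex.exp_ne_zero (eta1 τ * (z + 1 / 2))
    field_simp
  · intro z
    rw [wsigma_add_tau h, hη]
    have : Complex.exp (-(eta1 τ * (z + τ) ^ 2 / 2)) =
      Complex.exp (-(eta1 τ * z ^ 2 / 2)) / Complex.exp (eta1 τ * τ * (z + τ / 2)) := by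
      rw [← Complex.exp_sub]; congr 1; ring
    rw [this]
    have := Complex.exp_ne_zero (eta1 τ * τ * (z + τ / 2))
    field_simp

lemma rem_div (hg : AnalyticAt ℂ g a) (h0 : g a = 0) :
    ∃ φ : ℂ → ℂ, AnalyticAt ℂ φ a ∧ φ a = deriv g a ∧ ∀ z, g z = (z - a) * φ z := by
  refine ⟨dslope g a, (let ⟨_, hp⟩ := hg; ⟨_, hp.has_fpower_series_dslope_fslope⟩), dslope_same _ _, fun z => ?_⟩
  have := sub_smul_dslope g a z
  simp [h0] at this
  exact this.symm

noncomputable def ph (τ z : ℂ) : ℂ := wp τ z - 1 / z ^ 2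

lemma wp_ph (τ z : ℂ) : wp τ z = 1 / z ^ 2 + ph τ z := by rw [ph]; ring

lemma ph_eq (h : UP τ) (hz : z ∈ lat τ → z = 0) :
    ph τ z = -deriv (zh τ) z := by
  rw [(zh_hasDerivAt h z hz).deriv, ph]; ring

lemma ph_analyticAt (h : UP τ) : AnalyticAt ℂ (ph τ) 0 := by
  refine (zh_analyticAt h 0 fun _ => rfl).deriv.neg.congr ?_
  filter_upwards [lat_punct h 0] with w hw
  simp [ph_eq h hw]

lemma ph_zero : ph τ 0 = 0 := by simp [ph, wp]

lemma ellRem (T : Set ℂ) (h1 : QP E 1 c1) (h2 : QP E τ c2)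
    (hA : ∀ z, (∀ a ∈ T, z - a ∉ lat τ) → RemAt E z) (hB : ∀ a ∈ T, RemAt E a) (z : ℂ) :
    RemAt E z := by
  by_cases hz : ∀ a ∈ T, z - a ∉ lat τ
  · exact hA z hz
  · push Not at hz
    obtain ⟨a, ha, hl⟩ := hz
    obtain ⟨c, hc⟩ := h1.lat h2 hl
    have := (hB a ha).transl hc
    simpa using this

lemma QP.sub (h : QP E l c) (h' : QP F l c') :
    QP (fun z => E z - F z) l (c - c') := by
  intro z
  filter_upwards [h z, h' z] with w a b
  rw [a, b]; ring

lemma QP.cmul (h : QP E l c) (r : ℂ) : QP (fun z => r * E z) l (r * c) := by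
  intro z
  filter_upwards [h z] with w a
  rw [a]; ring

lemma QP.shift (h : QP E l c) (a : ℂ) : QP (fun z => E (z - a)) l c := by
  intro z
  filter_upwards [(tendsto_sub_punct z a).eventually (h (z - a))] with w hw
  rw [← hw]; congr 1; ring

lemma zeta_qp1 (h : UP τ) : QP (wzeta τ) 1 (eta1 τ) := fun z => by
  filter_upwards [off_lat h z] with w hw using wzeta_add_one h hw

lemma zeta_qp2 (h : UP τ) : QP (wzeta τ) τ (eta2 τ) := fun z => by
  filter_upwards [off_lat h z] with w hw using wzeta_add_tau h hw

lemma an_sub (h : AnalyticAt ℂ f (z - a)) :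
    AnalyticAt ℂ (fun w => f (w - a)) z :=
  AnalyticAt.fun_comp (f := fun w => w - a) h (by fun_prop)

lemma an_add (h : AnalyticAt ℂ f (z + a)) :
    AnalyticAt ℂ (fun w => f (w + a)) z :=
  AnalyticAt.fun_comp (f := fun w => w + a) h (by fun_prop)

/-- lambda -/
noncomputable def lam (τ u v : ℂ) : ℂ := wzeta τ (u + v) - wzeta τ u - wzeta τ v

lemma lext_of_analytic (h1 : AnalyticAt ℂ φ z) (h2 : E =ᶠ[𝓝[≠] z] φ) :
    lext E z = φ z := (lext_eq h1 h2).self_of_nhds.symm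

lemma qp_of_all (h : UP τ) (a b : ℂ)
    (hE : ∀ w, w - a ∉ lat τ → w - b ∉ lat τ → E (w + l) = E w + c) : QP E l c :=
  ev_lat h a b hE

lemma FS (h : UP τ) {u v : ℂ} (hu : u ∉ lat τ) (hv : v ∉ lat τ) (huv : u + v ∉ lat τ) :
    lam τ u v ^ 2 = wp τ u + wp τ v + wp τ (u + v) := by
  set E : ℂ → ℂ := fun u => lam τ u v ^ 2 - wp τ u - wp τ v - wp τ (u + v) with hE
  have hp : ∀ l η, l ∈ lat τ → (∀ z ∉ lat τ, wzeta τ (z + l) = wzeta τ z + η) → QP E l 0 := by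
    intro l η hl hz
    refine qp_of_all h 0 (-v) fun w h1 h2 => ?_
    simp only [sub_zero, sub_neg_eq_add] at h1 h2
    simp only [hE, lam]
    rw [show w + l + v = w + v + l by ring, hz _ h1, hz _ h2, wp_add h _ hl, wp_add h _ hl]; ring
  have q1 := hp 1 _ (lat_one τ) fun z hz => wzeta_add_one h hz
  have q2 := hp τ _ (lat_tau τ) fun z hz => wzeta_add_tau h hz
  have hsym : ∀ u, E (-v - u) = E u := by
    intro u
    simp only [hE, lam]
    rw [show -v - u + v = -u by ring, show -v - u = -(u + v) by ring, wzeta_neg, wzeta_neg,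
      wp_neg h, wp_neg h]
    ring
  have hz0 : ∃ φ : ℂ → ℂ, AnalyticAt ℂ φ 0 ∧ E =ᶠ[𝓝[≠] 0] φ ∧ φ 0 = 0 := by
    have hv0 : 0 + v ∉ lat τ := by simpa using hv
    have a1 : AnalyticAt ℂ (fun u => wzeta τ (u + v) - wzeta τ v - zh τ u) 0 :=
      ((an_add (wzeta_analyticAt h hv0)).sub analyticAt_const).sub (zh_analyticAt h 0 fun _ => rfl)
    obtain ⟨φ, p1, p2, p3⟩ := rem_div a1 (by simp [zh_zero])
    have hd : HasDerivAt (fun u => wzeta τ (u + v) - wzeta τ v - zh τ u) (-wp τ v) 0 := by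
      have e1 := ((wzeta_hasDerivAt h hv0).comp_add_const 0 v).sub_const (wzeta τ v)
      have e2 := e1.sub (zh_hasDerivAt h 0 fun _ => rfl)
      refine e2.cg (fun _ => rfl) ?_
      simp [wp]
    rw [hd.deriv] at p2
    refine ⟨fun u => (u * φ u) ^ 2 - 2 * φ u - ph τ u - wp τ v - wp τ (u + v), ?_, ?_, ?_⟩
    · have := ph_analyticAt h
      have := an_add (wp_analyticAt h hv0)
      fun_prop
    · filter_upwards [self_mem_nhdsWithin] with u hu
      have hu : u ≠ 0 := hu
      have := p3 u
      simp only [hE, lam]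
      rw [show wzeta τ (u + v) - wzeta τ u - wzeta τ v = u * φ u - 1 / u by
        rw [wzeta_eq τ u]; linear_combination this, wp_ph τ u]
      field_simp; ring
    · simp [ph_zero, p2]
      ring
  obtain ⟨φ, p1, p2, p3⟩ := hz0
  have hr := ellRem {0, -v} q1 q2 ?_ ?_
  · obtain ⟨-, b, hb, -⟩ := liouville h q1 q2 hr
    have e1 : b = 0 := by
      have := hb 0
      rw [lext_of_analytic p1 p2, p3] at this
      simpa using this.symm
    have a2 : AnalyticAt ℂ E u := by
      have := wzeta_analyticAt h hu
      have := an_add (wzeta_analyticAt h huv)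
      have := wp_analyticAt h hu
      have := an_add (wp_analyticAt h huv)
      simp only [hE, lam]
      fun_prop
    have := hb u
    rw [lext_of_analytic a2 EventuallyEq.rfl, e1] at this
    simp only [hE] at this
    linear_combination this
  · intro z hz
    have z1 : z ∉ lat τ := by simpa using hz 0 (by simp)
    have z2 : z + v ∉ lat τ := by simpa using hz (-v) (by simp)
    have := wzeta_analyticAt h z1
    have := an_add (wzeta_analyticAt h z2)
    have := wp_analyticAt h z1
    have := an_add (wp_analyticAt h z2)
    have : AnalyticAt ℂ E z := by
      simp only [hE, lam]
      fun_prop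
    exact this.remAt
  · rintro a (rfl | rfl)
    · exact ⟨φ, p1, p2⟩
    · have r0 : RemAt E 0 := ⟨φ, p1, p2⟩
      have r1 : RemAt E (-(-v) - v) := by simpa using r0
      have : RemAt (fun w => E (-w - v)) (-v) := by
        have := (RemAt.comp_sub r1).comp_neg (z := -v)
        exact this
      refine this.congr (Eventually.of_forall fun z => ?_)
      dsimp only
      rw [← hsym z]; congr 1; ring

lemma FS' (h : UP τ) {u v : ℂ} (hu : u ∉ lat τ) (hv : v ∉ lat τ) (huv : u + v ∉ lat τ) :
    2 * lam τ u v * (wp τ u - wp τ v) = deriv (wp τ) u - deriv (wp τ) v := by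
  have key : ∀ u v, u ∉ lat τ → v ∉ lat τ → u + v ∉ lat τ →
      2 * lam τ u v * (wp τ u - wp τ (u + v)) = deriv (wp τ) u + deriv (wp τ) (u + v) := by
    intro u v hu hv huv
    have d1 : HasDerivAt (fun u => lam τ u v ^ 2) (2 * lam τ u v * (wp τ u - wp τ (u + v))) u := by
      have e1 := (((wzeta_hasDerivAt h huv).comp_add_const u v).sub
        (wzeta_hasDerivAt h hu)).sub_const (wzeta τ v)
      exact (e1.fun_pow 2).cg (fun _ => rfl) (by
        simp only [lam, Nat.cast_ofNat, Nat.add_one_sub_one, pow_one, Pi.sub_apply]; ring)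
    have d2 : HasDerivAt (fun u => wp τ u + wp τ v + wp τ (u + v))
        (deriv (wp τ) u + deriv (wp τ) (u + v)) u :=
      ((wp_analyticAt h hu).differentiableAt.hasDerivAt.add_const _).add
        ((wp_analyticAt h huv).differentiableAt.hasDerivAt.comp_add_const u v)
    refine d1.unique (d2.congr_of_eventuallyEq ?_)
    have o1 := (lat_closed h).isOpen_compl.mem_nhds hu
    have o2 : ∀ᶠ w in 𝓝 u, w + v ∉ lat τ :=
      (continuous_id.add continuous_const).continuousAt.eventually
        ((lat_closed h).isOpen_compl.mem_nhds huv)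
    filter_upwards [o1, o2] with w w1 w2
    exact FS h w1 hv w2
  have k1 := key u v hu hv huv
  have k2 := key v u hv hu (by rwa [add_comm])
  have : lam τ v u = lam τ u v := by simp [lam, add_comm v u]; ring
  rw [this, add_comm v u] at k2
  linear_combination k1 - k2

lemma wpd_neg (h : UP τ) (z : ℂ) : deriv (wp τ) (-z) = -deriv (wp τ) z := by
  have : wp τ = fun z => wp τ (-z) := funext fun z => (wp_neg h z).symm
  have e := congrArg (fun f => deriv f z) this
  simp only [deriv_comp_neg] at e
  rw [e]; ring

lemma wpd_half (h : UP τ) (h2 : 2 * ω ∈ lat τ) : deriv (wp τ) ω = 0 := by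
  have : wp τ = fun z => wp τ (z + 2 * ω) := funext fun z => (wp_add h z h2).symm
  have e := congrArg (fun f => deriv f (-ω)) this
  simp only [deriv_comp_add_const, wpd_neg h] at e
  rw [show -ω + 2 * ω = ω by ring] at e
  linear_combination -e / 2

/-- if the values avoid zero then we have a contradiction -/
lemma zero_exists (h : UP τ) (T : Set ℂ) (h0 : 0 ∈ T)
    (h1 : ∀ z, F (z + 1) = F z) (h2 : ∀ z, F (z + τ) = F z)
    (hF : ∀ z, (∀ a ∈ T, z - a ∉ lat τ) → AnalyticAt ℂ F z)
    (hT : ∀ a ∈ T, ∃ φ : ℂ → ℂ, AnalyticAt ℂ φ a ∧ φ a ≠ 0 ∧ F =ᶠ[𝓝[≠] a] fun z => φ z / (z - a) ^ 2) :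
    ∃ z, (∀ a ∈ T, z - a ∉ lat τ) ∧ F z = 0 := by
  by_contra! hne
  have q1 : QP (fun z => (F z)⁻¹) 1 0 := fun z => Eventually.of_forall fun w => by simp [h1]
  have q2 : QP (fun z => (F z)⁻¹) τ 0 := fun z => Eventually.of_forall fun w => by simp [h2]
  have hT' : ∀ a ∈ T, ∃ ψ : ℂ → ℂ, AnalyticAt ℂ ψ a ∧ ψ a = 0 ∧ (fun z => (F z)⁻¹) =ᶠ[𝓝[≠] a] ψ := by
    intro a ha
    obtain ⟨φ, p1, p2, p3⟩ := hT a ha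
    refine ⟨fun z => (z - a) ^ 2 * (φ z)⁻¹, ?_, by simp, ?_⟩
    · have := p1.inv p2
      fun_prop
    · filter_upwards [p3] with w hw
      rw [hw]; simp [div_eq_mul_inv, mul_comm]
  have hr := ellRem T q1 q2 (fun z hz => ((hF z hz).inv (hne z hz)).remAt)
    (fun a ha => let ⟨ψ, x, _, y⟩ := hT' a ha; ⟨ψ, x, y⟩)
  obtain ⟨-, b, hb, hb'⟩ := liouville h q1 q2 hr
  obtain ⟨ψ, x, y, y'⟩ := hT' 0 h0
  have e1 : b = 0 := by
    have := hb 0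
    rw [lext_of_analytic x y', y] at this
    simpa using this.symm
  obtain ⟨φ, p1, p2, p3⟩ := hT 0 h0
  obtain ⟨w, w1, w2, w3, w4⟩ := ((hb' 0).and (p3.and (((p1.continuousAt.eventually_ne p2).filter_mono
    nhdsWithin_le_nhds).and self_mem_nhdsWithin))).exists
  rw [e1] at w1
  simp only [zero_mul, add_zero, inv_eq_zero] at w1
  rw [w2] at w1
  have : w ≠ 0 := w4
  simp [w3, this] at w1

lemma wp_pole (h : UP τ) (c : ℂ) : ∃ φ : ℂ → ℂ, AnalyticAt ℂ φ 0 ∧ φ 0 ≠ 0 ∧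
    (fun z => wp τ z - c) =ᶠ[𝓝[≠] 0] fun z => φ z / (z - 0) ^ 2 := by
  refine ⟨fun z => 1 + z ^ 2 * (ph τ z - c), ?_, by simp, ?_⟩
  · have := ph_analyticAt h
    fun_prop
  · filter_upwards [self_mem_nhdsWithin] with z hz
    have hz : z ≠ 0 := hz
    rw [wp_ph]; field_simp; ring_nf

lemma wp_surj (h : UP τ) (c : ℂ) : ∃ z ∉ lat τ, wp τ z = c := by
  have key := zero_exists h (F := fun z => wp τ z - c) {0} rfl
    (fun z => by simp [wp_add h z (lat_one τ)]) (fun z => by simp [wp_add h z (lat_tau τ)]) ?_ ?_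
  · obtain ⟨z, hz, hz'⟩ := key
    exact ⟨z, by simpa using hz, sub_eq_zero.1 hz'⟩
  · intro z hz
    exact (wp_analyticAt h (by simpa using hz)).sub analyticAt_const
  · rintro a rfl
    exact wp_pole h c

lemma exists_pair (h : UP τ) (hA : A ∉ lat τ) (c : ℂ) :
    ∃ a ∉ lat τ, A - a ∉ lat τ ∧ wp τ a + wp τ (A - a) = c := by
  have hpole : ∃ φ : ℂ → ℂ, AnalyticAt ℂ φ 0 ∧ φ 0 ≠ 0 ∧
    (fun z => wp τ z + wp τ (A - z) - c) =ᶠ[𝓝[≠] 0] fun z => φ z / (z - 0) ^ 2 := by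
    refine ⟨fun z => 1 + z ^ 2 * (ph τ z + wp τ (A - z) - c), ?_, by simp, ?_⟩
    · have := ph_analyticAt h
      have : AnalyticAt ℂ (fun z => wp τ (A - z)) 0 :=
        AnalyticAt.fun_comp (f := fun z => A - z) (wp_analyticAt h (by simpa using hA)) (by fun_prop)
      fun_prop
    · filter_upwards [self_mem_nhdsWithin] with z hz
      have hz : z ≠ 0 := hz
      rw [wp_ph τ z]; field_simp; ring_nf
  have key := zero_exists h (F := fun z => wp τ z + wp τ (A - z) - c) {0, A} (by simp)
    (fun z => ?_) (fun z => ?_) ?_ ?_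
  · obtain ⟨z, hz, hz'⟩ := key
    refine ⟨z, by simpa using hz 0, ?_, sub_eq_zero.1 hz'⟩
    rw [← lat_neg_iff, neg_sub]
    exact hz A (by simp)
  · rw [wp_add h z (lat_one τ), ← wp_add h (A - (z + 1)) (lat_one τ)]; congr 4; ring
  · rw [wp_add h z (lat_tau τ), ← wp_add h (A - (z + τ)) (lat_tau τ)]; congr 4; ring
  · intro z hz
    have h1 := wp_analyticAt h (z := z) (by simpa using hz 0)
    have : AnalyticAt ℂ (fun z => wp τ (A - z)) z :=
      AnalyticAt.fun_comp (f := fun z => A - z) (wp_analyticAt h (by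
        rw [← lat_neg_iff, neg_sub]
        exact hz A (by simp))) (by fun_prop)
    fun_prop
  · rintro a (rfl | rfl)
    · exact hpole
    · obtain ⟨φ, p1, p2, p3⟩ := hpole
      refine ⟨fun z => φ (a - z), AnalyticAt.fun_comp (f := fun z => a - z) (by simpa using p1)
        (by fun_prop), by simpa using p2, ?_⟩
      have t1 := (tendsto_neg_punct (a - a)).comp (tendsto_sub_punct a a)
      simp only [sub_self, neg_zero] at t1
      filter_upwards [t1.eventually p3] with w hw
      simp only [Function.comp, neg_sub, sub_zero, sub_sub_cancel] at hw
      rw [show (w - a) ^ 2 = (a - w) ^ 2 by ring, ← hw]; ring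

lemma wp_half_inj (h : UP τ) (hω : ω ∉ lat τ) (h2 : 2 * ω ∈ lat τ)
    (ha : a ∉ lat τ) (he : wp τ a = wp τ ω) : a - ω ∈ lat τ := by
  by_contra hne
  have hω' : 0 + ω ∉ lat τ := by simpa using hω
  set x : ℂ → ℂ := fun z => wp τ z - wp τ ω with hx
  have x1 : ∀ {l}, l ∈ lat τ → ∀ z, x (z + l) = x z := fun hl z => by simp [hx, wp_add h z hl]
  have han : ∀ z ∉ lat τ, AnalyticAt ℂ x z := fun z hz => (wp_analyticAt h hz).sub analyticAt_const
  set E : ℂ → ℂ := fun z => x z * x (z + ω) with hE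
  have hp : ∀ l ∈ lat τ, QP E l 0 := fun l hl z => Eventually.of_forall fun w => by
    simp only [hE]; rw [x1 hl, show w + l + ω = w + ω + l by ring, x1 hl]; ring
  have hpω : QP E ω 0 := fun z => Eventually.of_forall fun w => by
    simp only [hE]; rw [show w + ω + ω = w + 2 * ω by ring, x1 h2]; ring
  have r0 : RemAt E 0 := by
    obtain ⟨φ, p1, -, p3⟩ := wp_pole h (wp τ ω)
    obtain ⟨g, g1, g2, g3⟩ := rem_div (an_add (a := ω) (han _ hω')) (by simp [hx])
    obtain ⟨g', g1', g2', g3'⟩ := rem_div g1 (by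
      rw [g2, deriv_comp_add_const]
      have : deriv x (0 + ω) = deriv (wp τ) ω := by simp [hx]
      rw [this, wpd_half h h2])
    refine ⟨fun z => φ z * g' z, p1.mul g1', ?_⟩
    filter_upwards [p3, self_mem_nhdsWithin] with z hz hz0
    have hz0 : z ≠ 0 := hz0
    simp only [hE]
    rw [g3, g3']
    have : x z = φ z / (z - 0) ^ 2 := hz
    rw [this]; simp only [sub_zero]; field_simp
  have q1 := hp 1 (lat_one τ)
  have q2 := hp τ (lat_tau τ)
  have hr := ellRem {0, ω} q1 q2 ?_ ?_
  · obtain ⟨-, b, hb, hb'⟩ := liouville h q1 q2 hr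
    have haω : a + ω ∉ lat τ := fun hl => hne (by
      have := lat_sub hl h2; rwa [show a + ω - 2 * ω = a - ω by ring] at this)
    have e1 : b = 0 := by
      have := hb a
      rw [lext_of_analytic (E := E) (φ := E) ((han a ha).mul (an_add (han _ haω))) EventuallyEq.rfl] at this
      simpa [hE, hx, he] using this.symm
    obtain ⟨φ, p1, p2, p3⟩ := wp_pole h (wp τ ω)
    have n0 : ∀ᶠ w in 𝓝[≠] (0:ℂ), x w ≠ 0 := by
      filter_upwards [p3, (p1.continuousAt.eventually_ne p2).filter_mono nhdsWithin_le_nhds,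
        self_mem_nhdsWithin] with w w1 w2 w3
      have w1 : x w = _ := w1
      have w3 : w ≠ 0 := w3
      rw [w1]; simp [w2, w3]
    have n1 : ∀ᶠ w in 𝓝[≠] (0:ℂ), x (w + ω) = 0 := by
      filter_upwards [n0, hb' 0] with w w1 w2
      simp [hE, e1] at w2
      tauto
    have n2 : ∀ᶠ w in 𝓝[≠] ω, x w = 0 := by
      have := tendsto_sub_punct ω ω
      rw [sub_self] at this
      filter_upwards [this.eventually n1] with w hw
      simpa using hw
    have n3 : EqOn x 0 (lat τ)ᶜ :=
      AnalyticOnNhd.eqOn_zero_of_preconnected_of_frequently_eq_zero (fun z hz => han z hz)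
        (lat_compl_preconn (lat_countable τ)) hω n2.frequently
    obtain ⟨w, w1, w2⟩ := (n0.and (off_lat h 0)).exists
    exact w1 (n3 w2)
  · intro z hz
    have z1 : z ∉ lat τ := by simpa using hz 0 (by simp)
    have z2 : z + ω ∉ lat τ := fun hl => hz ω (by simp) (by
      have := lat_sub hl h2; rwa [show z + ω - 2 * ω = z - ω by ring] at this)
    exact ((han z z1).mul (an_add (han _ z2))).remAt
  · rintro z (rfl | rfl)
    · exact r0
    · simpa using r0.transl hpω

/-- data of the explicit solution -/
structure YD (τ ω a1 a2 : ℂ) (y q : ℂ → ℂ) (μ1 μ2 l ε : ℂ) : Prop where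
  a1n : a1 ∉ lat τ
  a2n : a2 ∉ lat τ
  a1w : a1 - ω ∉ lat τ
  a2w : a2 - ω ∉ lat τ
  xne : wp τ a1 ≠ wp τ a2
  lsq : l ^ 2 = wp τ (a1 + a2) + 2 * wp τ ω
  an : ∀ z, z ∉ lat τ → z - ω ∉ lat τ → AnalyticAt ℂ y z
  ode : ∀ z, z ∉ lat τ → z - ω ∉ lat τ → deriv (deriv y) z = q z * y z
  zer : ∀ z, z ∉ lat τ → z - ω ∉ lat τ → (y z = 0 ↔ z - a1 ∈ lat τ ∨ z - a2 ∈ lat τ)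
  per1 : ∀ z, y (z + 1) = μ1 * y z
  per2 : ∀ z, y (z + τ) = μ2 * y z
  m1 : μ1 = Complex.exp (wzeta τ (a1 + a2) - wzeta τ ω - eta1 τ * (a1 + a2 - ω))
  m2 : μ2 = Complex.exp ((wzeta τ (a1 + a2) - wzeta τ ω) * τ - eta2 τ * (a1 + a2 - ω))
  pole0 : ∃ g : ℂ → ℂ, AnalyticAt ℂ g 0 ∧ g 0 ≠ 0 ∧ ∀ z, y z = g z / z
  polew : ∃ g : ℂ → ℂ, AnalyticAt ℂ g ω ∧ g ω ≠ 0 ∧ ∀ z, y z = g z / (z - ω)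
  qdef : ∀ z, q z = 2 * wp τ z + 2 * wp τ (z - ω) - 2 * l * (wzeta τ z - wzeta τ (z - ω)) + ε
  q0 : ∃ m : ℂ → ℂ, AnalyticAt ℂ m 0 ∧ m 0 = l ∧ ∀ᶠ z in 𝓝[≠] (0:ℂ),
    q z = 2 / z ^ 2 - 2 * m z / z + deriv m z + m z ^ 2

lemma yd_rem {m R : ℂ → ℂ} (hκ : κ ^ 2 = 1) (hm : AnalyticAt ℂ m p)
    (hR : AnalyticAt ℂ R p) (h1 : ∀ z, z ≠ p → ell z = κ / (z - p) + m z)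
    (h2 : ∀ z, z ≠ p → E z = ell z ^ 2 - 1 / (z - p) ^ 2 - 2 * κ * m p / (z - p) + R z) :
    RemAt E p := by
  obtain ⟨φ, p1, -, p3⟩ := rem_div (hm.sub analyticAt_const) (show m p - m p = 0 by ring)
  refine ⟨fun z => 2 * κ * φ z + m z ^ 2 + R z, by fun_prop, ?_⟩
  filter_upwards [self_mem_nhdsWithin] with z hz
  have hz : z ≠ p := hz
  have hz' : z - p ≠ 0 := sub_ne_zero.2 hz
  have e : m z = m p + (z - p) * φ z := by
    have := p3 z; simp only [Pi.sub_apply] at this; linear_combination this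
  rw [h2 z hz, h1 z hz, e]
  field_simp
  linear_combination hκ

set_option maxHeartbeats 1000000 in
lemma ydata (h : UP τ) (hω : ω ∉ lat τ) (h2 : 2 * ω ∈ lat τ)
    (ha1 : a1 ∉ lat τ) (ha2 : a2 ∉ lat τ) (hA : a1 + a2 ∉ lat τ)
    (he : wp τ a1 + wp τ a2 = 2 * wp τ ω) :
    ∃ y q μ1 μ2 ε, YD τ ω a1 a2 y q μ1 μ2 (lam τ a1 a2) ε := by
  have x1 : wp τ a1 ≠ wp τ ω := by
    intro e1
    have e2 : wp τ a2 = wp τ ω := by linear_combination he - e1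
    have := lat_add (lat_add (wp_half_inj h hω h2 ha1 e1) (wp_half_inj h hω h2 ha2 e2)) h2
    exact hA (by rwa [show a1 - ω + (a2 - ω) + 2 * ω = a1 + a2 by ring] at this)
  have x2 : wp τ a2 ≠ wp τ ω := fun e => x1 (by linear_combination he - e)
  have hcong : ∀ a b, a - b ∈ lat τ → wp τ a = wp τ b := by
    intro a b hab
    rw [← wp_add h b hab]; congr 1; ring
  have a1w : a1 - ω ∉ lat τ := fun hl => x1 (hcong _ _ hl)
  have a2w : a2 - ω ∉ lat τ := fun hl => x2 (hcong _ _ hl)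
  have xne : wp τ a1 ≠ wp τ a2 := fun e => x1 (by linear_combination (he + e) / 2)
  have a12 : a1 - a2 ∉ lat τ := fun hl => xne (hcong _ _ hl)
  have nn : ∀ {a b : ℂ}, a - b ∉ lat τ → b - a ∉ lat τ := fun {a b} hab hl => hab (by
    rw [← neg_sub]; exact lat_neg hl)
  have n0 : ∀ {a : ℂ}, a ∉ lat τ → 0 - a ∉ lat τ := fun {a} ha hl => ha (by
    rw [zero_sub, lat_neg_iff] at hl; exact hl)
  have dω : deriv (wp τ) ω = 0 := wpd_half h h2
  have ng : ∀ {a : ℂ}, a ∉ lat τ → -a ∉ lat τ := fun {a} ha => by rwa [lat_neg_iff]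
  -- the addition formulas
  have f12 := FS' h ha1 ha2 hA
  have f1m2 := FS' h ha1 (ng ha2) (by rwa [← sub_eq_add_neg])
  have f2m1 := FS' h ha2 (ng ha1) (by rw [← sub_eq_add_neg]; exact nn a12)
  have f1w := FS' h ha1 (ng hω) (by rwa [← sub_eq_add_neg])
  have f2w := FS' h ha2 (ng hω) (by rwa [← sub_eq_add_neg])
  have fw1 := FS' h hω (ng ha1) (by rw [← sub_eq_add_neg]; exact nn a1w)
  have fw2 := FS' h hω (ng ha2) (by rw [← sub_eq_add_neg]; exact nn a2w)
  simp only [wp_neg h, wpd_neg h, dω] at f12 f1m2 f2m1 f1w f2w fw1 fw2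
  simp only [lam, ← sub_eq_add_neg, wzeta_neg] at f12 f1m2 f2m1 f1w f2w fw1 fw2
  have hw2 : wp τ a2 = 2 * wp τ ω - wp τ a1 := by linear_combination he
  rw [hw2] at f12 f1m2 f2m1 f2w fw2
  have xx : wp τ a1 - wp τ ω ≠ 0 := sub_ne_zero.2 x1
  set c := wzeta τ (a1 + a2) - wzeta τ ω with hc
  set l := lam τ a1 a2 with hl
  have hl' : l = wzeta τ (a1 + a2) - wzeta τ a1 - wzeta τ a2 := rfl
  have N1 : wzeta τ (a1 - a2) - wzeta τ a1 - wzeta τ (a1 - ω) + c = 0 := by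
    refine (mul_eq_zero.1 (?_ : (wp τ a1 - wp τ ω) * _ = 0)).resolve_left xx
    rw [hc]
    linear_combination (f1m2 + f12 - 2 * f1w) / 4
  have N2 : wzeta τ (a2 - a1) - wzeta τ a2 - wzeta τ (a2 - ω) + c = 0 := by
    refine (mul_eq_zero.1 (?_ : (wp τ a1 - wp τ ω) * _ = 0)).resolve_left xx
    rw [hc]
    linear_combination (-f2m1 + f12 + 2 * f2w) / 4
  have N3 : wzeta τ (ω - a1) + wzeta τ (ω - a2) - wzeta τ ω + c = -l := by
    refine sub_eq_zero.1 ((mul_eq_zero.1 (?_ : (wp τ a1 - wp τ ω) * _ = 0)).resolve_left xx)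
    rw [hc, hl']
    linear_combination (-fw1 + fw2) / 2 + f12 / 2
  clear f12 f1m2 f2m1 f1w f2w fw1 fw2
  set ell : ℂ → ℂ := fun z => wzeta τ (z - a1) + wzeta τ (z - a2) - wzeta τ z - wzeta τ (z - ω) + c
    with hell
  set E : ℂ → ℂ := fun z => ell z ^ 2 - wp τ (z - a1) - wp τ (z - a2) - wp τ z - wp τ (z - ω)
    + 2 * l * (wzeta τ z - wzeta τ (z - ω)) with hE
  have zA : ∀ {z a : ℂ}, z - a ∉ lat τ → AnalyticAt ℂ (fun w => wzeta τ (w - a)) z :=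
    fun hz => an_sub (wzeta_analyticAt h hz)
  have pA : ∀ {z a : ℂ}, z - a ∉ lat τ → AnalyticAt ℂ (fun w => wp τ (w - a)) z :=
    fun hz => an_sub (wp_analyticAt h hz)
  have zhA : ∀ a : ℂ, AnalyticAt ℂ (fun w => zh τ (w - a)) a := fun a =>
    an_sub (by rw [sub_self]; exact zh_analyticAt h 0 fun _ => rfl)
  have phA : ∀ a : ℂ, AnalyticAt ℂ (fun w => ph τ (w - a)) a := fun a =>
    an_sub (by rw [sub_self]; exact ph_analyticAt h)
  have hEan : ∀ z, z - a1 ∉ lat τ → z - a2 ∉ lat τ → z ∉ lat τ → z - ω ∉ lat τ →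
      AnalyticAt ℂ E z := by
    intro z z1 z2 z3 z4
    have e1 : AnalyticAt ℂ ell z := ((((zA z1).fun_add (zA z2)).fun_sub
      (wzeta_analyticAt h z3)).fun_sub (zA z4)).fun_add analyticAt_const
    exact (((((e1.fun_pow 2).fun_sub (pA z1)).fun_sub (pA z2)).fun_sub
      (wp_analyticAt h z3)).fun_sub (pA z4)).fun_add
      (analyticAt_const.fun_mul ((wzeta_analyticAt h z3).fun_sub (zA z4)))
  have hellqp : ∀ t η, (∀ z ∉ lat τ, wzeta τ (z + t) = wzeta τ z + η) →
      ∀ w, w - a1 ∉ lat τ → w - a2 ∉ lat τ → w ∉ lat τ → w - ω ∉ lat τ →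
      ell (w + t) = ell w := by
    intro t η hz w z1 z2 z3 z4
    simp only [hell]
    rw [show w + t - a1 = w - a1 + t by ring, show w + t - a2 = w - a2 + t by ring,
      show w + t - ω = w - ω + t by ring, hz _ z1, hz _ z2, hz _ z3, hz _ z4]; ring
  have hEqp : ∀ t η, t ∈ lat τ → (∀ z ∉ lat τ, wzeta τ (z + t) = wzeta τ z + η) → QP E t 0 := by
    intro t η ht hz z
    filter_upwards [off_lat_sub h a1 z, off_lat_sub h a2 z, off_lat h z, off_lat_sub h ω z] with
      w z1 z2 z3 z4
    simp only [hE]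
    rw [hellqp t η hz w z1 z2 z3 z4, show w + t - a1 = w - a1 + t by ring,
      show w + t - a2 = w - a2 + t by ring,
      show w + t - ω = w - ω + t by ring, hz _ z3, hz _ z4, wp_add h _ ht, wp_add h _ ht,
      wp_add h _ ht, wp_add h _ ht]; ring
  have q1 := hEqp 1 _ (lat_one τ) fun z hz => wzeta_add_one h hz
  have q2 := hEqp τ _ (lat_tau τ) fun z hz => wzeta_add_tau h hz
  have m0A : AnalyticAt ℂ (fun z => wzeta τ (z - a1) + wzeta τ (z - a2) - zh τ z
      - wzeta τ (z - ω) + c) 0 := by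
    exact ((((zA (n0 ha1)).fun_add (zA (n0 ha2))).fun_sub
      (zh_analyticAt h 0 fun _ => rfl)).fun_sub (zA (n0 hω))).fun_add analyticAt_const
  have m00 : wzeta τ (0 - a1) + wzeta τ (0 - a2) - zh τ 0 - wzeta τ (0 - ω) + c = l := by
    simp only [zero_sub, wzeta_neg, zh_zero, hc, hl']; ring
  have hr := ellRem {0, ω, a1, a2} q1 q2 ?_ ?_
  rotate_left
  · intro z hz
    exact (hEan z (hz a1 (by simp)) (hz a2 (by simp)) (by simpa using hz 0 (by simp))
      (hz ω (by simp))).remAt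
  · rintro a (rfl | rfl | rfl | rfl)
    · refine yd_rem (κ := -1) (ell := ell) (R := fun z => - wp τ (z - a1) - wp τ (z - a2) - ph τ z
        - wp τ (z - ω) + 2 * l * (zh τ z - wzeta τ (z - ω))) (by norm_num) m0A ?_ ?_ ?_
      · exact (((((pA (n0 ha1)).fun_neg.fun_sub (pA (n0 ha2))).fun_sub (ph_analyticAt h)).fun_sub
          (pA (n0 hω))).fun_add (analyticAt_const.fun_mul
          ((zh_analyticAt h 0 fun _ => rfl).fun_sub (zA (n0 hω)))))
      · intro z hz; simp only [hell, wzeta_eq τ z, sub_zero]; ring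
      · intro z hz
        beta_reduce
        rw [m00]; simp only [hE, wp_ph τ z, wzeta_eq τ z, sub_zero]; ring
    · refine yd_rem (κ := -1) (ell := ell) (m := fun z => wzeta τ (z - a1) + wzeta τ (z - a2)
        - wzeta τ z - zh τ (z - a) + c) (R := fun z => - wp τ (z - a1) - wp τ (z - a2) - wp τ z
        - ph τ (z - a) + 2 * l * (wzeta τ z - zh τ (z - a))) (by norm_num) ?_ ?_ ?_ ?_
      · exact ((((zA (nn a1w)).fun_add (zA (nn a2w))).fun_sub (wzeta_analyticAt h hω)).fun_sub
          (zhA a)).fun_add analyticAt_const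
      · exact (((((pA (nn a1w)).fun_neg.fun_sub (pA (nn a2w))).fun_sub
          (wp_analyticAt h hω)).fun_sub (phA a)).fun_add (analyticAt_const.fun_mul
          ((wzeta_analyticAt h hω).fun_sub (zhA a))))
      · intro z hz; simp only [hell, wzeta_eq τ (z - a)]; ring
      · intro z hz
        beta_reduce
        rw [sub_self, zh_zero, sub_zero, N3]
        simp only [hE, wp_ph τ (z - a), wzeta_eq τ (z - a)]; ring
    · refine yd_rem (κ := 1) (ell := ell) (m := fun z => zh τ (z - a) + wzeta τ (z - a2)
        - wzeta τ z - wzeta τ (z - ω) + c) (R := fun z => - ph τ (z - a) - wp τ (z - a2) - wp τ z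
        - wp τ (z - ω) + 2 * l * (wzeta τ z - wzeta τ (z - ω))) (by norm_num) ?_ ?_ ?_ ?_
      · exact ((((zhA a).fun_add (zA a12)).fun_sub (wzeta_analyticAt h ha1)).fun_sub
          (zA a1w)).fun_add analyticAt_const
      · exact (((((phA a).fun_neg.fun_sub (pA a12)).fun_sub
          (wp_analyticAt h ha1)).fun_sub (pA a1w)).fun_add (analyticAt_const.fun_mul
          ((wzeta_analyticAt h ha1).fun_sub (zA a1w))))
      · intro z hz; simp only [hell, wzeta_eq τ (z - a)]; ring
      · intro z hz
        beta_reduce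
        rw [sub_self, zh_zero, zero_add, N1]
        simp only [hE, wp_ph τ (z - a)]; ring
    · refine yd_rem (κ := 1) (ell := ell) (m := fun z => wzeta τ (z - a1) + zh τ (z - a)
        - wzeta τ z - wzeta τ (z - ω) + c) (R := fun z => - ph τ (z - a) - wp τ (z - a1) - wp τ z
        - wp τ (z - ω) + 2 * l * (wzeta τ z - wzeta τ (z - ω))) (by norm_num) ?_ ?_ ?_ ?_
      · exact ((((zA (nn a12)).fun_add (zhA a)).fun_sub (wzeta_analyticAt h ha2)).fun_sub
          (zA a2w)).fun_add analyticAt_const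
      · exact (((((phA a).fun_neg.fun_sub (pA (nn a12))).fun_sub
          (wp_analyticAt h ha2)).fun_sub (pA a2w)).fun_add (analyticAt_const.fun_mul
          ((wzeta_analyticAt h ha2).fun_sub (zA a2w))))
      · intro z hz; simp only [hell, wzeta_eq τ (z - a)]; ring
      · intro z hz
        beta_reduce
        rw [sub_self, zh_zero, add_zero, N2]
        simp only [hE, wp_ph τ (z - a)]; ring
  obtain ⟨-, ε, hε, -⟩ := liouville h q1 q2 hr
  have hEε : ∀ z, z - a1 ∉ lat τ → z - a2 ∉ lat τ → z ∉ lat τ → z - ω ∉ lat τ → E z = ε := by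
    intro z z1 z2 z3 z4
    have := hε z
    rw [lext_of_analytic (E := E) (φ := E) (hEan z z1 z2 z3 z4) EventuallyEq.rfl] at this
    simpa using this
  set y : ℂ → ℂ := fun z => Complex.exp (c * z) * wsigma τ (z - a1) * wsigma τ (z - a2) /
    (wsigma τ z * wsigma τ (z - ω)) with hy
  set q : ℂ → ℂ := fun z => 2 * wp τ z + 2 * wp τ (z - ω) - 2 * l * (wzeta τ z - wzeta τ (z - ω))
    + ε with hq
  have sA : ∀ a z : ℂ, AnalyticAt ℂ (fun w => wsigma τ (w - a)) z := fun a z =>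
    an_sub ((wsigma_diff h).analyticAt _)
  have eA : ∀ z : ℂ, AnalyticAt ℂ (fun z => Complex.exp (c * z)) z := fun z => by fun_prop
  have yan : ∀ z, z ∉ lat τ → z - ω ∉ lat τ → AnalyticAt ℂ y z := by
    intro z z1 z2
    exact AnalyticAt.fun_div (((eA z).fun_mul (sA a1 z)).fun_mul (sA a2 z))
      (((wsigma_diff h).analyticAt z).fun_mul (sA ω z)) (mul_ne_zero (wsigma_ne h z1) (wsigma_ne h z2))
  have yd : ∀ z, z - a1 ∉ lat τ → z - a2 ∉ lat τ → z ∉ lat τ → z - ω ∉ lat τ →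
      HasDerivAt y (ell z * y z) z := by
    intro z z1 z2 z3 z4
    have d1 := (wsigma_hasDerivAt h z1).comp_sub_const z a1
    have d2 := (wsigma_hasDerivAt h z2).comp_sub_const z a2
    have d3 := wsigma_hasDerivAt h z3
    have d4 := (wsigma_hasDerivAt h z4).comp_sub_const z ω
    have s3 := wsigma_ne h z3
    have s4 := wsigma_ne h z4
    have d5 : HasDerivAt (fun z => Complex.exp (c * z)) (Complex.exp (c * z) * c) z := by
      have := ((hasDerivAt_id z).const_mul c).cexp
      exact this.cg (fun _ => rfl) (by simp)
    have := ((d5.fun_mul d1).fun_mul d2).fun_div (d3.fun_mul d4) (mul_ne_zero s3 s4)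
    refine this.cg (fun _ => rfl) ?_
    simp only [hy, hell]
    field_simp
    ring
  have elld : ∀ z, z - a1 ∉ lat τ → z - a2 ∉ lat τ → z ∉ lat τ → z - ω ∉ lat τ →
      HasDerivAt ell (-wp τ (z - a1) - wp τ (z - a2) + wp τ z + wp τ (z - ω)) z := by
    intro z z1 z2 z3 z4
    have d1 := (wzeta_hasDerivAt h z1).comp_sub_const z a1
    have d2 := (wzeta_hasDerivAt h z2).comp_sub_const z a2
    have d3 := wzeta_hasDerivAt h z3
    have d4 := (wzeta_hasDerivAt h z4).comp_sub_const z ω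
    exact ((((d1.fun_add d2).fun_sub d3).fun_sub d4).add_const c).cg (fun _ => rfl) (by ring)
  have ellq : ∀ z, z - a1 ∉ lat τ → z - a2 ∉ lat τ → z ∉ lat τ → z - ω ∉ lat τ →
      q z = (-wp τ (z - a1) - wp τ (z - a2) + wp τ z + wp τ (z - ω)) + ell z ^ 2 := by
    intro z z1 z2 z3 z4
    have := hEε z z1 z2 z3 z4
    simp only [hq, ← this, hE]; ring
  have ode0 : ∀ z, z - a1 ∉ lat τ → z - a2 ∉ lat τ → z ∉ lat τ → z - ω ∉ lat τ →
      deriv (deriv y) z = q z * y z := by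
    intro z z1 z2 z3 z4
    have e1 : deriv y =ᶠ[𝓝 z] fun w => ell w * y w := by
      have o : ∀ {a : ℂ}, z - a ∉ lat τ → ∀ᶠ w in 𝓝 z, w - a ∉ lat τ := fun {a} ha =>
        (continuous_id.sub continuous_const).continuousAt.eventually
          ((lat_closed h).isOpen_compl.mem_nhds ha)
      filter_upwards [o z1, o z2, (lat_closed h).isOpen_compl.mem_nhds z3, o z4] with w w1 w2 w3 w4
      exact (yd w w1 w2 w3 w4).deriv
    rw [e1.deriv_eq, ((elld z z1 z2 z3 z4).fun_mul (yd z z1 z2 z3 z4)).deriv, ellq z z1 z2 z3 z4]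
    ring
  have qan : ∀ z, z ∉ lat τ → z - ω ∉ lat τ → AnalyticAt ℂ q z := by
    intro z z1 z2
    exact (((analyticAt_const.fun_mul (wp_analyticAt h z1)).fun_add (analyticAt_const.fun_mul
      (pA z2))).fun_sub (analyticAt_const.fun_mul ((wzeta_analyticAt h z1).fun_sub
      (zA z2)))).fun_add analyticAt_const
  refine ⟨y, q, _, _, ε, ⟨ha1, ha2, a1w, a2w, xne, ?_, yan, ?_, ?_, ?_, ?_, rfl, rfl, ?_, ?_,
    fun _ => rfl, ?_⟩⟩
  · rw [hl, FS h ha1 ha2 hA]; linear_combination he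
  · intro z z1 z2
    have c1 : ContinuousAt (deriv (deriv y)) z := (yan z z1 z2).deriv.deriv.continuousAt
    have c2 : ContinuousAt (fun z => q z * y z) z := ((qan z z1 z2).mul (yan z z1 z2)).continuousAt
    refine tendsto_nhds_unique (c1.tendsto.mono_left (nhdsWithin_le_nhds (s := {z}ᶜ)))
      ((c2.tendsto.mono_left nhdsWithin_le_nhds).congr' ?_)
    filter_upwards [off_lat_sub h a1 z, off_lat_sub h a2 z, off_lat h z, off_lat_sub h ω z] with
      w w1 w2 w3 w4
    exact (ode0 w w1 w2 w3 w4).symm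
  · intro z z1 z2
    have s3 := wsigma_ne h z1
    have s4 := wsigma_ne h z2
    have sz : ∀ w, wsigma τ w = 0 ↔ w ∈ lat τ := by
      intro w
      refine ⟨fun e => by_contra fun hw => wsigma_ne h hw e, fun hw => ?_⟩
      rcases eq_or_ne w 0 with rfl | h0
      · simp [wsigma]
      · obtain ⟨p, hp⟩ := exists_latPt hw h0
        rw [wsigma, tprod_of_exists_eq_zero ⟨p, by rw [hp, div_self h0]; ring⟩, mul_zero]
    simp only [hy, div_eq_zero_iff, mul_eq_zero, sz, Complex.exp_ne_zero]
    tauto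
  · intro z
    simp only [hy]
    rw [show z + 1 - a1 = z - a1 + 1 by ring, show z + 1 - a2 = z - a2 + 1 by ring,
      show z + 1 - ω = z - ω + 1 by ring, wsigma_add_one h, wsigma_add_one h, wsigma_add_one h,
      wsigma_add_one h, mul_div_assoc']
    have e : Complex.exp (c * (z + 1)) * Complex.exp (eta1 τ * (z - a1 + 1 / 2)) *
      Complex.exp (eta1 τ * (z - a2 + 1 / 2)) = Complex.exp (c - eta1 τ * (a1 + a2 - ω)) *
      Complex.exp (c * z) * (Complex.exp (eta1 τ * (z + 1 / 2)) *
      Complex.exp (eta1 τ * (z - ω + 1 / 2))) := by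
      simp only [← Complex.exp_add]; congr 1; ring
    have n1 := Complex.exp_ne_zero (eta1 τ * (z + 1 / 2))
    have n2 := Complex.exp_ne_zero (eta1 τ * (z - ω + 1 / 2))
    generalize Complex.exp (eta1 τ * (z + 1 / 2)) = E1 at *
    generalize Complex.exp (eta1 τ * (z - ω + 1 / 2)) = E2 at *
    rw [show ∀ a b : ℂ, -E1 * a * (-E2 * b) = (E1 * E2) * (a * b) from fun a b => by ring,
      ← mul_div_mul_left _ (wsigma τ z * wsigma τ (z - ω)) (mul_ne_zero n1 n2)]
    congr 1
    linear_combination (wsigma τ (z - a1) * wsigma τ (z - a2)) * e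
  · intro z
    simp only [hy]
    rw [show z + τ - a1 = z - a1 + τ by ring, show z + τ - a2 = z - a2 + τ by ring,
      show z + τ - ω = z - ω + τ by ring, wsigma_add_tau h, wsigma_add_tau h, wsigma_add_tau h,
      wsigma_add_tau h, mul_div_assoc']
    have e : Complex.exp (c * (z + τ)) * Complex.exp (eta2 τ * (z - a1 + τ / 2)) *
      Complex.exp (eta2 τ * (z - a2 + τ / 2)) = Complex.exp (c * τ - eta2 τ * (a1 + a2 - ω)) *
      Complex.exp (c * z) * (Complex.exp (eta2 τ * (z + τ / 2)) *
      Complex.exp (eta2 τ * (z - ω + τ / 2))) := by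
      simp only [← Complex.exp_add]; congr 1; ring
    have n1 := Complex.exp_ne_zero (eta2 τ * (z + τ / 2))
    have n2 := Complex.exp_ne_zero (eta2 τ * (z - ω + τ / 2))
    generalize Complex.exp (eta2 τ * (z + τ / 2)) = E1 at *
    generalize Complex.exp (eta2 τ * (z - ω + τ / 2)) = E2 at *
    rw [show ∀ a b : ℂ, -E1 * a * (-E2 * b) = (E1 * E2) * (a * b) from fun a b => by ring,
      ← mul_div_mul_left _ (wsigma τ z * wsigma τ (z - ω)) (mul_ne_zero n1 n2)]
    congr 1
    linear_combination (wsigma τ (z - a1) * wsigma τ (z - a2)) * e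
  · have k1 := sP_ne h (z := 0) fun _ => rfl
    have k2 := wsigma_ne h (n0 hω)
    have k3 := wsigma_ne h (n0 ha1)
    have k4 := wsigma_ne h (n0 ha2)
    refine ⟨fun z => Complex.exp (c * z) * wsigma τ (z - a1) * wsigma τ (z - a2) /
      (sP τ z * wsigma τ (z - ω)), ?_, ?_, ?_⟩
    · exact AnalyticAt.fun_div (((eA 0).fun_mul (sA a1 0)).fun_mul (sA a2 0))
        (((sP_diff h).analyticAt 0).fun_mul (sA ω 0)) (mul_ne_zero k1 k2)
    · exact div_ne_zero (mul_ne_zero (mul_ne_zero (Complex.exp_ne_zero _) k3) k4)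
        (mul_ne_zero k1 k2)
    · intro z
      simp only [hy]; rw [wsigma_eq τ z, div_div]; congr 1; ring
  · have k1 : sP τ (ω - ω) ≠ 0 := by rw [sub_self]; exact sP_ne h (z := 0) fun _ => rfl
    have k2 := wsigma_ne h hω
    have k3 := wsigma_ne h (nn a1w)
    have k4 := wsigma_ne h (nn a2w)
    refine ⟨fun z => Complex.exp (c * z) * wsigma τ (z - a1) * wsigma τ (z - a2) /
      (wsigma τ z * sP τ (z - ω)), ?_, ?_, ?_⟩
    · exact AnalyticAt.fun_div (((eA ω).fun_mul (sA a1 ω)).fun_mul (sA a2 ω))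
        (((wsigma_diff h).analyticAt ω).fun_mul (an_sub ((sP_diff h).analyticAt _)))
        (mul_ne_zero k2 k1)
    · exact div_ne_zero (mul_ne_zero (mul_ne_zero (Complex.exp_ne_zero _) k3) k4)
        (mul_ne_zero k2 k1)
    · intro z
      simp only [hy]; rw [wsigma_eq τ (z - ω), div_div]; congr 1; ring
  · refine ⟨_, m0A, m00, ?_⟩
    have ev := m0A.eventually_analyticAt.filter_mono (nhdsWithin_le_nhds (s := {(0:ℂ)}ᶜ))
    filter_upwards [off_lat_sub h a1 0, off_lat_sub h a2 0, off_lat h 0, off_lat_sub h ω 0, ev,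
      self_mem_nhdsWithin] with z w1 w2 w3 w4 w5 w6
    have w6 : z ≠ 0 := w6
    have d1 : HasDerivAt ell (1 / z ^ 2 + deriv (fun z => wzeta τ (z - a1) + wzeta τ (z - a2)
        - zh τ z - wzeta τ (z - ω) + c) z) z := by
      have := ((hasDerivAt_inv w6).fun_neg).fun_add w5.differentiableAt.hasDerivAt
      refine this.cg (fun w => ?_) (by simp)
      simp only [hell, wzeta_eq τ w]; ring
    rw [ellq z w1 w2 w3 w4, (elld z w1 w2 w3 w4).unique d1]
    simp only [hell, wzeta_eq τ z]
    field_simp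
    ring

/-- real-linear map `h ↦ a h + b h̄` -/
noncomputable def LL (a b : ℂ) : ℂ →L[ℝ] ℂ :=
  a • ContinuousLinearMap.id ℝ ℂ + b • (Complex.conjCLE : ℂ →L[ℝ] ℂ)

theorem LL_apply (a b h : ℂ) : LL a b h = a * h + b * starRingEnd ℂ h := by
  simp [LL]

/-- Wirtinger derivatives -/
def HW (g : ℂ → ℂ) (a b z : ℂ) : Prop := HasFDerivAt g (LL a b) z

theorem hw_mk {L : ℂ →L[ℝ] ℂ} (h : HasFDerivAt f L z)
    (hg : ∀ w, g w = f w) (e : ∀ h, L h = a * h + b * starRingEnd ℂ h) : HW g a b z := by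
  unfold HW
  rw [show g = f from funext hg]
  rwa [show LL a b = L from ContinuousLinearMap.ext fun h => by rw [LL_apply, e]]

theorem HW.congr (h : HW g a b z) (e : f =ᶠ[𝓝 z] g) : HW f a b z :=
  HasFDerivAt.congr_of_eventuallyEq h e

theorem HW.cg (h : HW g a b z) (e : ∀ w, f w = g w)
    (ha : a' = a) (hb : b' = b) : HW f a' b' z := by
  subst ha hb; rwa [show f = g from funext e]

theorem HW.unique (h : HW g a b z) (h' : HW g a' b' z) :
    a = a' ∧ b = b' := by
  have e := HasFDerivAt.unique h h'
  have e1 := DFunLike.congr_fun e 1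
  have e2 := DFunLike.congr_fun e Complex.I
  simp only [LL_apply, map_one, Complex.conj_I] at e1 e2
  have e3 : a - b = a' - b' := by
    apply mul_right_cancel₀ Complex.I_ne_zero; linear_combination e2
  exact ⟨by linear_combination (e1 + e3) / 2, by linear_combination (e1 - e3) / 2⟩

theorem hw_const (c z : ℂ) : HW (fun _ => c) 0 0 z := by
  have := hasFDerivAt_const (𝕜 := ℝ) c z
  unfold HW
  convert this using 1
  ext h <;> simp [LL_apply]

theorem HW.add (h : HW f a b z) (h' : HW g c d z) :
    HW (fun w => f w + g w) (a + c) (b + d) z := by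
  have := HasFDerivAt.fun_add h h'
  unfold HW
  rwa [show LL (a + c) (b + d) = LL a b + LL c d from by ext h <;> simp [LL_apply] <;> ring]

theorem HW.mul (h : HW f a b z) (h' : HW g c d z) :
    HW (fun w => f w * g w) (a * g z + f z * c) (b * g z + f z * d) z := by
  have := HasFDerivAt.fun_mul h h'
  unfold HW
  rwa [show LL (a * g z + f z * c) (b * g z + f z * d) = f z • LL c d + g z • LL a b from by
    ext h <;> simp [LL_apply] <;> ring]

theorem HW.comp_left (hφ : HasDerivAt φ c (g z)) (h : HW g a b z) :
    HW (fun w => φ (g w)) (c * a) (c * b) z := by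
  exact hw_mk ((hφ.complexToReal_fderiv).comp z h) (fun w => rfl) fun h => by
    simp [LL_apply]; ring

theorem HW.of_deriv (hφ : HasDerivAt φ c z) : HW φ c 0 z := by
  have := hφ.complexToReal_fderiv
  unfold HW
  convert this using 1
  ext h <;> simp [LL_apply]

theorem hw_id (z : ℂ) : HW (fun w => w) 1 0 z := HW.of_deriv (hasDerivAt_id z)

theorem HW.neg (h : HW f a b z) : HW (fun w => - f w) (-a) (-b) z :=
  ((hw_const (-1) z).mul h).cg (fun w => by ring) (by ring) (by ring)

theorem HW.sub (h : HW f a b z) (h' : HW g c d z) :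
    HW (fun w => f w - g w) (a - c) (b - d) z :=
  (h.add h'.neg).cg (fun w => by ring) (by ring) (by ring)

theorem HW.cmul (c : ℂ) (h : HW f a b z) :
    HW (fun w => c * f w) (c * a) (c * b) z :=
  ((hw_const c z).mul h).cg (fun w => by ring) (by ring) (by ring)

theorem HW.conj (h : HW f a b z) :
    HW (fun w => starRingEnd ℂ (f w)) (starRingEnd ℂ b) (starRingEnd ℂ a) z := by
  exact hw_mk ((Complex.conjCLE : ℂ →L[ℝ] ℂ).hasFDerivAt.comp z h) (fun w => rfl) fun h => by
    simp [LL_apply]; ring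

theorem HW.inv (h : HW f a b z) (h0 : f z ≠ 0) :
    HW (fun w => (f w)⁻¹) (-a / f z ^ 2) (-b / f z ^ 2) z :=
  (HW.comp_left (hasDerivAt_inv h0) h).cg (fun w => rfl) (by field_simp) (by field_simp)

theorem HW.div (h : HW f a b z) (h' : HW g c d z) (h0 : g z ≠ 0) :
    HW (fun w => f w / g w) ((a * g z - f z * c) / g z ^ 2) ((b * g z - f z * d) / g z ^ 2) z :=
  (h.mul (h'.inv h0)).cg (fun w => rfl) (by field_simp; ring) (by field_simp; ring)

theorem HW.comp_right (h : HW g a b (φ z)) (hφ : HasDerivAt φ c z) :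
    HW (fun w => g (φ w)) (a * c) (b * starRingEnd ℂ c) z := by
  exact hw_mk (HasFDerivAt.comp z h hφ.complexToReal_fderiv) (fun w => rfl) fun h => by
    simp [LL_apply]; ring

theorem HW.hasDerivAt (h : HW φ c 0 z) : HasDerivAt φ c z := by
  unfold HW at h
  rw [hasDerivAt_iff_hasFDerivAt]
  rw [hasFDerivAt_iff_isLittleO] at h ⊢
  simpa [LL_apply, mul_comm] using h

/-- `∂_{z̄} g` -/
noncomputable def dzb (g : ℂ → ℂ) (z : ℂ) : ℂ :=
  (1 / 2) * (fderiv ℝ g z (1 : ℂ) + Complex.I * fderiv ℝ g z Complex.I)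

theorem hw_of_diff (h : DifferentiableAt ℝ g z) :
    HW g (wirt g z) (dzb g z) z := by
  have := h.hasFDerivAt
  unfold HW
  rwa [show LL (wirt g z) (dzb g z) = fderiv ℝ g z from ?_]
  have key : ∀ h : ℂ, h = h.re • (1 : ℂ) + h.im • Complex.I := fun h => by
    simp [Complex.re_add_im]
  refine ContinuousLinearMap.ext fun h => ?_
  have e : fderiv ℝ g z h = h.re * fderiv ℝ g z 1 + h.im * fderiv ℝ g z Complex.I := by
    conv_lhs => rw [key h]
    rw [map_add, map_smul, map_smul]; simp
  rw [e, LL_apply, wirt, dzb]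
  have h1 : h = h.re + h.im * Complex.I := (Complex.re_add_im h).symm
  have h2 : starRingEnd ℂ h = h.re - h.im * Complex.I := by
    apply Complex.ext <;> simp
  rw [h2]
  generalize fderiv ℝ g z 1 = X
  generalize fderiv ℝ g z Complex.I = Y
  conv_lhs => rw [h1]
  simp only [Complex.add_re, Complex.add_im, Complex.ofReal_re, Complex.ofReal_im,
    Complex.mul_re, Complex.mul_im, Complex.I_re, Complex.I_im]
  push_cast
  linear_combination (-(h.im : ℂ) * Y) * Complex.I_sq

theorem HW.mixed {a b : ℂ → ℂ} (h : ∀ᶠ w in 𝓝 z, HW g (a w) (b w) w)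
    (ha : HW a a1 a2 z) (hb : HW b b1 b2 z) : a2 = b1 := by
  let T : ℂ →L[ℝ] (ℂ →L[ℝ] ℂ) := (ContinuousLinearMap.mul ℝ ℂ)
  let T2 : ℂ →L[ℝ] (ℂ →L[ℝ] ℂ) :=
    ((ContinuousLinearMap.compL ℝ ℂ ℂ ℂ).flip (Complex.conjCLE : ℂ →L[ℝ] ℂ)).comp T
  have hL : ∀ a b, LL a b = T a + T2 b := by
    intro a b; refine ContinuousLinearMap.ext fun h => ?_
    simp [LL_apply, T, T2]
  have hd : HasFDerivAt (fun w => LL (a w) (b w)) (T.comp (LL a1 a2) + T2.comp (LL b1 b2)) z := by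
    have := (T.hasFDerivAt.comp z ha).add (T2.hasFDerivAt.comp z hb)
    refine this.congr_of_eventuallyEq (Eventually.of_forall fun w => ?_)
    simp [hL]
  have := second_derivative_symmetric_of_eventually_of_real h hd 1 Complex.I
  simp [LL_apply, T, T2] at this
  have h2 : (2 * Complex.I) * a2 = (2 * Complex.I) * b1 := by linear_combination this
  exact mul_left_cancel₀ (by simp) h2

theorem HW.real_fderiv {U : ℂ} (h : HW (fun w => (u w : ℂ)) U V z) :
    HasFDerivAt u (Complex.reCLM.comp (LL U V)) z := by
  have := Complex.reCLM.hasFDerivAt.comp z h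
  refine this.congr_of_eventuallyEq (Eventually.of_forall fun w => ?_)
  simp

theorem hw_real (h : DifferentiableAt ℝ u z) :
    HW (fun w => (u w : ℂ)) (wirt (fun w => (u w : ℂ)) z)
      (starRingEnd ℂ (wirt (fun w => (u w : ℂ)) z)) z := by
  have h1 : DifferentiableAt ℝ (fun w => (u w : ℂ)) z :=
    Complex.ofRealCLM.differentiableAt.comp z h
  have h2 := hw_of_diff h1
  have h3 := h2.conj
  simp only [Complex.conj_ofReal] at h3
  rw [(h2.unique h3).2] at h2
  simpa using h2

theorem lapl_eq
    (h : ∀ᶠ w in 𝓝 z, HW (fun w => (u w : ℂ)) (U w) (starRingEnd ℂ (U w)) w) (hU : HW U a b z) :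
    lapl u z = 4 * b.re := by
  have e1 : (fun w => fderiv ℝ u w (1 : ℂ)) =ᶠ[𝓝 z] fun w => 2 * (U w).re := by
    filter_upwards [h] with w hw
    rw [hw.real_fderiv.fderiv]; simp [LL_apply]; ring
  have e2 : (fun w => fderiv ℝ u w Complex.I) =ᶠ[𝓝 z] fun w => -2 * (U w).im := by
    filter_upwards [h] with w hw
    rw [hw.real_fderiv.fderiv]; simp [LL_apply]; ring
  have d1 : HasFDerivAt (fun w => 2 * (U w).re) ((2 : ℝ) • Complex.reCLM.comp (LL a b)) z :=
    (Complex.reCLM.hasFDerivAt.comp z hU).const_mul 2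
  have d2 : HasFDerivAt (fun w => -2 * (U w).im) ((-2 : ℝ) • Complex.imCLM.comp (LL a b)) z :=
    (Complex.imCLM.hasFDerivAt.comp z hU).const_mul (-2)
  rw [lapl, e1.fderiv_eq, e2.fderiv_eq, d1.fderiv, d2.fderiv]
  simp [LL_apply]; ring

/-- local form of the curvature equation on an open set -/
structure CS (O : Set ℂ) (u : ℂ → ℝ) (U q : ℂ → ℂ) : Prop where
  op : IsOpen O
  du : ∀ z ∈ O, HW (fun w => (u w : ℂ)) (U z) (starRingEnd ℂ (U z)) z
  dU : ∀ z ∈ O, HW U (U z ^ 2 / 2 - 2 * q z) (-((Real.exp (u z) : ℝ) : ℂ) / 4) z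
  dq : ∀ z ∈ O, DifferentiableAt ℂ q z

theorem CS.lapl (h : CS O u U q) (hz : z ∈ O) :
    lapl u z + Real.exp (u z) = 0 := by
  rw [lapl_eq (by filter_upwards [h.op.mem_nhds hz] with w hw using h.du w hw) (h.dU z hz)]
  rw [show (-((Real.exp (u z) : ℝ) : ℂ) / 4) = ((-(Real.exp (u z)) / 4 : ℝ) : ℂ) by push_cast; ring,
    Complex.ofReal_re]
  ring

theorem wirt_contDiffAt (n : ℕ) (h : ContDiffAt ℝ (n + 1 : ℕ) g z) :
    ContDiffAt ℝ n (wirt g) z := by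
  have h1 : ContDiffAt ℝ n (fderiv ℝ g) z := h.fderiv_right (by norm_cast)
  unfold wirt
  exact contDiffAt_const.mul ((h1.clm_apply contDiffAt_const).sub
    (contDiffAt_const.mul (h1.clm_apply contDiffAt_const)))

theorem hw_expu {U : ℂ} (c : ℝ) (h : HW (fun w => (u w : ℂ)) U V z) :
    HW (fun w => ((Real.exp (c * u w) : ℝ) : ℂ)) (c * U * (Real.exp (c * u z) : ℝ))
      (c * V * (Real.exp (c * u z) : ℝ)) z :=
  (HW.comp_left (Complex.hasDerivAt_exp _) (h.cmul c)).cg (fun w => by push_cast; rfl)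
    (by push_cast; ring) (by push_cast; ring)

theorem cs_of_sol (ho : IsOpen O)
    (h : ∀ z ∈ O, (∀ n : ℕ, ContDiffAt ℝ n u z) ∧ lapl u z + Real.exp (u z) = 0) :
    CS O u (wirt (fun w => (u w : ℂ))) (uPot u) := by
  set U := wirt (fun w => (u w : ℂ)) with hU
  have hc : ∀ z ∈ O, ∀ n : ℕ, ContDiffAt ℝ n (fun w => (u w : ℂ)) z := fun z hz n =>
    Complex.ofRealCLM.contDiff.contDiffAt.comp z ((h z hz).1 n)
  have cU : ∀ z ∈ O, ∀ n : ℕ, ContDiffAt ℝ n U z := fun z hz n =>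
    wirt_contDiffAt n (hc z hz _)
  have du : ∀ z ∈ O, HW (fun w => (u w : ℂ)) (U z) (starRingEnd ℂ (U z)) z := fun z hz =>
    hw_real (((h z hz).1 1).differentiableAt (by norm_num))
  have nb : ∀ z ∈ O, ∀ᶠ w in 𝓝 z, w ∈ O := fun z hz => ho.mem_nhds hz
  have dU : ∀ z ∈ O, HW U (U z ^ 2 / 2 - 2 * uPot u z) (-((Real.exp (u z) : ℝ) : ℂ) / 4) z := by
    intro z hz
    have h1 := hw_of_diff ((cU z hz 1).differentiableAt (by norm_num))
    have h2 : dzb U z = starRingEnd ℂ (dzb U z) :=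
      HW.mixed ((nb z hz).mono fun w hw => du w hw) h1 h1.conj
    have h3 := lapl_eq ((nb z hz).mono fun w hw => du w hw) h1
    have h4 : dzb U z = ((dzb U z).re : ℂ) := (Complex.conj_eq_iff_re.1 h2.symm).symm
    have h5 := (h z hz).2
    refine h1.cg (fun _ => rfl) ?_ ?_
    · simp only [uPot, ← hU]; ring
    · rw [h4, show (dzb U z).re = - Real.exp (u z) / 4 by linarith]; push_cast; ring
  refine ⟨ho, du, dU, fun z hz => ?_⟩
  have h1 : HW (wirt U) (wirt (wirt U) z) (dzb (wirt U) z) z :=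
    hw_of_diff ((wirt_contDiffAt 1 (cU z hz 2)).differentiableAt (by norm_num))
  have h2 : HW (fun w => -((Real.exp (u w) : ℝ) : ℂ) / 4) (-(U z * Real.exp (u z)) / 4)
      (-(starRingEnd ℂ (U z) * Real.exp (u z)) / 4) z :=
    ((hw_expu 1 (du z hz)).cmul (-1/4)).cg (fun w => by simp; ring) (by simp; ring) (by simp; ring)
  have h3 := HW.mixed (g := U) (a := wirt U) (b := fun w => -((Real.exp (u w) : ℝ) : ℂ) / 4)
    (z := z) ((nb z hz).mono fun w hw => (dU w hw).cg (fun _ => rfl) (by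
      simp only [uPot, ← hU]; ring) rfl) h1 h2
  have h4 : HW (uPot u) (-(1 / 2) * (wirt (wirt U) z - (1/2) * (2 * U z * (U z ^ 2 / 2 - 2 * uPot u z)))) 0 z := by
    refine ((h1.sub (((dU z hz).mul (dU z hz)).cmul (1/2))).cmul (-(1/2))).cg (fun w => ?_) ?_ ?_
    · simp only [uPot, ← hU]; ring
    · ring
    · rw [h3]; ring
  exact h4.hasDerivAt.differentiableAt

/-- data for `ψ = e^{-u/2}` -/
structure PS (O : Set ℂ) (ψ R : ℂ → ℝ) (P q : ℂ → ℂ) : Prop where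
  dψ : ∀ z ∈ O, HW (fun w => (ψ w : ℂ)) (P z) (starRingEnd ℂ (P z)) z
  dP : ∀ z ∈ O, HW P (q z * ψ z) (R z) z
  dR : ∀ z ∈ O, HW (fun w => (R w : ℂ)) (q z * starRingEnd ℂ (P z)) (starRingEnd ℂ (q z) * P z) z
  rel : ∀ z, (ψ z * R z : ℂ) - P z * starRingEnd ℂ (P z) = 1 / 8
  pos : ∀ z, 0 < ψ z

theorem CS.ps (h : CS O u U q) :
    PS O (fun z => Real.exp (-1/2 * u z))
      (fun z => (1/8 + ‖-1/2 * U z * (Real.exp (-1/2 * u z) : ℝ)‖ ^ 2) / Real.exp (-1/2 * u z))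
      (fun z => -1/2 * U z * (Real.exp (-1/2 * u z) : ℝ)) q := by
  set ψ : ℂ → ℝ := fun z => Real.exp (-1/2 * u z) with hψ
  set P : ℂ → ℂ := fun z => -1/2 * U z * (ψ z : ℝ) with hP
  have pos : ∀ z, 0 < ψ z := fun z => Real.exp_pos _
  have ne : ∀ z, (ψ z : ℂ) ≠ 0 := fun z => by exact_mod_cast (pos z).ne'
  have dψ : ∀ z ∈ O, HW (fun w => (ψ w : ℂ)) (P z) (starRingEnd ℂ (P z)) z := fun z hz =>
    (hw_expu (-1/2) (h.du z hz)).cg (fun w => rfl) (by simp [hP, hψ])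
      (by simp only [hP, hψ, map_mul, Complex.conj_ofReal, map_div₀, map_neg, map_one, map_ofNat]
          push_cast; ring)
  have eR : ∀ z, (((1/8 + ‖P z‖ ^ 2) / ψ z : ℝ) : ℂ) =
      (1/8 + P z * starRingEnd ℂ (P z)) / ψ z := fun z => by
    rw [Complex.mul_conj']; push_cast; rfl
  have dP : ∀ z ∈ O, HW P (q z * ψ z) (((1/8 + ‖P z‖ ^ 2) / ψ z : ℝ) : ℂ) z := by
    intro z hz
    refine (((h.dU z hz).cmul (-1/2)).mul (dψ z hz)).cg (fun w => rfl) ?_ ?_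
    · simp only [hP]; ring
    · rw [eR]
      have e1 : ((Real.exp (u z) : ℝ) : ℂ) = 1 / ((ψ z : ℂ)) ^ 2 := by
        rw [eq_div_iff (pow_ne_zero _ (ne z))]
        norm_cast
        simp only [hψ, ← Real.exp_nat_mul, ← Real.exp_add]
        rw [Real.exp_eq_one_iff]; push_cast; ring
      rw [e1]; simp only [hP, map_mul, Complex.conj_ofReal]; field_simp [ne z]; ring
  refine ⟨dψ, dP, fun z hz => ?_, fun z => ?_, pos⟩
  · have d1 := (dP z hz).conj
    rw [Complex.conj_ofReal] at d1
    refine ((((hw_const (1/8) z).add ((dP z hz).mul d1)).div (dψ z hz) (ne z))).cg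
      (fun w => eR w) ?_ ?_
    · rw [eR]; field_simp [ne z]; ring
    · rw [eR]; simp only [map_mul, Complex.conj_ofReal]; field_simp [ne z]; ring
  · rw [eR]; field_simp [ne z]; ring

/-- developing map computation -/
theorem dev_cs (hF : AnalyticAt ℂ F z) (h0 : deriv F z ≠ 0)
    (hu : ∀ᶠ w in 𝓝 z, u w = Real.log (8 * ‖deriv F w‖ ^ 2 / (1 + ‖F w‖ ^ 2) ^ 2)) :
    (∀ᶠ w in 𝓝 z, HW (fun w => (u w : ℂ))
      (deriv (deriv F) w / deriv F w - 2 * deriv F w * starRingEnd ℂ (F w) / (1 + F w * starRingEnd ℂ (F w)))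
      (starRingEnd ℂ (deriv (deriv F) w / deriv F w - 2 * deriv F w * starRingEnd ℂ (F w) / (1 + F w * starRingEnd ℂ (F w)))) w) ∧
    HW (fun w => deriv (deriv F) w / deriv F w - 2 * deriv F w * starRingEnd ℂ (F w) / (1 + F w * starRingEnd ℂ (F w)))
      ((deriv (deriv F) z / deriv F z - 2 * deriv F z * starRingEnd ℂ (F z) / (1 + F z * starRingEnd ℂ (F z))) ^ 2 / 2
        + (deriv (deriv (deriv F)) z / deriv F z - 3 / 2 * (deriv (deriv F) z / deriv F z) ^ 2))
      (-((Real.exp (u z) : ℝ) : ℂ) / 4) z := by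
  have n1 : ∀ w, (1 + F w * starRingEnd ℂ (F w)) ≠ 0 := fun w => by
    rw [Complex.mul_conj']; norm_cast; positivity
  have dF := fun w (hw : AnalyticAt ℂ F w) => HW.of_deriv hw.differentiableAt.hasDerivAt
  constructor
  · filter_upwards [hu.eventually_nhds, hF.eventually_analyticAt,
      hF.deriv.continuousAt.eventually_ne h0] with w h1 h2 h3
    have a1 := dF w h2
    have a2 := HW.of_deriv h2.deriv.differentiableAt.hasDerivAt
    have nz : (8 * (deriv F w * starRingEnd ℂ (deriv F w)) / (1 + F w * starRingEnd ℂ (F w)) ^ 2) ∈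
        Complex.slitPlane := by
      rw [Complex.mul_conj', Complex.mul_conj']
      norm_cast
      rw [Complex.ofReal_mem_slitPlane]
      have : 0 < ‖deriv F w‖ := norm_pos_iff.2 h3
      positivity
    have sq : ∀ {g : ℂ → ℂ} {a b : ℂ}, HW g a b w → HW (fun w => g w ^ 2) (2 * g w * a) (2 * g w * b) w :=
      fun h => (h.mul h).cg (fun _ => by ring) (by ring) (by ring)
    have a3 := HW.comp_left (g := fun w => 8 * (deriv F w * starRingEnd ℂ (deriv F w)) / (1 + F w * starRingEnd ℂ (F w)) ^ 2)
      (Complex.hasDerivAt_log nz) (((a2.mul a2.conj).cmul 8).div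
      (sq ((hw_const 1 w).add (a1.mul a1.conj))) (pow_ne_zero 2 (n1 w)))
    have cj : starRingEnd ℂ (deriv F w) ≠ 0 := by simpa using h3
    have n1' := n1 w
    have n3 : 1 + starRingEnd ℂ (F w) * F w ≠ 0 := by rwa [mul_comm] at n1'
    refine (a3.congr ?_).cg (fun _ => rfl) ?_ ?_
    · filter_upwards [h1] with x hx
      rw [hx, Complex.ofReal_log (by positivity)]
      push_cast
      rw [Complex.mul_conj', Complex.mul_conj']
    · simp only [map_zero]
      field_simp
      ring
    · simp only [map_zero, map_sub, map_div₀, map_mul, map_add, map_one, Complex.conj_conj,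
        map_ofNat] at *
      field_simp
      ring
  · have a1 := dF z hF
    have a2 := HW.of_deriv hF.deriv.differentiableAt.hasDerivAt
    have a3 := HW.of_deriv hF.deriv.deriv.differentiableAt.hasDerivAt
    have n1' := n1 z
    have n3 : 1 + starRingEnd ℂ (F z) * F z ≠ 0 := by rwa [mul_comm] at n1'
    refine ((a3.div a2 h0).sub (((a2.cmul 2).mul a1.conj).div
      ((hw_const 1 z).add (a1.mul a1.conj)) n1')).cg (fun _ => rfl) ?_ ?_
    · simp only [map_zero]; field_simp; ring
    · have h8 : 0 < ‖deriv F z‖ := norm_pos_iff.2 h0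
      rw [hu.self_of_nhds, Real.exp_log (by positivity)]
      push_cast
      rw [← Complex.mul_conj', ← Complex.mul_conj']
      field_simp; ring

theorem CS.dev (h : CS O u U q) (hz : z ∈ O)
    (hF : AnalyticAt ℂ F z) (h0 : deriv F z ≠ 0)
    (hu : ∀ᶠ w in 𝓝 z, u w = Real.log (8 * ‖deriv F w‖ ^ 2 / (1 + ‖F w‖ ^ 2) ^ 2)) :
    q z = -(1/2) * (deriv (deriv (deriv F)) z / deriv F z - 3 / 2 * (deriv (deriv F) z / deriv F z) ^ 2) := by
  obtain ⟨h1, h2⟩ := dev_cs hF h0 hu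
  have e : ∀ᶠ w in 𝓝 z, U w = deriv (deriv F) w / deriv F w - 2 * deriv F w * starRingEnd ℂ (F w) / (1 + F w * starRingEnd ℂ (F w)) := by
    filter_upwards [h1, h.op.mem_nhds hz] with w hw hO
    exact ((h.du w hO).unique hw).1
  have h3 := ((h.dU z hz).unique (h2.congr e)).1
  rw [e.self_of_nhds] at h3
  linear_combination -h3 / 2

def SS (τ ω : ℂ) : Set ℂ := {z | z ∈ lat τ ∨ z - ω ∈ lat τ}

theorem mem_SS : z ∈ SS τ ω ↔ z ∈ lat τ ∨ z - ω ∈ lat τ := Iff.rfl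

theorem notin_SS : z ∉ SS τ ω ↔ z ∉ lat τ ∧ z - ω ∉ lat τ := by
  rw [mem_SS]; tauto

theorem SS_closed (h : UP τ) (ω : ℂ) : IsClosed (SS τ ω) :=
  (lat_closed h).union ((lat_closed h).preimage (continuous_id.sub continuous_const))

theorem coset_countable (τ a : ℂ) : {z | z - a ∈ lat τ}.Countable :=
  (lat_countable τ).preimage (f := fun z => z - a) fun x y h => by simpa using h

theorem coset_closed (h : UP τ) (a : ℂ) : IsClosed {z | z - a ∈ lat τ} :=
  (lat_closed h).preimage (continuous_id.sub continuous_const)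

theorem SS_countable (τ ω : ℂ) : (SS τ ω).Countable :=
  (lat_countable τ).union (coset_countable τ ω)

theorem SS_neg (h2 : 2 * ω ∈ lat τ) : -z ∈ SS τ ω ↔ z ∈ SS τ ω := by
  rw [mem_SS, mem_SS, lat_neg_iff, ← lat_neg_iff (a := -z - ω)]
  rw [show -(-z - ω) = z - ω + 2 * ω by ring, lat_add_iff h2]

theorem SS_refl : ω - z ∈ SS τ ω ↔ z ∈ SS τ ω := by
  rw [mem_SS, mem_SS, show ω - z - ω = -z by ring, ← lat_neg_iff (a := ω - z), neg_sub, lat_neg_iff]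
  tauto

theorem SS_add (hl : l ∈ lat τ) : z + l ∈ SS τ ω ↔ z ∈ SS τ ω := by
  rw [mem_SS, mem_SS, lat_add_iff hl, show z + l - ω = z - ω + l by ring, lat_add_iff hl]

theorem SS_nhds (h : UP τ) (hz : z ∉ SS τ ω) : ∀ᶠ w in 𝓝 z, w ∉ SS τ ω :=
  (SS_closed h ω).isOpen_compl.mem_nhds hz

theorem SS_punct (h : UP τ) (ω z : ℂ) : ∀ᶠ w in 𝓝[≠] z, w ∉ SS τ ω := by
  filter_upwards [off_lat_sub h 0 z, off_lat_sub h ω z] with w h1 h2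
  rw [notin_SS]; exact ⟨by simpa using h1, h2⟩

theorem per_half (h : UP τ) (hk : K3 k) :
    per τ k / 2 ∉ lat τ ∧ 2 * (per τ k / 2) ∈ lat τ := by
  rw [mul_div_cancel₀ _ (two_ne_zero)]
  rcases hk with rfl | rfl | rfl
  · refine ⟨?_, lat_one τ⟩
    have := half_notin h (m := 1) (n := 0) (by decide)
    simpa [per] using this
  · refine ⟨?_, lat_tau τ⟩
    have := half_notin h (m := 0) (n := 1) (by decide)
    simpa [per] using this
  · refine ⟨?_, lat_add (lat_one τ) (lat_tau τ)⟩
    have := half_notin h (m := 1) (n := 1) (by decide)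
    simpa [per] using this

theorem singSet_star (hk : K3 k) :
    singSet τ (starM k) = SS τ (per τ k / 2) := by
  ext z
  rw [mem_SS, singSet]
  constructor
  · rintro ⟨j, hj, l, hl, rfl⟩
    have : (j : ℕ) = 0 ∨ (j : ℕ) = k := by
      by_contra hc; simp only [starM, if_neg hc] at hj; omega
    rcases this with e | e
    · left; rw [e]; simpa [per] using hl
    · right; rw [e]; simpa using hl
  · rintro (hz | hz)
    · exact ⟨0, by simp [starM], z, hz, by simp [per]⟩
    · refine ⟨⟨k, by omega⟩, by simp [starM], z - per τ k / 2, hz, by simp⟩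

theorem hecke_shift (h : UP τ) (hk : K3 k) (r s : ℂ) :
    heckeZ (rkr k r) (rks k s) τ =
      wzeta τ (r + s * τ + per τ k / 2) - wzeta τ (per τ k / 2) - r * eta1 τ - s * eta2 τ := by
  rcases hk with rfl | rfl | rfl
  · simp only [heckeZ, rkr, rks, per, eta1]
    norm_num
    rw [show r + 1 / 2 + s * τ = r + s * τ + 1 / 2 by ring]; ring
  · simp only [heckeZ, rkr, rks, per, eta2]
    norm_num
    rw [show r + (s + 1 / 2) * τ = r + s * τ + τ / 2 by ring]; ring
  · have h1 : -((1 + τ) / 2) ∉ lat τ := by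
      rw [lat_neg_iff]; exact (per_half h (k := 3) (Or.inr (Or.inr rfl))).1
    have h2 : -((1 + τ) / 2) + 1 ∉ lat τ := by rwa [lat_add_iff (lat_one τ)]
    have e := wzeta_add_tau h h2
    rw [wzeta_add_one h h1, wzeta_neg, show -((1 + τ) / 2) + 1 + τ = (1 + τ) / 2 by ring] at e
    simp only [heckeZ, rkr, rks, per]
    norm_num
    rw [show r + 1 / 2 + (s + 1 / 2) * τ = r + s * τ + (1 + τ) / 2 by ring]
    linear_combination e / 2

theorem hecke_m (h : UP τ) (hk : K3 k) {r s : ℂ}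
    (h0 : heckeZ (rkr k r) (rks k s) τ = 0) (hA : r + s * τ + per τ k / 2 ∉ lat τ)
    (hB : r + s * τ ∉ lat τ) :
    heckeZm k r s τ = wp τ (r + s * τ + per τ k / 2) + 2 * wp τ (per τ k / 2) := by
  rw [hecke_shift h hk] at h0
  have e := FS h hA (v := -(per τ k / 2)) (by rw [lat_neg_iff]; exact (per_half h hk).1)
    (by rwa [add_neg_cancel_right])
  rw [add_neg_cancel_right, wp_neg h, lam, add_neg_cancel_right, wzeta_neg] at e
  rw [heckeZm, heckeZ, eper]
  have e2 : wzeta τ (r + s * τ) - r * eta1 τ - s * eta2 τ = wzeta τ (r + s * τ) -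
      wzeta τ (r + s * τ + per τ k / 2) - -wzeta τ (per τ k / 2) := by linear_combination h0
  rw [e2, e]; ring

theorem real_lat (h : UP τ)
    (e : (r : ℂ) + s * τ = m + n * τ) : r = m ∧ s = n := by
  have h1 := congrArg Complex.im e
  simp at h1
  have h2 : s = n := by
    rcases h1 with h1 | h1
    · exact h1
    · exact absurd h1 h.ne'
  have h3 := congrArg Complex.re e
  simp [h2] at h3
  exact ⟨h3, h2⟩

theorem half_of_two (h : UP τ) (e : 2 * ((r : ℂ) + s * τ) ∈ lat τ) :
    IsHalfIntPair (r : ℂ) (s : ℂ) := by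
  obtain ⟨m, n, e⟩ := e
  have := real_lat h (r := 2 * r) (s := 2 * s) (m := m) (n := n) (by push_cast; linear_combination e)
  refine ⟨m, n, ?_, ?_⟩
  · have e1 : (r : ℂ) = ((m / 2 : ℝ) : ℂ) := by rw [← this.1]; push_cast; ring
    rw [e1]; push_cast; ring
  · have e1 : (s : ℂ) = ((n / 2 : ℝ) : ℂ) := by rw [← this.2]; push_cast; ring
    rw [e1]; push_cast; ring

theorem per_lat {α : Type*} {f : ℂ → α} (h1 : ∀ z, f (z + 1) = f z)
    (h2 : ∀ z, f (z + τ) = f z) (hl : l ∈ lat τ) (z : ℂ) : f (z + l) = f z := by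
  obtain ⟨m, n, rfl⟩ := hl
  have a1 : ∀ m : ℤ, ∀ z, f (z + m) = f z := by
    intro m; induction m using Int.induction_on with
    | zero => simp
    | succ i ih => intro z; rw [← ih z, ← h1 (z + (i : ℤ))]; congr 1; push_cast; ring
    | pred i ih => intro z; rw [← ih z, ← h1]; congr 1; push_cast; ring
  have a2 : ∀ m : ℤ, ∀ z, f (z + m * τ) = f z := by
    intro m; induction m using Int.induction_on with
    | zero => simp
    | succ i ih => intro z; rw [← ih z, ← h2 (z + (i : ℤ) * τ)]; congr 1; push_cast; ring
    | pred i ih => intro z; rw [← ih z, ← h2]; congr 1; push_cast; ring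
  rw [← add_assoc, a2, a1]

theorem mult_lat (n1 : μ1 ≠ 0) (n2 : μ2 ≠ 0)
    (h1 : ∀ z, y (z + 1) = μ1 * y z) (h2 : ∀ z, y (z + τ) = μ2 * y z) (hl : l ∈ lat τ) :
    ∃ c : ℂ, c ≠ 0 ∧ ∀ z, y (z + l) = c * y z := by
  obtain ⟨m, n, rfl⟩ := hl
  have key : ∀ (p μ : ℂ), μ ≠ 0 → (∀ z, y (z + p) = μ * y z) → ∀ m : ℤ, ∀ z, y (z + m * p) = μ ^ m * y z := by
    intro p μ hμ hp m
    induction m using Int.induction_on with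
    | zero => simp
    | succ i ih =>
      intro z; rw [zpow_add_one₀ hμ, mul_comm (μ ^ _) μ, mul_assoc, ← ih z, ← hp]; congr 1; push_cast; ring
    | pred i ih =>
      intro z
      have e := hp (z + ((-(i:ℤ) - 1 : ℤ) : ℂ) * p)
      rw [show z + ((-(i:ℤ) - 1 : ℤ) : ℂ) * p + p = z + ((-(i:ℤ) : ℤ) : ℂ) * p by push_cast; ring, ih] at e
      rw [zpow_sub_one₀ hμ]; field_simp; rw [e]; ring
  refine ⟨μ2 ^ n * μ1 ^ m, mul_ne_zero (zpow_ne_zero _ n2) (zpow_ne_zero _ n1), fun z => ?_⟩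
  rw [← add_assoc, key τ μ2 n2 h2]
  have := key 1 μ1 n1 h1 m z
  rw [mul_one] at this
  rw [this]; ring

theorem yd_pole (Y : YD τ ω a1 a2 y q μ1 μ2 l ε)
    (hp : p ∈ SS τ ω) : ∃ G : ℂ → ℂ, AnalyticAt ℂ G p ∧ G p ≠ 0 ∧ ∀ z, y z = G z / (z - p) := by
  have n1 : μ1 ≠ 0 := by rw [Y.m1]; exact Complex.exp_ne_zero _
  have n2 : μ2 ≠ 0 := by rw [Y.m2]; exact Complex.exp_ne_zero _
  have key : ∀ p0 : ℂ, p - p0 ∈ lat τ → (∃ g : ℂ → ℂ, AnalyticAt ℂ g p0 ∧ g p0 ≠ 0 ∧ ∀ z, y z = g z / (z - p0)) →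
      ∃ G : ℂ → ℂ, AnalyticAt ℂ G p ∧ G p ≠ 0 ∧ ∀ z, y z = G z / (z - p) := by
    rintro p0 hp0 ⟨g, g1, g2, g3⟩
    obtain ⟨c, hc, hc'⟩ := mult_lat n1 n2 Y.per1 Y.per2 hp0
    have e : p - (p - p0) = p0 := by ring
    refine ⟨fun z => c * g (z - (p - p0)), ?_, ?_, fun z => ?_⟩
    · refine analyticAt_const.fun_mul (AnalyticAt.fun_comp (f := fun z => z - (p - p0)) ?_ ?_)
      · simpa [e] using g1
      · exact analyticAt_id.fun_sub analyticAt_const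
    · simp only [e]; exact mul_ne_zero hc g2
    · have := hc' (z - (p - p0))
      rw [sub_add_cancel, g3 (z - _)] at this
      rw [this, show z - (p - p0) - p0 = z - p by ring]; ring
  rcases hp with hp | hp
  · refine key 0 (by simpa using hp) ?_
    simpa using Y.pole0
  · exact key ω hp Y.polew

theorem yd_qrefl (h : UP τ) (Y : YD τ ω a1 a2 y q μ1 μ2 l ε)
    (z : ℂ) : q (ω - z) = q z := by
  rw [Y.qdef, Y.qdef, show ω - z - ω = -z by ring, wp_neg h, wzeta_neg,
    show ω - z = -(z - ω) by ring, wp_neg h, wzeta_neg]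
  ring

theorem yd_mults (h : UP τ) (Y : YD τ ω a1 a2 y q μ1 μ2 l ε) {r s : ℂ} (e : a1 + a2 = r + s * τ + ω) : ∃ n : ℤ, n ≠ 0 ∧
    μ1 = Complex.exp (wzeta τ (r + s * τ + ω) - wzeta τ ω - r * eta1 τ - s * eta2 τ - 2 * Real.pi * Complex.I * n * s) ∧
    μ2 = Complex.exp ((wzeta τ (r + s * τ + ω) - wzeta τ ω - r * eta1 τ - s * eta2 τ) * τ + 2 * Real.pi * Complex.I * n * r) := by
  obtain ⟨n, hn, hl⟩ := legendre h
  refine ⟨n, hn, ?_, ?_⟩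
  · rw [Y.m1, e]; congr 1; linear_combination -s * hl
  · rw [Y.m2, e]; congr 1; linear_combination r * hl

theorem CS.uniq (h : CS O u U q)
    (h' : CS O' u U' q') (hz : z ∈ O) (hz' : z ∈ O') : q z = q' z := by
  have e : ∀ᶠ w in 𝓝 z, U w = U' w := by
    filter_upwards [h.op.mem_nhds hz, h'.op.mem_nhds hz'] with w h1 h2
    exact ((h.du w h1).unique (h'.du w h2)).1
  have h3 := ((h.dU z hz).unique ((h'.dU z hz').congr e)).1
  rw [e.self_of_nhds] at h3
  linear_combination -h3 / 2

theorem CS.reflect (h : CS O u U q) (ho : IsOpen O')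
    (hO : ∀ z ∈ O', -z ∈ O) :
    CS O' (fun z => u (-z)) (fun z => -U (-z)) (fun z => q (-z)) := by
  refine ⟨ho, fun z hz => ?_, fun z hz => ?_, fun z hz => ?_⟩
  · exact ((h.du (-z) (hO z hz)).comp_right (φ := fun z => -z) (hasDerivAt_neg z)).cg (fun _ => rfl)
      (by ring) (by simp)
  · exact ((h.dU (-z) (hO z hz)).comp_right (φ := fun z => -z) (hasDerivAt_neg z)).neg.cg (fun _ => rfl)
      (by ring) (by simp)
  · exact (h.dq (-z) (hO z hz)).comp z differentiableAt_id.neg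

theorem ratio_deriv (h1 : AnalyticAt ℂ y z) (h2 : AnalyticAt ℂ ys z)
    (h0 : ys z ≠ 0) : HasDerivAt (fun w => y w / ys w)
      (-(y z * deriv ys z - deriv y z * ys z) / ys z ^ 2) z :=
  (h1.differentiableAt.hasDerivAt.fun_div h2.differentiableAt.hasDerivAt h0).cg (fun _ => rfl)
    (by ring)

theorem ratio_schw (hW : W0 ≠ 0) (hc : c ≠ 0)
    (h1 : AnalyticAt ℂ y z) (h2 : AnalyticAt ℂ ys z) (h0 : ys z ≠ 0)
    (hw : ∀ᶠ w in 𝓝 z, y w * deriv ys w - deriv y w * ys w = W0)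
    (ho : deriv (deriv ys) z = q z * ys z) :
    deriv (fun w => c * (y w / ys w)) z ≠ 0 ∧
    -(1/2) * (deriv (deriv (deriv (fun w => c * (y w / ys w)))) z / deriv (fun w => c * (y w / ys w)) z
      - 3 / 2 * (deriv (deriv (fun w => c * (y w / ys w))) z / deriv (fun w => c * (y w / ys w)) z) ^ 2) = q z := by
  have a0 : ∀ᶠ w in 𝓝 z, ys w ≠ 0 := h2.continuousAt.eventually_ne h0
  have e1 : deriv (fun w => c * (y w / ys w)) =ᶠ[𝓝 z] fun w => -(c * W0) / ys w ^ 2 := by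
    filter_upwards [h1.eventually_analyticAt, h2.eventually_analyticAt, a0, hw] with w b1 b2 b3 b4
    rw [((ratio_deriv b1 b2 b3).const_mul c).deriv, b4]; ring
  have e2 : deriv (deriv (fun w => c * (y w / ys w))) =ᶠ[𝓝 z] fun w => 2 * (c * W0) * deriv ys w / ys w ^ 3 := by
    filter_upwards [e1.eventually_nhds, h2.eventually_analyticAt, a0] with w b1 b2 b3
    rw [EventuallyEq.deriv_eq b1]
    refine HasDerivAt.deriv (((hasDerivAt_const w (-(c * W0))).fun_div
      (b2.differentiableAt.hasDerivAt.fun_pow 2) (pow_ne_zero 2 b3)).cg (fun _ => rfl) ?_)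
    field_simp; push_cast; ring
  have e3 : deriv (deriv (deriv (fun w => c * (y w / ys w)))) z =
      2 * (c * W0) * (q z / ys z ^ 2 - 3 * deriv ys z ^ 2 / ys z ^ 4) := by
    rw [e2.deriv_eq]
    refine HasDerivAt.deriv (((h2.deriv.differentiableAt.hasDerivAt.const_mul (2 * (c * W0))).fun_div
      (h2.differentiableAt.hasDerivAt.fun_pow 3) (pow_ne_zero 3 h0)).cg (fun _ => rfl) ?_)
    rw [ho]; field_simp; push_cast; ring
  rw [e3, e2.self_of_nhds, e1.self_of_nhds]
  refine ⟨div_ne_zero (neg_ne_zero.2 (mul_ne_zero hc hW)) (pow_ne_zero 2 h0), ?_⟩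
  field_simp; ring

theorem wr_log (h1 : AnalyticAt ℂ y z) (h2 : AnalyticAt ℂ ys z)
    (h0 : ys z ≠ 0) (hw : ‖y z * deriv ys z - deriv y z * ys z‖ = ‖W0‖) :
    Real.log (8 * ‖W0‖ ^ 2 / (‖y z‖ ^ 2 + ‖ys z‖ ^ 2) ^ 2) =
    Real.log (8 * ‖deriv (fun w => y w / ys w) z‖ ^ 2 / (1 + ‖y z / ys z‖ ^ 2) ^ 2) := by
  rw [(ratio_deriv h1 h2 h0).deriv, norm_div, norm_div, norm_neg, hw, norm_pow]
  have : ‖ys z‖ ≠ 0 := norm_ne_zero_iff.2 h0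
  congr 1
  have e1 : 1 + (‖y z‖ / ‖ys z‖) ^ 2 = (‖y z‖ ^ 2 + ‖ys z‖ ^ 2) / ‖ys z‖ ^ 2 := by field_simp; ring
  rw [e1]
  field_simp

/-- from a wronskian pair to a solution -/
theorem pair_sol (h : UP τ) (hk : K3 k)
    (hW : W0 ≠ 0) (ya : ∀ z ∉ SS τ (per τ k / 2), AnalyticAt ℂ y z)
    (sa : ∀ z ∉ SS τ (per τ k / 2), AnalyticAt ℂ ys z)
    (hw : ∀ z ∉ SS τ (per τ k / 2), y z * deriv ys z - deriv y z * ys z = W0)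
    (p1 : ∀ z, ‖y (z + 1)‖ = ‖y z‖) (p2 : ∀ z, ‖y (z + τ)‖ = ‖y z‖)
    (s1 : ∀ z, ‖ys (z + 1)‖ = ‖ys z‖) (s2 : ∀ z, ‖ys (z + τ)‖ = ‖ys z‖)
    (yp : ∀ p ∈ SS τ (per τ k / 2), ∃ G : ℂ → ℂ, AnalyticAt ℂ G p ∧ G p ≠ 0 ∧ ∀ z, y z = G z / (z - p))
    (sp : ∀ p ∈ SS τ (per τ k / 2), ∃ G : ℂ → ℂ, AnalyticAt ℂ G p ∧ G p ≠ 0 ∧ ∀ z, ys z = G z / (z - p)) :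
    IsCurvatureSolution τ (starM k) (fun z => Real.log (8 * ‖W0‖ ^ 2 / (‖y z‖ ^ 2 + ‖ys z‖ ^ 2) ^ 2)) := by
  have nW : 0 < ‖W0‖ := norm_pos_iff.2 hW
  have pos : ∀ z ∉ SS τ (per τ k / 2), 0 < ‖y z‖ ^ 2 + ‖ys z‖ ^ 2 := by
    intro z hz
    by_contra hc
    have e1 : ‖y z‖ = 0 := by nlinarith [norm_nonneg (y z), norm_nonneg (ys z), sq_nonneg ‖y z‖, sq_nonneg ‖ys z‖]
    have e2 : ‖ys z‖ = 0 := by nlinarith [norm_nonneg (y z), norm_nonneg (ys z), sq_nonneg ‖y z‖, sq_nonneg ‖ys z‖]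
    have := hw z hz
    rw [norm_eq_zero.1 e1, norm_eq_zero.1 e2] at this
    exact hW (by rw [← this]; ring)
  refine ⟨fun z => by simp only [p1, s1], fun z => by simp only [p2, s2], ?_, ?_⟩
  · rw [singSet_star hk]
    intro z hz
    constructor
    · intro n
      have c1 : ∀ g : ℂ → ℂ, AnalyticAt ℂ g z → ContDiffAt ℝ n (fun w => ‖g w‖ ^ 2) z := fun g hg =>
        ((hg.contDiffAt (n := n)).restrict_scalars ℝ).norm_sq ℝ
      refine ContDiffAt.log (contDiffAt_const.div (((c1 y (ya z hz)).add (c1 ys (sa z hz))).pow 2) ?_) ?_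
      · exact pow_ne_zero 2 (pos z hz).ne'
      · have := pos z hz; positivity
    · have main : ∀ a b : ℂ → ℂ, AnalyticAt ℂ a z → AnalyticAt ℂ b z → b z ≠ 0 →
          (∀ᶠ w in 𝓝 z, ‖a w * deriv b w - deriv a w * b w‖ = ‖W0‖) →
          lapl (fun z => Real.log (8 * ‖W0‖ ^ 2 / (‖a z‖ ^ 2 + ‖b z‖ ^ 2) ^ 2)) z +
            Real.exp (Real.log (8 * ‖W0‖ ^ 2 / (‖a z‖ ^ 2 + ‖b z‖ ^ 2) ^ 2)) = 0 := by
        intro a b ha hb h0 hw'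
        have ev : ∀ᶠ w in 𝓝 z, Real.log (8 * ‖W0‖ ^ 2 / (‖a w‖ ^ 2 + ‖b w‖ ^ 2) ^ 2) =
            Real.log (8 * ‖deriv (fun w => a w / b w) w‖ ^ 2 / (1 + ‖a w / b w‖ ^ 2) ^ 2) := by
          filter_upwards [ha.eventually_analyticAt, hb.eventually_analyticAt,
            hb.continuousAt.eventually_ne h0, hw'] with w b1 b2 b3 b4
          exact wr_log b1 b2 b3 b4
        obtain ⟨d1, d2⟩ := dev_cs (F := fun w => a w / b w) (ha.fun_div hb h0) (by
          rw [(ratio_deriv ha hb h0).deriv]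
          refine div_ne_zero (neg_ne_zero.2 ?_) (pow_ne_zero 2 h0)
          rw [← norm_ne_zero_iff, hw'.self_of_nhds]; exact nW.ne') ev
        rw [lapl_eq d1 d2, show ∀ x : ℝ, (-((x : ℝ) : ℂ) / 4) = ((-x / 4 : ℝ) : ℂ) from fun x => by push_cast; ring,
          Complex.ofReal_re]
        ring
      by_cases h0 : ys z = 0
      · have h1 : y z ≠ 0 := fun h1 => by have := pos z hz; simp [h0, h1] at this
        have := main ys y (sa z hz) (ya z hz) h1 (by
          filter_upwards [SS_nhds h hz] with w hw'
          rw [← hw w hw', ← norm_neg]; congr 1; ring)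
        simp only [add_comm (‖ys _‖ ^ 2)] at this
        exact this
      · exact main y ys (ya z hz) (sa z hz) h0 (by
          filter_upwards [SS_nhds h hz] with w hw'
          rw [hw w hw'])
  · intro j hj l hl
    have hm : starM k j = 1 := by
      unfold starM at *; split_ifs with h1
      · rfl
      · rw [if_neg h1] at hj; omega
    have hp : per τ j / 2 + l ∈ SS τ (per τ k / 2) := by
      rw [← singSet_star hk]; exact ⟨j, hj, l, hl, rfl⟩
    rw [hm]
    set p := per τ j / 2 + l with hpd
    obtain ⟨G, g1, g2, g3⟩ := yp p hp
    obtain ⟨K, k1, k2, k3⟩ := sp p hp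
    let D : ℂ → ℝ := fun z => Real.log (8 * ‖W0‖ ^ 2 / (‖G z‖ ^ 2 + ‖K z‖ ^ 2) ^ 2)
    have Dp : 0 < ‖G p‖ ^ 2 + ‖K p‖ ^ 2 := by
      have : 0 < ‖G p‖ := norm_pos_iff.2 g2
      positivity
    have Nc : ContinuousAt (fun z => ‖G z‖ ^ 2 + ‖K z‖ ^ 2) p :=
      (g1.continuousAt.norm.pow 2).add (k1.continuousAt.norm.pow 2)
    have Dc : ContinuousAt D p := by
      refine ContinuousAt.log (continuousAt_const.div (Nc.pow 2) (pow_ne_zero 2 Dp.ne')) ?_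
      positivity
    have e1 : ∀ᶠ z in 𝓝 p, |D z| < |D p| + 1 := Dc.abs.eventually_lt_const (by linarith)
    have e2 : ∀ᶠ z in 𝓝 p, 0 < ‖G z‖ ^ 2 + ‖K z‖ ^ 2 := Nc.eventually_const_lt Dp
    obtain ⟨ε, hε, hb⟩ := Metric.eventually_nhds_iff.1 (e1.and e2)
    refine ⟨|D p| + 1, ε, hε, fun z hz hd => ?_⟩
    obtain ⟨b1, b2⟩ := hb hd
    have hd0 : 0 < dist z p := dist_pos.2 hz
    have : Real.log (8 * ‖W0‖ ^ 2 / (‖y z‖ ^ 2 + ‖ys z‖ ^ 2) ^ 2) - 4 * ((1 : ℕ) : ℝ) * Real.log (dist z p) = D z := by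
      have e3 : 8 * ‖W0‖ ^ 2 / (‖y z‖ ^ 2 + ‖ys z‖ ^ 2) ^ 2 =
          8 * ‖W0‖ ^ 2 / (‖G z‖ ^ 2 + ‖K z‖ ^ 2) ^ 2 * (dist z p) ^ 4 := by
        rw [g3, k3, norm_div, norm_div, dist_eq_norm]
        rw [dist_eq_norm] at hd0
        rw [show (‖G z‖ / ‖z - p‖) ^ 2 + (‖K z‖ / ‖z - p‖) ^ 2 = (‖G z‖ ^ 2 + ‖K z‖ ^ 2) / ‖z - p‖ ^ 2 by
          field_simp]
        field_simp
      rw [e3, Real.log_mul (by positivity) (by positivity), Real.log_pow]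
      push_cast; ring
    rw [this]; exact b1.le

theorem pair_dev (h : UP τ)
    (hW : W0 ≠ 0) (ya : ∀ z ∉ SS τ ω, AnalyticAt ℂ y z)
    (sa : ∀ z ∉ SS τ ω, AnalyticAt ℂ ys z)
    (hw : ∀ z ∉ SS τ ω, y z * deriv ys z - deriv y z * ys z = W0)
    (yp : ∀ p ∈ SS τ ω, ∃ G : ℂ → ℂ, AnalyticAt ℂ G p ∧ G p ≠ 0 ∧ ∀ z, y z = G z / (z - p))
    (sp : ∀ p ∈ SS τ ω, ∃ G : ℂ → ℂ, AnalyticAt ℂ G p ∧ G p ≠ 0 ∧ ∀ z, ys z = G z / (z - p)) :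
    IsDevelopingMapOf (fun z => Real.log (8 * ‖W0‖ ^ 2 / (‖y z‖ ^ 2 + ‖ys z‖ ^ 2) ^ 2))
      (fun z => y z / ys z) := by
  have mer : ∀ g : ℂ → ℂ, (∀ z ∉ SS τ ω, AnalyticAt ℂ g z) →
      (∀ p ∈ SS τ ω, ∃ G : ℂ → ℂ, AnalyticAt ℂ G p ∧ G p ≠ 0 ∧ ∀ z, g z = G z / (z - p)) →
      ∀ z, MeromorphicAt g z := by
    intro g ga gp z
    by_cases hz : z ∈ SS τ ω
    · obtain ⟨G, g1, -, g3⟩ := gp z hz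
      rw [show g = G / (fun w => w - z) from funext g3]
      exact g1.meromorphicAt.div (analyticAt_id.fun_sub analyticAt_const).meromorphicAt
    · exact (ga z hz).meromorphicAt
  refine ⟨fun z => (mer y ya yp z).div (mer ys sa sp z), fun z fa fd => ?_⟩
  by_cases hz : z ∈ SS τ ω
  · exfalso
    obtain ⟨K, k1, k2, k3⟩ := sp z hz
    have t1 : Tendsto (deriv fun z => y z / ys z) (𝓝[≠] z) (𝓝 (deriv (fun z => y z / ys z) z)) :=
      fa.deriv.continuousAt.tendsto.mono_left nhdsWithin_le_nhds
    have t2 : Tendsto (fun w => -W0 * (w - z) ^ 2 / K w ^ 2) (𝓝[≠] z) (𝓝 0) := by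
      have : ContinuousAt (fun w => -W0 * (w - z) ^ 2 / K w ^ 2) z :=
        ((continuousAt_const.mul ((continuousAt_id.sub continuousAt_const).pow 2)).div
          (k1.continuousAt.pow 2) (pow_ne_zero 2 k2))
      have := this.tendsto.mono_left (nhdsWithin_le_nhds (s := {z}ᶜ))
      simpa using this
    refine fd (tendsto_nhds_unique t1 (t2.congr' ?_))
    filter_upwards [self_mem_nhdsWithin, SS_punct h ω z,
      nhdsWithin_le_nhds (k1.continuousAt.eventually_ne k2)] with w b1 b2 b3
    have b4 : w - z ≠ 0 := sub_ne_zero.2 b1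
    have b5 : ys w ≠ 0 := by rw [k3]; exact div_ne_zero b3 b4
    rw [(ratio_deriv (ya w b2) (sa w b2) b5).deriv, hw w b2, k3]
    field_simp
  · by_cases h0 : ys z = 0
    · exfalso
      have hy : y z ≠ 0 := fun h1 => hW (by rw [← hw z hz, h0, h1]; ring)
      have nz : ∀ᶠ w in 𝓝[≠] z, ys w ≠ 0 := by
        rcases (sa z hz).eventually_eq_zero_or_eventually_ne_zero with e | e
        · exfalso; apply hW
          rw [← hw z hz, h0, show deriv ys z = 0 by
            have : ys =ᶠ[𝓝 z] fun _ => 0 := e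
            rw [this.deriv_eq]; simp]
          ring
        · exact e
      have t1 : Tendsto y (𝓝[≠] z) (𝓝 (y z)) := (ya z hz).continuousAt.tendsto.mono_left nhdsWithin_le_nhds
      have t2 : Tendsto (fun w => (y w / ys w) * ys w) (𝓝[≠] z) (𝓝 (y z / ys z * ys z)) :=
        (fa.continuousAt.mul (sa z hz).continuousAt).tendsto.mono_left nhdsWithin_le_nhds
      rw [h0, mul_zero] at t2
      refine hy (tendsto_nhds_unique t1 (t2.congr' ?_))
      filter_upwards [nz] with w hw'
      field_simp
    · exact wr_log (ya z hz) (sa z hz) h0 (by rw [hw z hz])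

theorem yd_star (h : UP τ) (Y : YD τ ω a1 a2 y q μ1 μ2 l ε) :
    (∀ z ∉ SS τ ω, AnalyticAt ℂ y z) ∧ (∀ z ∉ SS τ ω, AnalyticAt ℂ (fun z => y (ω - z)) z) ∧
    (∀ z ∉ SS τ ω, deriv (deriv (fun z => y (ω - z))) z = q z * y (ω - z)) ∧
    (∀ p ∈ SS τ ω, ∃ G : ℂ → ℂ, AnalyticAt ℂ G p ∧ G p ≠ 0 ∧ ∀ z, y (ω - z) = G z / (z - p)) := by
  have ya : ∀ z ∉ SS τ ω, AnalyticAt ℂ y z := fun z hz => Y.an z (notin_SS.1 hz).1 (notin_SS.1 hz).2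
  refine ⟨ya, fun z hz => ?_, fun z hz => ?_, fun p hp => ?_⟩
  · refine AnalyticAt.fun_comp (f := fun z => ω - z) (ya _ ?_) (analyticAt_const.fun_sub analyticAt_id)
    rwa [SS_refl]
  · have e : deriv (fun z => y (ω - z)) = fun z => - deriv y (ω - z) := by
      funext w; rw [deriv_comp_const_sub]
    rw [e, deriv.fun_neg, deriv_comp_const_sub, neg_neg]
    have hz' := notin_SS.1 (mt SS_refl.1 hz)
    rw [Y.ode _ hz'.1 hz'.2, yd_qrefl h Y]
  · obtain ⟨G, g1, g2, g3⟩ := yd_pole Y (SS_refl.2 hp)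
    refine ⟨fun z => -G (ω - z), ?_, neg_ne_zero.2 g2, fun z => ?_⟩
    · exact (AnalyticAt.fun_comp (f := fun z => ω - z) g1 (analyticAt_const.fun_sub analyticAt_id)).fun_neg
    · rw [g3, show ω - z - (ω - p) = -(z - p) by ring, div_neg, neg_div]

theorem ode_wr (h : UP τ) (ya : ∀ z ∉ SS τ ω, AnalyticAt ℂ y z)
    (sa : ∀ z ∉ SS τ ω, AnalyticAt ℂ ys z) (yo : ∀ z ∉ SS τ ω, deriv (deriv y) z = q z * y z)
    (so : ∀ z ∉ SS τ ω, deriv (deriv ys) z = q z * ys z) :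
    ∃ W0, ∀ z ∉ SS τ ω, y z * deriv ys z - deriv y z * ys z = W0 := by
  by_cases hne : ∃ z, z ∉ SS τ ω
  · obtain ⟨z0, hz0⟩ := hne
    refine ⟨y z0 * deriv ys z0 - deriv y z0 * ys z0, fun z hz => ?_⟩
    refine const_of_deriv_zero (SS_countable τ ω) (SS_closed h ω)
      (f := fun z => y z * deriv ys z - deriv y z * ys z) (fun w hw => ?_) hz hz0
    refine (((ya w hw).differentiableAt.hasDerivAt.fun_mul (sa w hw).deriv.differentiableAt.hasDerivAt).fun_sub
      ((ya w hw).deriv.differentiableAt.hasDerivAt.fun_mul (sa w hw).differentiableAt.hasDerivAt)).cg (fun _ => rfl) ?_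
    rw [yo w hw, so w hw]; ring
  · exact ⟨0, fun z hz => absurd ⟨z, hz⟩ hne⟩

theorem yd_wr (h : UP τ) (h2 : 2 * ω ∈ lat τ)
    (Y : YD τ ω a1 a2 y q μ1 μ2 l ε) (hA : 2 * (a1 + a2 - ω) ∉ lat τ) :
    ∃ W0, W0 ≠ 0 ∧ ∀ z ∉ SS τ ω, y z * deriv (fun z => y (ω - z)) z - deriv y z * y (ω - z) = W0 := by
  obtain ⟨ya, sa, so, -⟩ := yd_star h Y
  obtain ⟨W0, hw⟩ := ode_wr h ya sa (fun z hz => Y.ode z (notin_SS.1 hz).1 (notin_SS.1 hz).2) so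
  refine ⟨W0, ?_, hw⟩
  rintro rfl
  let T := SS τ ω ∪ ({z | z - a1 ∈ lat τ} ∪ {z | z - a2 ∈ lat τ})
  have Tc : T.Countable := (SS_countable τ ω).union ((coset_countable τ a1).union (coset_countable τ a2))
  have Tcl : IsClosed T := (SS_closed h ω).union ((coset_closed h a1).union (coset_closed h a2))
  have yz : ∀ z ∉ T, z ∉ SS τ ω ∧ y z ≠ 0 := by
    intro z hz
    have h1 : z ∉ SS τ ω := fun hc => hz (Or.inl hc)
    refine ⟨h1, fun hc => hz (Or.inr ?_)⟩
    exact (Y.zer z (notin_SS.1 h1).1 (notin_SS.1 h1).2).1 hc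
  have tp : ∀ z : ℂ, ∀ᶠ w in 𝓝[≠] z, w ∉ T := by
    intro z
    filter_upwards [SS_punct h ω z, off_lat_sub h a1 z, off_lat_sub h a2 z] with w b1 b2 b3
    rintro (hc | hc | hc)
    exacts [b1 hc, b2 hc, b3 hc]
  obtain ⟨z0, hz0⟩ := (tp 0).exists
  have rat : ∀ z ∉ T, y (ω - z) / y z = y (ω - z0) / y z0 := fun z hz => by
    refine const_of_deriv_zero Tc Tcl (f := fun z => y (ω - z) / y z) (fun w hw' => ?_) hz hz0
    obtain ⟨b1, b2⟩ := yz w hw'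
    refine (ratio_deriv (sa w b1) (ya w b1) b2).cg (fun _ => rfl) ?_
    rw [show y (ω - w) * deriv y w - deriv (fun z => y (ω - z)) w * y w = 0 by
      linear_combination -hw w b1]; simp
  set c := y (ω - z0) / y z0
  have lim : ∀ z ∉ SS τ ω, y (ω - z) = c * y z := by
    intro z hz
    have t1 : Tendsto (fun z => y (ω - z)) (𝓝[≠] z) (𝓝 (y (ω - z))) :=
      (sa z hz).continuousAt.tendsto.mono_left nhdsWithin_le_nhds
    have t2 : Tendsto (fun z => c * y z) (𝓝[≠] z) (𝓝 (c * y z)) :=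
      (continuousAt_const.mul (ya z hz).continuousAt).tendsto.mono_left nhdsWithin_le_nhds
    refine tendsto_nhds_unique t1 (t2.congr' ?_)
    filter_upwards [tp z] with w hw'
    rw [← rat w hw']; field_simp [(yz w hw').2]
  have zz : ∀ a, (a - a1 ∈ lat τ ∨ a - a2 ∈ lat τ) → a ∉ lat τ → a - ω ∉ lat τ →
      (ω - a) - a1 ∈ lat τ ∨ (ω - a) - a2 ∈ lat τ := by
    intro a ha n1 n2
    have hs : a ∉ SS τ ω := notin_SS.2 ⟨n1, n2⟩
    have e := lim a hs
    rw [(Y.zer a n1 n2).2 ha, mul_zero] at e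
    have hs' := notin_SS.1 (mt SS_refl.1 hs)
    exact (Y.zer _ hs'.1 hs'.2).1 e
  have z1 := zz a1 (Or.inl (by simpa using lat_zero τ)) Y.a1n Y.a1w
  have z2 := zz a2 (Or.inr (by simpa using lat_zero τ)) Y.a2n Y.a2w
  have no : ω - a1 - a2 ∉ lat τ := fun hc => hA (by
    have := lat_neg (lat_add hc hc)
    rwa [show -(ω - a1 - a2 + (ω - a1 - a2)) = 2 * (a1 + a2 - ω) by ring] at this)
  have y1 : ω - a1 - a1 ∈ lat τ := z1.resolve_right no
  have y2 : ω - a2 - a2 ∈ lat τ := z2.resolve_left (by rwa [sub_right_comm])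
  apply hA
  rw [← lat_add_iff h2]
  have := lat_neg (lat_sub (lat_add y1 y2) h2)
  rwa [show -(ω - a1 - a1 + (ω - a2 - a2) - 2 * ω) = 2 * (a1 + a2 - ω) + 2 * ω by ring] at this

theorem norm_exp_I (x : ℝ) : ‖Complex.exp (2 * Real.pi * Complex.I * x)‖ = 1 := by
  rw [show (2 * Real.pi * Complex.I * x : ℂ) = ((2 * Real.pi * x : ℝ) : ℂ) * Complex.I by push_cast; ring,
    Complex.norm_exp_ofReal_mul_I]

theorem left_dir (h : UP τ) (hk : K3 k)
    (hrs : ¬ IsHalfIntPair (r : ℂ) (s : ℂ)) (hz : heckeZ (rkr k (r : ℂ)) (rks k (s : ℂ)) τ = 0)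
    (hzm : heckeZm k (r : ℂ) (s : ℂ) τ ≠ 0) : HasNonEvenFamily τ (starM k) := by
  obtain ⟨hω, h2⟩ := per_half h hk
  have hB2 : 2 * ((r : ℂ) + s * τ) ∉ lat τ := fun hc => hrs (half_of_two h hc)
  have hB : (r : ℂ) + s * τ ∉ lat τ := fun hc => hB2 (by rw [two_mul]; exact lat_add hc hc)
  have hA : (r : ℂ) + s * τ + per τ k / 2 ∉ lat τ := fun hc => hB2 (by
    rw [← lat_add_iff h2]; have := lat_add hc hc
    rwa [show 2 * ((r : ℂ) + s * τ) + 2 * (per τ k / 2) = (r : ℂ) + s * τ + per τ k / 2 + ((r : ℂ) + s * τ + per τ k / 2) by ring])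
  have hzm' := hecke_m h hk hz hA hB
  set ω := per τ k / 2 with hωd
  obtain ⟨a1, ha1, ha2, he⟩ := exists_pair h hA (2 * wp τ ω)
  have eA : a1 + ((r : ℂ) + s * τ + ω - a1) = r + s * τ + ω := by ring
  obtain ⟨y, q, μ1, μ2, ε, Y⟩ := ydata h hω h2 ha1 ha2 (by rwa [eA]) he
  set l := lam τ a1 ((r : ℂ) + s * τ + ω - a1)
  have hl : l ≠ 0 := fun hc => hzm (by
    have := Y.lsq; rw [hc, eA] at this; rw [hzm', ← this]; ring)
  obtain ⟨n, -, m1, m2⟩ := yd_mults h Y eA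
  rw [hecke_shift h hk, ← hωd] at hz
  rw [hz] at m1 m2
  obtain ⟨W0, hW, hw⟩ := yd_wr h h2 Y (by rw [eA]; simpa using hB2)
  obtain ⟨ya, sa, so, sp⟩ := yd_star h Y
  have nm1 : ‖μ1‖ = 1 := by
    rw [m1, show (0 - 2 * Real.pi * Complex.I * n * s : ℂ) = 2 * Real.pi * Complex.I * ((-(n * s) : ℝ) : ℂ) by push_cast; ring]
    exact norm_exp_I _
  have nm2 : ‖μ2‖ = 1 := by
    rw [m2, show (0 * τ + 2 * Real.pi * Complex.I * n * r : ℂ) = 2 * Real.pi * Complex.I * (((n * r) : ℝ) : ℂ) by push_cast; ring]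
    exact norm_exp_I _
  have z1 : μ1 ≠ 0 := norm_ne_zero_iff.1 (by rw [nm1]; norm_num)
  have z2 : μ2 ≠ 0 := norm_ne_zero_iff.1 (by rw [nm2]; norm_num)
  have s1 : ∀ z, y (ω - (z + 1)) = μ1⁻¹ * y (ω - z) := fun z => by
    rw [eq_inv_mul_iff_mul_eq₀ z1, ← Y.per1]; congr 1; ring
  have s2 : ∀ z, y (ω - (z + τ)) = μ2⁻¹ * y (ω - z) := fun z => by
    rw [eq_inv_mul_iff_mul_eq₀ z2, ← Y.per2]; congr 1; ring
  refine ⟨_, fun z => y z / y (ω - z), pair_sol h hk hW ya sa hw (fun z => by rw [Y.per1, norm_mul, nm1, one_mul])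
    (fun z => by rw [Y.per2, norm_mul, nm2, one_mul]) (fun z => by simp only [s1, norm_mul, norm_inv, nm1]; simp)
    (fun z => by simp only [s2, norm_mul, norm_inv, nm2]; simp) (fun p hp => yd_pole Y hp) sp,
    pair_dev h hW ya sa hw (fun p hp => yd_pole Y hp) sp, ?_, ?_⟩
  · refine ⟨-(2 * Real.pi * n * s), 2 * Real.pi * n * r, fun z => ?_, fun z => ?_⟩
    · simp only [s1, Y.per1]
      have : Complex.exp (2 * Complex.I * ((-(2 * Real.pi * n * s) : ℝ) : ℂ)) = μ1 * μ1 := by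
        rw [m1, ← Complex.exp_add]; congr 1; push_cast; ring
      rw [this]; field_simp
    · simp only [s2, Y.per2]
      have : Complex.exp (2 * Complex.I * ((2 * Real.pi * n * r : ℝ) : ℂ)) = μ2 * μ2 := by
        rw [m2, ← Complex.exp_add]; congr 1; push_cast; ring
      rw [this]; field_simp
  · rintro ⟨β, v, hv, hd, hev⟩
    have C : CS (SS τ ω)ᶜ v (wirt fun w => (v w : ℂ)) (uPot v) :=
      cs_of_sol (SS_closed h ω).isOpen_compl fun z hz => hv.2.2.1 z (by rw [singSet_star hk]; exact hz)
    have hq : ∀ z ∉ SS τ ω, y (ω - z) ≠ 0 → uPot v z = q z := by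
      intro z hz' h0
      have hwe : ∀ᶠ w in 𝓝 z, y w * deriv (fun z => y (ω - z)) w - deriv y w * y (ω - w) = W0 := by
        filter_upwards [SS_nhds h hz'] with w hw' using hw w hw'
      have hβ : ((Real.exp β : ℝ) : ℂ) ≠ 0 := by exact_mod_cast (Real.exp_pos β).ne'
      obtain ⟨b1, b2⟩ := ratio_schw hW hβ (ya z hz') (sa z hz') h0 hwe (so z hz')
      have Fa : AnalyticAt ℂ (fun w => ((Real.exp β : ℝ) : ℂ) * (y w / y (ω - w))) z :=
        analyticAt_const.fun_mul ((ya z hz').fun_div (sa z hz') h0)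
      rw [← b2]
      refine C.dev hz' Fa b1 ?_
      filter_upwards [Fa.eventually_analyticAt, Fa.deriv.continuousAt.eventually_ne b1] with w c1 c2
      exact hd.2 w c1 c2
    have qe : ∀ z ∉ SS τ ω, uPot v (-z) = uPot v z := by
      intro z hz'
      have C' := C.reflect (SS_closed h ω).isOpen_compl (fun z hz => (mt (SS_neg h2).1 hz))
      rw [show (fun z => v (-z)) = v from funext hev] at C'
      exact C'.uniq C hz' hz'
    obtain ⟨m, ma, m0, mq⟩ := Y.q0
    obtain ⟨G, g1, g2, g3⟩ := sp 0 (Or.inl (lat_zero τ))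
    have ne : ∀ᶠ z in 𝓝[≠] (0 : ℂ), z ∉ SS τ ω ∧ y (ω - z) ≠ 0 ∧
        q z = 2 / z ^ 2 - 2 * m z / z + deriv m z + m z ^ 2 := by
      filter_upwards [SS_punct h ω 0, nhdsWithin_le_nhds (g1.continuousAt.eventually_ne g2),
        self_mem_nhdsWithin, mq] with z b1 b2 b3 b4
      refine ⟨b1, ?_, b4⟩
      rw [g3]; exact div_ne_zero b2 (by simpa using b3)
    have ne' : ∀ᶠ z in 𝓝[≠] (0 : ℂ), -z ∉ SS τ ω ∧ y (ω - -z) ≠ 0 ∧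
        q (-z) = 2 / (-z) ^ 2 - 2 * m (-z) / (-z) + deriv m (-z) + m (-z) ^ 2 := by
      have := tendsto_neg_punct 0
      rw [neg_zero] at this
      exact this.eventually ne
    have ma' : AnalyticAt ℂ m (-0) := by rwa [neg_zero]
    have cm : ContinuousAt (fun z => m (-z)) 0 :=
      ContinuousAt.comp (f := fun z : ℂ => -z) ma'.continuousAt continuousAt_neg
    have cm' : ContinuousAt (fun z => deriv m (-z)) 0 :=
      ContinuousAt.comp (f := fun z : ℂ => -z) ma'.deriv.continuousAt continuousAt_neg
    have t : ContinuousAt (fun z => -2 * (m z + m (-z)) + z * (deriv m z + m z ^ 2 - deriv m (-z) - m (-z) ^ 2)) 0 :=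
      (continuousAt_const.mul (ma.continuousAt.add cm)).add (continuousAt_id.mul
        (((ma.deriv.continuousAt.add (ma.continuousAt.pow 2)).sub cm').sub (cm.pow 2)))
    have t' := t.tendsto.mono_left (nhdsWithin_le_nhds (s := {0}ᶜ))
    have := tendsto_nhds_unique (t'.congr' (f₂ := fun _ => (0 : ℂ)) ?_) tendsto_const_nhds
    · simp [m0] at this
      exact hl this
    · filter_upwards [ne, ne', self_mem_nhdsWithin] with z b1 b2 b3
      have e := qe z b1.1
      rw [hq z b1.1 b1.2.1, hq _ b2.1 b2.2.1, b1.2.2, b2.2.2] at e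
      have b3 : z ≠ 0 := b3
      field_simp at e
      have : z ^ 1 * (-2 * (m z + m (-z)) + z * (deriv m z + m z ^ 2 - deriv m (-z) - m (-z) ^ 2)) = 0 := by
        linear_combination -e
      exact (mul_eq_zero.1 this).resolve_left (pow_ne_zero _ b3)

theorem cp_int {a : ℂ → ℂ} (ha : ContDiff ℝ 1 a) (hc : HasCompactSupport a) (z : ℂ) :
    ∫ w, w⁻¹ * dzb a (z - w) = Real.pi * a z := by
  have dc : Continuous (fderiv ℝ a) := ha.continuous_fderiv one_ne_zero
  obtain ⟨R, hR⟩ : ∃ R : ℝ, ∀ w, R < ‖w‖ → a =ᶠ[𝓝 (z - w)] 0 := by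
    obtain ⟨R, hR⟩ := hc.isBounded.exists_norm_le
    refine ⟨R + ‖z‖, fun w hw => ?_⟩
    have : z - w ∉ tsupport a := fun h => by
      have h1 := hR _ h
      have h2 := norm_sub_norm_le w z
      rw [norm_sub_rev] at h2
      linarith
    exact notMem_tsupport_iff_eventuallyEq.1 this
  have en : ∀ θ : ℝ, ‖Complex.exp (θ * Complex.I)‖ = 1 := fun θ => Complex.norm_exp_ofReal_mul_I θ
  let pt : ℝ × ℝ → ℂ := fun p => z - p.1 * Complex.exp (p.2 * Complex.I)
  have ptc : Continuous pt := by fun_prop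
  let F : ℝ × ℝ → ℂ := fun p => fderiv ℝ a (pt p) (Complex.exp (p.2 * Complex.I))
  let G : ℝ × ℝ → ℂ := fun p => fderiv ℝ a (pt p) (Complex.I * Complex.exp (p.2 * Complex.I))
  have Fc : Continuous F := (dc.comp ptc).clm_apply (by fun_prop)
  have Gc : Continuous G := (dc.comp ptc).clm_apply (by fun_prop)
  have zer : ∀ p : ℝ × ℝ, R < p.1 → 0 < p.1 → fderiv ℝ a (pt p) = 0 := by
    intro p hp h0
    have := (hR (p.1 * Complex.exp (p.2 * Complex.I)) (by
      rw [norm_mul, en, mul_one, Complex.norm_real, Real.norm_of_nonneg h0.le]; exact hp)).fderiv_eq (𝕜 := ℝ)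
    rw [show pt p = z - p.1 * Complex.exp (p.2 * Complex.I) from rfl, this]
    simp
  have int : ∀ H : ℝ × ℝ → ℂ, Continuous H → (∀ p, R < p.1 → 0 < p.1 → H p = 0) →
      MeasureTheory.IntegrableOn H (Ioi (0:ℝ) ×ˢ Ioo (-Real.pi) Real.pi) := by
    intro H Hc Hz
    have : MeasureTheory.IntegrableOn H (Icc (0:ℝ) R ×ˢ Icc (-Real.pi) Real.pi) :=
      Hc.continuousOn.integrableOn_compact (isCompact_Icc.prod isCompact_Icc)
    refine this.of_forall_sdiff_eq_zero (measurableSet_Ioi.prod measurableSet_Ioo) fun p hp => ?_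
    refine Hz p ?_ hp.1.1
    by_contra h
    exact hp.2 ⟨⟨le_of_lt hp.1.1, not_lt.1 h⟩, ⟨hp.1.2.1.le, hp.1.2.2.le⟩⟩
  have Fi := int F Fc fun p h1 h2 => by simp [F, zer p h1 h2]
  have Gi := int G Gc fun p h1 h2 => by simp [G, zer p h1 h2]
  have hd : ∀ w, HasFDerivAt a (fderiv ℝ a w) w := fun w =>
    (ha.differentiable one_ne_zero w).hasFDerivAt
  have hr : ∀ r θ : ℝ, HasDerivAt (fun r : ℝ => a (pt (r, θ))) (-F (r, θ)) r := by
    intro r θ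
    have h1 : HasDerivAt (fun r : ℝ => pt (r, θ)) (-Complex.exp (θ * Complex.I)) r := by
      have := (Complex.ofRealCLM.hasDerivAt (x := r)).mul_const (Complex.exp (θ * Complex.I))
      have := this.const_sub z
      simpa using this
    have := (hd (pt (r, θ))).comp_hasDerivAt r h1
    exact this.congr_deriv (by simp [F])
  have hθ : ∀ r θ : ℝ, HasDerivAt (fun θ : ℝ => a (pt (r, θ))) (-(r * G (r, θ))) θ := by
    intro r θ
    have h1 : HasDerivAt (fun θ : ℝ => pt (r, θ)) (-(r * (Complex.I * Complex.exp (θ * Complex.I)))) θ := by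
      have h2 : HasDerivAt (fun θ : ℝ => (θ : ℂ) * Complex.I) Complex.I θ := by
        simpa using (Complex.ofRealCLM.hasDerivAt (x := θ)).mul_const Complex.I
      have := (h2.cexp.const_mul (r : ℂ)).const_sub z
      exact this.congr_deriv (by ring)
    have := (hd (pt (r, θ))).comp_hasDerivAt θ h1
    rw [map_neg, ← Complex.real_smul, map_smul] at this
    exact this.congr_deriv (by simp [G])
  have gz : ∫ p in Ioi (0:ℝ) ×ˢ Ioo (-Real.pi) Real.pi, G p = 0 := by
    rw [MeasureTheory.Measure.volume_eq_prod, MeasureTheory.setIntegral_prod _ Gi]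
    refine MeasureTheory.setIntegral_eq_zero_of_forall_eq_zero fun r hr => ?_
    rw [← MeasureTheory.integral_Ioc_eq_integral_Ioo, ← intervalIntegral.integral_of_le (by linarith [Real.pi_pos])]
    have := intervalIntegral.integral_eq_sub_of_hasDerivAt (a := -Real.pi) (b := Real.pi) (fun θ _ => hθ r θ)
      ((by fun_prop : Continuous fun θ : ℝ => -((r:ℂ) * G (r, θ))).intervalIntegrable _ _)
    rw [show a (pt (r, Real.pi)) - a (pt (r, -Real.pi)) = 0 by
      simp only [pt]
      simp [Complex.exp_neg, Complex.exp_pi_mul_I], intervalIntegral.integral_neg, intervalIntegral.integral_const_mul] at this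
    have hr : (r : ℂ) ≠ 0 := by exact_mod_cast (ne_of_gt hr)
    simpa [hr] using this
  have fz : ∫ p in Ioi (0:ℝ) ×ˢ Ioo (-Real.pi) Real.pi, F p = 2 * Real.pi * a z := by
    have Fi' : MeasureTheory.IntegrableOn (fun p : ℝ × ℝ => F p.swap) (Ioo (-Real.pi) Real.pi ×ˢ Ioi (0:ℝ)) := by
      have := MeasureTheory.Integrable.swap (f := F) (μ := MeasureTheory.volume.restrict (Ioi (0:ℝ))) (ν := MeasureTheory.volume.restrict (Ioo (-Real.pi) Real.pi)) (by
        rw [MeasureTheory.Measure.prod_restrict]; exact Fi)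
      rw [MeasureTheory.Measure.prod_restrict] at this
      exact this
    rw [MeasureTheory.Measure.volume_eq_prod, ← MeasureTheory.setIntegral_prod_swap, MeasureTheory.setIntegral_prod _ Fi']
    have : ∀ θ : ℝ, ∫ r in Ioi (0:ℝ), F (r, θ) = a z := by
      intro θ
      have hz : ∀ r : ℝ, R < r → 0 < r → a (pt (r, θ)) = 0 := fun r h1 h2 => by
        have := (hR (r * Complex.exp (θ * Complex.I)) (by
          rw [norm_mul, en, mul_one, Complex.norm_real, Real.norm_of_nonneg h2.le]; exact h1)).eq_of_nhds
        simpa [pt] using this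
      have ii : MeasureTheory.IntegrableOn (fun r : ℝ => F (r, θ)) (Ioi 0) := by
        have : MeasureTheory.IntegrableOn (fun r : ℝ => F (r, θ)) (Icc 0 R) :=
          (by fun_prop : Continuous fun r : ℝ => F (r, θ)).continuousOn.integrableOn_compact isCompact_Icc
        refine this.of_forall_sdiff_eq_zero measurableSet_Ioi fun r hr => ?_
        have h1 : R < r := by
          by_contra h
          exact hr.2 ⟨le_of_lt hr.1, not_lt.1 h⟩
        simp [F, zer (r, θ) h1 hr.1]
      have := MeasureTheory.integral_Ioi_of_hasDerivAt_of_tendsto' (a := 0) (m := 0) (fun r _ => hr r θ) ii.neg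
        (tendsto_const_nhds.congr' (by
          filter_upwards [eventually_gt_atTop R, eventually_gt_atTop 0] with r h1 h2
          rw [hz r h1 h2]))
      rw [MeasureTheory.integral_neg] at this
      simp only [pt] at this
      simpa using this
    simp only [Prod.swap_prod_mk, this]
    simp [Real.pi_pos.le]
    left; ring
  rw [← Complex.integral_comp_polarCoord_symm]
  have key : ∀ p ∈ Ioi (0:ℝ) ×ˢ Ioo (-Real.pi) Real.pi, p.1 • ((Complex.polarCoord.symm p)⁻¹ * dzb a (z - Complex.polarCoord.symm p)) = (1/2 : ℂ) * (F p + Complex.I * G p) := by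
    intro p hp
    have e1 : Complex.polarCoord.symm p = p.1 * Complex.exp (p.2 * Complex.I) := by
      rw [Complex.polarCoord_symm_apply, Complex.exp_mul_I]; simp
    have hW := hw_of_diff (ha.differentiable one_ne_zero (pt p))
    have e2 : ∀ h, fderiv ℝ a (pt p) h = wirt a (pt p) * h + dzb a (pt p) * starRingEnd ℂ h := by
      intro h; rw [HasFDerivAt.fderiv hW, LL_apply]
    have p1 : (p.1 : ℂ) ≠ 0 := by exact_mod_cast (ne_of_gt hp.1)
    have ee := Complex.exp_ne_zero (p.2 * Complex.I)
    have e3 : starRingEnd ℂ (Complex.exp (p.2 * Complex.I)) = (Complex.exp (p.2 * Complex.I))⁻¹ := by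
      rw [← Complex.exp_conj, ← Complex.exp_neg]; simp
    simp only [F, G, e2, map_mul, e3, Complex.conj_I]
    rw [e1, show z - p.1 * Complex.exp (p.2 * Complex.I) = pt p from rfl, Complex.real_smul]
    field_simp
    linear_combination (dzb a (pt p) - wirt a (pt p) * Complex.exp (p.2 * Complex.I) ^ 2 ) * Complex.I_sq
  have mt : MeasurableSet (Ioi (0:ℝ) ×ˢ Ioo (-Real.pi) Real.pi) := measurableSet_Ioi.prod measurableSet_Ioo
  rw [show polarCoord.target = Ioi (0:ℝ) ×ˢ Ioo (-Real.pi) Real.pi from rfl,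
    MeasureTheory.setIntegral_congr_fun mt key, MeasureTheory.integral_const_mul,
    MeasureTheory.integral_add Fi (Gi.const_mul _), MeasureTheory.integral_const_mul, fz, gz]
  ring

theorem inv_locint : MeasureTheory.LocallyIntegrable (fun w : ℂ => w⁻¹) := by
  refine MeasureTheory.locallyIntegrable_of_norm_le_rpow (C := 1) (α := 1) (by simp) (by simp) ?_ ?_
  · refine Eventually.of_forall fun w => ?_
    rw [one_mul, Real.rpow_neg_one, norm_inv]
  · exact (measurable_inv).aestronglyMeasurable

theorem ct_smooth {a : ℂ → ℂ} (ha : ContDiff ℝ 1 a) (hc : HasCompactSupport a) (z : ℂ) :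
    ∃ g1, HW (fun z => ∫ w, (z - w)⁻¹ * a w) g1 (Real.pi * a z) z := by
  have h := hc.hasFDerivAt_convolution_right (ContinuousLinearMap.mul ℝ ℂ) inv_locint ha z
  set L := (MeasureTheory.convolution (fun w : ℂ => w⁻¹) (fderiv ℝ a)
    ((ContinuousLinearMap.mul ℝ ℂ).precompR ℂ) MeasureTheory.volume) z with hL
  have e0 : (fun z => ∫ w, (z - w)⁻¹ * a w) = MeasureTheory.convolution (fun w : ℂ => w⁻¹) a (ContinuousLinearMap.mul ℝ ℂ) MeasureTheory.volume := by
    ext z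
    rw [MeasureTheory.convolution_def]
    rw [← MeasureTheory.integral_sub_left_eq_self (fun t => (z - t)⁻¹ * a t) _ z]
    simp
  have eL : ∀ v, L v = ∫ w, w⁻¹ * fderiv ℝ a (z - w) v := by
    intro v
    rw [hL, MeasureTheory.convolution_precompR_apply _ inv_locint (hc.fderiv ℝ)
      (ha.continuous_fderiv one_ne_zero), MeasureTheory.convolution_def]
    simp
  have ii : ∀ v, MeasureTheory.Integrable fun w => w⁻¹ * fderiv ℝ a (z - w) v := by
    intro v
    have := (HasCompactSupport.convolutionExists_right (ContinuousLinearMap.mul ℝ ℂ)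
      (g := fun w => fderiv ℝ a w v) (f := fun w : ℂ => w⁻¹) (μ := MeasureTheory.volume)
      ((hc.fderiv ℝ).comp_left (g := fun L : ℂ →L[ℝ] ℂ => L v) (by simp)) inv_locint
      ((ha.continuous_fderiv one_ne_zero).clm_apply continuous_const)) z
    simpa [MeasureTheory.ConvolutionExistsAt] using this
  rw [e0]
  have hd := hw_of_diff h.differentiableAt
  refine ⟨_, hd.cg (fun _ => rfl) rfl ?_⟩
  unfold dzb
  rw [h.fderiv, eL, eL, ← MeasureTheory.integral_const_mul, ← MeasureTheory.integral_add (ii _) ((ii _).const_mul _),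
    ← MeasureTheory.integral_const_mul, ← cp_int ha hc z]
  refine MeasureTheory.integral_congr_ae (Eventually.of_forall fun w => ?_)
  simp only [dzb]
  ring

theorem ct_far {b : ℂ → ℂ} (hb : MeasureTheory.Integrable b) (hδ : 0 < δ)
    (h0 : ∀ w ∈ ball z δ, b w = 0) :
    ∃ c, HasDerivAt (fun z => ∫ w, (z - w)⁻¹ * b w) c z := by
  have far : ∀ w, b w ≠ 0 → ∀ x ∈ ball z (δ/2), δ / 2 ≤ ‖x - w‖ := by
    intro w hw x hx
    have h1 : δ ≤ dist w z := by
      by_contra h; exact hw (h0 w (not_le.1 h))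
    have h2 := dist_triangle w x z
    rw [dist_comm w x, dist_eq_norm x w] at h2
    have := mem_ball.1 hx
    linarith
  have meas : ∀ n : ℕ, ∀ x, MeasureTheory.AEStronglyMeasurable (fun w => ((x - w)⁻¹)^n * b w) :=
    fun n x => (by fun_prop : Measurable fun w : ℂ => ((x - w)⁻¹)^n).aestronglyMeasurable.mul hb.1
  have bd : ∀ n : ℕ, ∀ w, ∀ x ∈ ball z (δ/2), ‖((x - w)⁻¹)^n * b w‖ ≤ (2/δ)^n * ‖b w‖ := by
    intro n w x hx
    by_cases hw : b w = 0
    · simp [hw]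
    rw [norm_mul, norm_pow, norm_inv]
    gcongr
    rw [← inv_div]
    exact inv_anti₀ (by linarith) (far w hw x hx)
  have := hasDerivAt_integral_of_dominated_loc_of_deriv_le (μ := MeasureTheory.volume) (s := ball z (δ/2)) (F := fun z w => (z - w)⁻¹ * b w)
    (F' := fun z w => -(((z - w)⁻¹)^2 * b w)) (bound := fun w => (2/δ)^2 * ‖b w‖) (x₀ := z)
    (ball_mem_nhds _ (by linarith)) (Eventually.of_forall fun x => by simpa using meas 1 x)
    ((hb.norm.const_mul ((2/δ)^1)).mono' (by simpa using meas 1 z) (Eventually.of_forall fun w => by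
      simpa using bd 1 w z (mem_ball_self (by linarith)))) (meas 2 z).neg
    (Eventually.of_forall fun w x hx => by rw [norm_neg]; exact bd 2 w x hx) (hb.norm.const_mul _)
    (Eventually.of_forall fun w x hx => by
      by_cases hw : b w = 0
      · simp [hw, hasDerivAt_const]
      have hne : x - w ≠ 0 := fun e => by
        have := far w hw x hx
        rw [e, norm_zero] at this
        linarith
      have := (((hasDerivAt_id x).sub_const w).inv hne).mul_const (b w)
      exact HasDerivAt.cg this (fun t => rfl) (by simp; ring))
  exact ⟨_, this.2⟩

theorem ct_int {s : ℂ → ℂ} (hs : MeasureTheory.AEStronglyMeasurable s) (hM : ∀ w, ‖s w‖ ≤ M)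
    (h0 : ∀ w, ρ ≤ ‖w‖ → s w = 0) (hz : ‖z‖ < ρ) :
    MeasureTheory.Integrable (fun w => (z - w)⁻¹ * s w) ∧
      ‖∫ w, (z - w)⁻¹ * s w‖ ≤ ∫ w in ball (0:ℂ) (2*ρ), ‖w‖⁻¹ * M := by
  have i1 : MeasureTheory.IntegrableOn (fun w : ℂ => ‖w‖⁻¹ * M) (ball 0 (2*ρ)) := by
    have := ((inv_locint.integrableOn_isCompact (isCompact_closedBall 0 (2*ρ))).mono_set ball_subset_closedBall).norm.mul_const M
    simp only [norm_inv] at this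
    exact this
  have i2 := i1.integrable_indicator measurableSet_ball
  have bd : ∀ w, ‖w⁻¹ * s (z - w)‖ ≤ (ball (0:ℂ) (2*ρ)).indicator (fun w : ℂ => ‖w‖⁻¹ * M) w := by
    intro w
    by_cases hw : w ∈ ball (0:ℂ) (2*ρ)
    · rw [indicator_of_mem hw, norm_mul, norm_inv]
      exact mul_le_mul_of_nonneg_left (hM _) (by positivity)
    · rw [indicator_of_notMem hw, h0]
      · simp
      · simp at hw
        have := norm_sub_norm_le w z
        rw [norm_sub_rev] at this
        linarith
  have i3 : MeasureTheory.Integrable fun w => w⁻¹ * s (z - w) := by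
    refine i2.mono' ?_ (Eventually.of_forall bd)
    exact measurable_inv.aestronglyMeasurable.mul (hs.comp_measurePreserving (MeasureTheory.Measure.measurePreserving_sub_left _ z))
  have e : ∀ w, (z - (z - w))⁻¹ * s (z - w) = w⁻¹ * s (z - w) := fun w => by simp
  constructor
  · rw [← MeasureTheory.integrable_comp_sub_left _ z]
    simpa only [e] using i3
  · rw [← MeasureTheory.integral_sub_left_eq_self (fun w => (z - w)⁻¹ * s w) _ z]
    simp only [e]
    rw [← MeasureTheory.integral_indicator measurableSet_ball]
    exact MeasureTheory.norm_integral_le_of_norm_le i2 (Eventually.of_forall bd)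

theorem ct_exists {s : ℂ → ℂ}
    (hs : ∀ z, z ≠ 0 → ‖z‖ < ρ → ContDiffAt ℝ 1 s z) (hM : ∀ z, z ≠ 0 → ‖z‖ < ρ → ‖s z‖ ≤ M) (hM0 : 0 ≤ M) :
    ∃ (G : ℂ → ℂ) (K : ℝ), (∀ z, z ≠ 0 → ‖z‖ < ρ → ∃ g, HW G g (s z) z) ∧
      ∀ z, ‖z‖ < ρ → ‖G z‖ ≤ K := by
  have op : IsOpen (ball (0:ℂ) ρ \ {0}) := isOpen_ball.sdiff isClosed_singleton
  have mem : ∀ z, z ∈ ball (0:ℂ) ρ \ {0} ↔ z ≠ 0 ∧ ‖z‖ < ρ := by intro z; simp; tauto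
  set s0 : ℂ → ℂ := (ball (0:ℂ) ρ \ {0}).indicator s with hs0
  have m0 : MeasureTheory.AEStronglyMeasurable s0 := by
    rw [hs0, aestronglyMeasurable_indicator_iff op.measurableSet]
    exact ContinuousOn.aestronglyMeasurable (fun z hz => (hs z ((mem z).1 hz).1 ((mem z).1 hz).2).continuousAt.continuousWithinAt) op.measurableSet
  have b0 : ∀ w, ‖s0 w‖ ≤ M := fun w => by
    by_cases hw : w ∈ ball (0:ℂ) ρ \ {0}
    · rw [hs0, indicator_of_mem hw]; exact hM w ((mem w).1 hw).1 ((mem w).1 hw).2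
    · rw [hs0, indicator_of_notMem hw]; simpa
  have z0 : ∀ w, ρ ≤ ‖w‖ → s0 w = 0 := fun w hw =>
    indicator_of_notMem (fun h => absurd ((mem w).1 h).2 (not_lt.2 hw)) _
  have ii : ∀ t : ℂ → ℂ, MeasureTheory.AEStronglyMeasurable t → (∀ w, ‖t w‖ ≤ M) → (∀ w, ρ ≤ ‖w‖ → t w = 0) → MeasureTheory.Integrable t := by
    intro t h1 h2 h3
    have := (MeasureTheory.integrable_indicator_iff (μ := MeasureTheory.volume) (measurableSet_ball (x := (0:ℂ)) (ε := ρ))).2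
      (MeasureTheory.integrableOn_const (C := M) MeasureTheory.measure_ball_lt_top.ne (by simp))
    refine this.mono' h1 (Eventually.of_forall fun w => ?_)
    by_cases hw : w ∈ ball (0:ℂ) ρ
    · rw [indicator_of_mem hw]; exact h2 w
    · rw [indicator_of_notMem hw, h3 w (by simpa using hw)]; simp
  refine ⟨fun z => (Real.pi : ℂ)⁻¹ * ∫ w, (z - w)⁻¹ * s0 w, ‖(Real.pi : ℂ)⁻¹‖ * ∫ w in ball (0:ℂ) (2*ρ), ‖w‖⁻¹ * M, ?_, ?_⟩
  · intro z hz hzρ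
    obtain ⟨R, R0, hR⟩ := Metric.isOpen_iff.1 op z ((mem z).2 ⟨hz, hzρ⟩)
    let χ : ContDiffBump z := ⟨R/4, R/2, by linarith, by linarith⟩
    let a : ℂ → ℂ := fun w => (χ w : ℂ) * s0 w
    let b : ℂ → ℂ := fun w => (1 - (χ w : ℂ)) * s0 w
    have χc : Continuous χ := χ.continuous
    have ac : HasCompactSupport a := by
      refine (χ.hasCompactSupport).mono fun w hw => ?_
      intro h
      exact hw (by simp [a, h])
    have ad : ContDiff ℝ 1 a := by
      rw [contDiff_iff_contDiffAt]
      intro w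
      by_cases hw : w ∈ ball (0:ℂ) ρ \ {0}
      · have e : s0 =ᶠ[𝓝 w] s := by
          filter_upwards [op.mem_nhds hw] with x hx
          exact indicator_of_mem hx _
        have h1 := (hs w ((mem w).1 hw).1 ((mem w).1 hw).2).congr_of_eventuallyEq e
        exact (Complex.ofRealCLM.contDiff.contDiffAt.comp w χ.contDiffAt).mul h1
      · have : w ∉ closedBall z (R/2) := fun h => hw (hR (closedBall_subset_ball (by linarith) h))
        refine contDiffAt_const (c := (0:ℂ)) |>.congr_of_eventuallyEq ?_
        filter_upwards [isClosed_closedBall.isOpen_compl.mem_nhds this] with x hx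
        have : χ x = 0 := χ.zero_of_le_dist (le_of_lt (by simpa using hx))
        simp [a, this]
    have χ1 : ∀ w, ‖(χ w : ℂ)‖ ≤ 1 ∧ ‖1 - (χ w : ℂ)‖ ≤ 1 := fun w => by
      have h1 := χ.nonneg (x := w)
      have h2 := χ.le_one (x := w)
      constructor
      · rw [Complex.norm_real, Real.norm_of_nonneg h1]; exact h2
      · rw [← Complex.ofReal_one, ← Complex.ofReal_sub, Complex.norm_real, Real.norm_of_nonneg (by linarith)]; linarith
    have am : MeasureTheory.AEStronglyMeasurable a :=
      (Complex.continuous_ofReal.comp χc).aestronglyMeasurable.mul m0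
    have bm : MeasureTheory.AEStronglyMeasurable b :=
      (continuous_const.sub (Complex.continuous_ofReal.comp χc)).aestronglyMeasurable.mul m0
    have ab : ∀ w, ‖a w‖ ≤ M := fun w => by
      rw [norm_mul]; nlinarith [(χ1 w).1, b0 w, norm_nonneg (s0 w), norm_nonneg (χ w : ℂ)]
    have bb : ∀ w, ‖b w‖ ≤ M := fun w => by
      rw [norm_mul]; nlinarith [(χ1 w).2, b0 w, norm_nonneg (s0 w), norm_nonneg (1 - (χ w : ℂ))]
    have az : ∀ w, ρ ≤ ‖w‖ → a w = 0 := fun w hw => by simp [a, z0 w hw]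
    have bz : ∀ w, ρ ≤ ‖w‖ → b w = 0 := fun w hw => by simp [b, z0 w hw]
    obtain ⟨g1, H1⟩ := ct_smooth ad ac z
    obtain ⟨c, H2⟩ := ct_far (ii b bm bb bz) (z := z) (δ := R/4) (by linarith) fun w hw => by
      simp [b, χ.one_of_mem_closedBall (ball_subset_closedBall hw)]
    have H := (H1.add (HW.of_deriv H2)).cmul (Real.pi : ℂ)⁻¹
    refine ⟨_, HW.cg (H.congr (f := fun z => (Real.pi : ℂ)⁻¹ * ∫ w, (z - w)⁻¹ * s0 w) ?_) (fun _ => rfl) rfl ?_⟩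
    · filter_upwards [isOpen_ball.mem_nhds (show z ∈ ball (0:ℂ) ρ by simpa using hzρ)] with x hx
      have hx' : ‖x‖ < ρ := by simpa using hx
      rw [← MeasureTheory.integral_add (ct_int am ab az hx').1 (ct_int bm bb bz hx').1]
      congr 2; ext w
      simp only [a, b]; ring
    · have : a z = s z := by
        simp only [a]
        rw [χ.one_of_mem_closedBall (mem_closedBall_self (by simp [χ]; linarith)), hs0, indicator_of_mem ((mem z).2 ⟨hz, hzρ⟩)]
        simp
      have pp : (Real.pi : ℂ) ≠ 0 := by exact_mod_cast Real.pi_ne_zero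
      rw [this]; field_simp; ring
  · intro z hz
    rw [norm_mul]
    exact mul_le_mul_of_nonneg_left (ct_int m0 b0 z0 hz).2 (norm_nonneg _)

theorem hw_mvt {a b : ℂ → ℂ} (h : ∀ z ∈ ball z1 r, HW f (a z) (b z) z)
    (hL : ∀ z ∈ ball z1 r, ‖a z‖ + ‖b z‖ ≤ L) (hz : z ∈ ball z1 r) : ‖f z - f z1‖ ≤ L * r := by
  have L0 : 0 ≤ L := le_trans (by positivity) (hL z hz)
  have r0 : 0 < r := lt_of_le_of_lt dist_nonneg (mem_ball.1 hz)
  have := (convex_ball z1 r).norm_image_sub_le_of_norm_hasFDerivWithin_le (𝕜 := ℝ) (f := f)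
    (f' := fun z => LL (a z) (b z)) (C := L) (fun z hz => HasFDerivAt.hasFDerivWithinAt (h z hz))
    (fun z hz => ContinuousLinearMap.opNorm_le_bound _ L0 fun v => by
      rw [LL_apply]
      refine (norm_add_le _ _).trans ?_
      rw [norm_mul, norm_mul, RCLike.norm_conj, ← add_mul]
      exact mul_le_mul_of_nonneg_right (hL z hz) (norm_nonneg _)) (mem_ball_self r0) hz
  refine this.trans (mul_le_mul_of_nonneg_left ?_ L0)
  rw [← dist_eq_norm]; exact (mem_ball.1 hz).le

theorem cauchy_half (hr : 0 < r) (h : ∀ z ∈ ball z1 r, HasDerivAt F (F' z) z)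
    (hM : ∀ z ∈ ball z1 r, ‖F z‖ ≤ M) : ‖F' z1‖ ≤ M / (r / 2) := by
  have hs : closedBall z1 (r/2) ⊆ ball z1 r := closedBall_subset_ball (by linarith)
  have := Complex.norm_deriv_le_of_forall_mem_sphere_norm_le (F := ℂ) (f := F) (c := z1) (R := r/2) (C := M) (by linarith)
    (DifferentiableOn.diffContOnCl_ball (U := ball z1 r) (fun z hz => (h z hz).differentiableAt.differentiableWithinAt) hs)
    (fun z hz => hM z (hs (sphere_subset_closedBall hz)))
  rwa [(h z1 (mem_ball_self hr)).deriv] at this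

theorem rem_bdd (hρ : 0 < ρ) (hf : ∀ z, z ≠ 0 → ‖z‖ < ρ → DifferentiableAt ℂ f z)
    (hM : ∀ z, z ≠ 0 → ‖z‖ < ρ → ‖f z‖ ≤ M) :
    ∃ φ : ℂ → ℂ, AnalyticAt ℂ φ 0 ∧ ∀ z, z ≠ 0 → φ z = f z := by
  have hb : ball (0:ℂ) ρ ∈ 𝓝 0 := ball_mem_nhds _ hρ
  have := Complex.differentiableOn_update_limUnder_of_bddAbove hb (f := f)
    (fun z hz => (hf z hz.2 (by simpa using hz.1)).differentiableWithinAt)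
    ⟨M, by rintro _ ⟨z, hz, rfl⟩; exact hM z hz.2 (by simpa using hz.1)⟩
  exact ⟨_, this.analyticAt hb, fun z hz => Function.update_of_ne hz _ _⟩

theorem hw_log (hz : z ≠ 0) : HW (fun w => ((4 * Real.log ‖w‖ : ℝ) : ℂ)) (2 / z) (starRingEnd ℂ (2 / z)) z := by
  have h1 := (hw_id z).mul (hw_id z).conj
  have e : ∀ w : ℂ, w * starRingEnd ℂ w = ((‖w‖ ^ 2 : ℝ) : ℂ) := fun w => by
    rw [Complex.mul_conj, Complex.normSq_eq_norm_sq]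
  have hp : 0 < ‖z‖ ^ 2 := by positivity
  have h2 : HasDerivAt Complex.log (z * starRingEnd ℂ z)⁻¹ (z * starRingEnd ℂ z) :=
    Complex.hasDerivAt_log (by rw [e]; exact Complex.ofReal_mem_slitPlane.2 hp)
  have h3 := (HW.comp_left (g := fun w => w * starRingEnd ℂ w) h2 h1).cmul 2
  have hc : starRingEnd ℂ z ≠ 0 := by simpa using hz
  refine h3.cg (fun w => ?_) ?_ ?_
  · rw [e, ← Complex.ofReal_log (by positivity), Real.log_pow]; push_cast; ring
  · simp; field_simp
  · simp; field_simp; exact Complex.conj_ofNat 2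

theorem near_norm (hw : w ∈ ball z (‖z‖ / 2)) : ‖z‖ / 2 < ‖w‖ ∧ ‖w‖ < 3 / 2 * ‖z‖ := by
  have h := mem_ball.1 hw
  rw [dist_eq_norm] at h
  have h1 := norm_sub_norm_le w z
  have h2 := norm_sub_norm_le z w
  rw [norm_sub_rev] at h2
  constructor <;> linarith

set_option maxHeartbeats 1000000 in
theorem loc_c {p : ℂ → ℂ} (hρ : 0 < ρ)
    (hv : ∀ z, z ≠ 0 → ‖z‖ < ρ → |v z| ≤ C)
    (hL : ∀ z, z ≠ 0 → ‖z‖ < ρ → ‖p z + B z‖ ≤ L)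
    (h : ∀ z, z ≠ 0 → ‖z‖ < ρ → HW (fun w => (v w : ℂ)) (c / z + p z + B z) (starRingEnd ℂ (c / z + p z + B z)) z) :
    c = 0 := by
  have key : ∀ l : ℂ, l.re = -1 → (c * l).re = 0 := by
    intro l hl
    by_contra hne
    set m := |2 * (c * l).re| with hm
    have m0 : 0 < m := by rw [hm]; positivity
    have L0 : 0 ≤ L := le_trans (norm_nonneg _) (hL (ρ/2 : ℝ) (by exact_mod_cast (by positivity : ρ/2 ≠ 0)) (by
      rw [Complex.norm_real, Real.norm_of_nonneg (by positivity)]; linarith))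
    obtain ⟨e, e0, e1, e2⟩ : ∃ e : ℝ, 0 < e ∧ e < ρ ∧ 2 * L * ‖l‖ * e ≤ m / 2 := by
      refine ⟨min (ρ/2) (m / (4 * (L * ‖l‖ + 1))), by positivity, (min_le_left _ _).trans_lt (by linarith), ?_⟩
      have : min (ρ/2) (m / (4 * (L * ‖l‖ + 1))) ≤ m / (4 * (L * ‖l‖ + 1)) := min_le_right _ _
      calc 2 * L * ‖l‖ * min (ρ/2) (m / (4 * (L * ‖l‖ + 1))) ≤ 2 * L * ‖l‖ * (m / (4 * (L * ‖l‖ + 1))) := by gcongr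
        _ ≤ m / 2 := by
          rw [mul_div_assoc', div_le_div_iff₀ (by positivity) (by positivity)]
          nlinarith [mul_nonneg L0 (norm_nonneg l)]
    let γ : ℝ → ℂ := fun t => e * Complex.exp (l * t)
    have γn : ∀ t, ‖γ t‖ = e * Real.exp (-t) := fun t => by
      simp [γ, Complex.norm_exp, hl, abs_of_pos e0]
    have γ0 : ∀ t, γ t ≠ 0 := fun t => by
      rw [← norm_pos_iff, γn]; positivity
    have γl : ∀ t, 0 ≤ t → ‖γ t‖ ≤ e := fun t ht => by
      rw [γn]
      have : Real.exp (-t) ≤ 1 := Real.exp_le_one_iff.2 (by linarith)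
      nlinarith
    have γd : ∀ t, HasDerivAt γ (l * γ t) t := fun t => by
      have h2 : HasDerivAt (fun t : ℝ => l * (t : ℂ)) l t := by
        simpa using (Complex.ofRealCLM.hasDerivAt (x := t)).const_mul l
      exact (h2.cexp.const_mul (e : ℂ)).congr_deriv (by simp only [γ]; ring)
    let D : ℝ → ℝ := fun t => v (γ t) - 2 * (c * l).re * t
    have Dd : ∀ t, 0 ≤ t → HasDerivAt D (2 * ((p (γ t) + B (γ t)) * (l * γ t)).re) t := by
      intro t ht
      have h1 := (h (γ t) (γ0 t) ((γl t ht).trans_lt e1)).real_fderiv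
      have h2 := (h1.comp_hasDerivAt t (γd t)).sub ((hasDerivAt_id t).const_mul (2 * (c * l).re))
      refine h2.congr_deriv ?_
      have : (c / γ t + p (γ t) + B (γ t)) * (l * γ t) = c * l + (p (γ t) + B (γ t)) * (l * γ t) := by
        have := γ0 t
        field_simp
        ring
      rw [ContinuousLinearMap.comp_apply, LL_apply, ← map_mul, this]
      simp
      ring
    have Db : ∀ T, 0 ≤ T → ‖D T - D 0‖ ≤ (m/2) * ‖T - 0‖ := by
      intro T hT
      refine (convex_Icc (0:ℝ) T).norm_image_sub_le_of_norm_hasDerivWithin_le (fun t ht => (Dd t ht.1).hasDerivWithinAt)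
        (fun t ht => ?_) ⟨le_rfl, hT⟩ ⟨hT, le_rfl⟩
      have h1 := Complex.abs_re_le_norm ((p (γ t) + B (γ t)) * (l * γ t))
      have h2 : ‖(p (γ t) + B (γ t)) * (l * γ t)‖ ≤ L * (‖l‖ * e) := by
        rw [norm_mul, norm_mul]
        have := hL (γ t) (γ0 t) ((γl t ht.1).trans_lt e1)
        have := γl t ht.1
        gcongr
      rw [Real.norm_eq_abs, abs_mul, abs_two]
      linarith
    have C0 : 0 ≤ C := le_trans (abs_nonneg _) (hv (γ 0) (γ0 0) ((γl 0 le_rfl).trans_lt e1))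
    set T := (4 * C + 2) / m with hT
    have T0 : 0 ≤ T := by positivity
    have h1 := Db T T0
    have h2 := abs_le.1 (hv (γ T) (γ0 T) ((γl T T0).trans_lt e1))
    have h3 := abs_le.1 (hv (γ 0) (γ0 0) ((γl 0 le_rfl).trans_lt e1))
    rw [sub_zero, Real.norm_eq_abs, Real.norm_of_nonneg T0] at h1
    have e3 : m * T = 4 * C + 2 := by rw [hT]; field_simp
    have e4 : |2 * (c * l).re * T| = m * T := by rw [abs_mul, abs_of_nonneg T0]
    have h4 : |2 * (c * l).re * T| ≤ |D T - D 0| + |v (γ T) - v (γ 0)| := by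
      rw [show 2 * (c * l).re * T = -(D T - D 0) + (v (γ T) - v (γ 0)) by simp [D]]
      refine (abs_add_le _ _).trans ?_
      rw [abs_neg]
    have h5 : |v (γ T) - v (γ 0)| ≤ 2 * C := abs_le.2 ⟨by linarith, by linarith⟩
    linarith
  have k1 := key (-1) (by simp)
  have k2 := key (-1 + Complex.I) (by simp)
  simp at k1 k2
  refine Complex.ext ?_ ?_ <;> simp <;> linarith


set_option maxHeartbeats 2000000 in
theorem loc_form (hρ : 0 < ρ) (hρ1 : ρ ≤ 1)
    (h : CS (ball 0 ρ \ {0}) u U q) (hsm : ∀ z, z ≠ 0 → ‖z‖ < ρ → ContDiffAt ℝ 1 u z)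
    (hC : ∀ z, z ≠ 0 → ‖z‖ < ρ → |u z - 4 * Real.log ‖z‖| ≤ C) :
    ∃ p d : ℂ → ℂ, AnalyticAt ℂ p 0 ∧ AnalyticAt ℂ d 0 ∧ d 0 = 0 ∧ deriv d 0 = 0 ∧
      ∀ᶠ t in 𝓝[≠] 0, q t = 2 / t ^ 2 + p t / t - 1 / 2 * deriv p t + 1 / 4 * p t ^ 2 + d t := by
  have mem : ∀ z, z ≠ 0 → ‖z‖ < ρ → z ∈ ball (0:ℂ) ρ \ {0} := fun z h1 h2 => ⟨by simpa using h2, h1⟩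
  have C0 : 0 ≤ C := le_trans (abs_nonneg _) (hC (ρ/2 : ℝ) (by exact_mod_cast (by positivity : ρ/2 ≠ 0)) (by
      rw [Complex.norm_real, Real.norm_of_nonneg (by positivity)]; linarith))
  have eb : ∀ z, z ≠ 0 → ‖z‖ < ρ → Real.exp (u z) ≤ Real.exp C * ‖z‖ ^ 4 := by
    intro z h1 h2
    have h3 := (abs_le.1 (hC z h1 h2)).2
    have n0 : 0 < ‖z‖ := norm_pos_iff.2 h1
    calc Real.exp (u z) ≤ Real.exp (C + 4 * Real.log ‖z‖) := Real.exp_le_exp.2 (by linarith)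
      _ = Real.exp C * ‖z‖ ^ 4 := by
        rw [Real.exp_add, show 4 * Real.log ‖z‖ = Real.log (‖z‖^4) by rw [Real.log_pow]; norm_num, Real.exp_log (by positivity)]
  have E0 := Real.exp_pos C
  have sb : ∀ z, z ≠ 0 → ‖z‖ < ρ → ‖-((Real.exp (u z) : ℝ) : ℂ) / 4‖ ≤ Real.exp C * ‖z‖ ^ 4 := by
    intro z h1 h2
    rw [norm_div, norm_neg, Complex.norm_real, Real.norm_of_nonneg (Real.exp_pos _).le]
    have := eb z h1 h2
    have := Real.exp_pos (u z)
    simp; linarith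
  obtain ⟨G, K, hG, hK⟩ := ct_exists (s := fun z => (-((Real.exp (u z) : ℝ) : ℂ) / 4) / z ^ 3) (ρ := ρ) (M := Real.exp C)
    (by
      intro z h1 h2
      have h3 : ContDiffAt ℝ 1 (fun w => ((Real.exp (u w) : ℝ) : ℂ)) z :=
        Complex.ofRealCLM.contDiff.contDiffAt.comp z (Real.contDiff_exp.contDiffAt.comp z (hsm z h1 h2))
      have h4 : ContDiffAt ℝ 1 (fun w : ℂ => w ^ 3) z := contDiffAt_id.pow 3
      have h5 : ContDiffAt ℝ 1 (fun w : ℂ => (w ^ 3)⁻¹) z := h4.inv (pow_ne_zero 3 h1)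
      simp only [div_eq_mul_inv]
      exact (h3.neg.mul contDiffAt_const).mul h5)
    (by
      intro z h1 h2
      have n0 : 0 < ‖z‖ := norm_pos_iff.2 h1
      rw [norm_div, norm_pow, div_le_iff₀ (by positivity)]
      refine (sb z h1 h2).trans (mul_le_mul_of_nonneg_left ?_ E0.le)
      exact pow_le_pow_of_le_one n0.le (by linarith) (by norm_num)) E0.le
  have K0 : 0 ≤ K := (norm_nonneg _).trans (hK 0 (by simpa using hρ))
  obtain ⟨B, hBdef⟩ : ∃ B : ℂ → ℂ, ∀ z, B z = z ^ 3 * G z := ⟨_, fun _ => rfl⟩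
  have Bb : ∀ z, ‖z‖ < ρ → ‖B z‖ ≤ K * ‖z‖ ^ 3 := fun z hz => by
    rw [hBdef, norm_mul, norm_pow, mul_comm]; exact mul_le_mul_of_nonneg_right (hK z hz) (by positivity)
  have Bw : ∀ z, z ≠ 0 → ‖z‖ < ρ → ∃ g, HW B g (-((Real.exp (u z) : ℝ) : ℂ) / 4) z := by
    intro z h1 h2
    obtain ⟨g, hg⟩ := hG z h1 h2
    exact ⟨_, ((HW.of_deriv (hasDerivAt_pow 3 z)).mul hg).cg (fun w => hBdef w) rfl (by field_simp; ring)⟩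
  obtain ⟨P, hP⟩ : ∃ P : ℂ → ℂ, ∀ z, P z = U z - B z := ⟨_, fun _ => rfl⟩
  have Pd : ∀ z, z ≠ 0 → ‖z‖ < ρ → DifferentiableAt ℂ P z := by
    intro z h1 h2
    obtain ⟨g, hg⟩ := Bw z h1 h2
    have := ((h.dU z (mem z h1 h2)).sub hg).cg (f := P) hP rfl (b' := 0) (by ring)
    exact this.hasDerivAt.differentiableAt
  have BW : ∀ z, z ≠ 0 → ‖z‖ < ρ → HW B (U z ^ 2 / 2 - 2 * q z - deriv P z) (-((Real.exp (u z) : ℝ) : ℂ) / 4) z := by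
    intro z h1 h2
    exact ((h.dU z (mem z h1 h2)).sub (HW.of_deriv (Pd z h1 h2).hasDerivAt)).cg (fun w => by rw [hP]; ring) rfl (by ring)
  obtain ⟨v, hv⟩ : ∃ v : ℂ → ℝ, ∀ z, v z = u z - 4 * Real.log ‖z‖ := ⟨_, fun _ => rfl⟩
  have vw : ∀ z, z ≠ 0 → ‖z‖ < ρ → HW (fun w => (v w : ℂ)) (U z - 2 / z) (starRingEnd ℂ (U z - 2 / z)) z := by
    intro z h1 h2
    exact ((h.du z (mem z h1 h2)).sub (hw_log h1)).cg (fun w => by rw [hv]; push_cast; ring) rfl (by simp)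
  have nb : ∀ z : ℂ, z ≠ 0 → ‖z‖ < ρ / 2 → ∀ w ∈ ball z (‖z‖/2), w ≠ 0 ∧ ‖w‖ < ρ ∧ ‖w‖ ≤ 2 * ‖z‖ := by
    intro z h1 h2 w hw
    have := near_norm hw
    have n0 : 0 < ‖z‖ := norm_pos_iff.2 h1
    exact ⟨norm_pos_iff.1 (by linarith), by linarith, by linarith⟩
  have P1d : ∀ z, z ≠ 0 → ‖z‖ < ρ → DifferentiableAt ℂ (fun w => P w - 2 / w) z := fun z h1 h2 =>
    (Pd z h1 h2).sub ((differentiableAt_const _).div differentiableAt_id h1)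
  have P1b : ∀ z, z ≠ 0 → ‖z‖ < ρ / 2 → ‖P z - 2 / z‖ ≤ 4 * Real.exp (C + K) / ‖z‖ := by
    intro z h1 h2
    have n0 : 0 < ‖z‖ := norm_pos_iff.2 h1
    obtain ⟨F, F0, hF⟩ := (DifferentiableOn.isExactOn_ball (f := fun w => P w - 2 / w) (c := z) (r := ‖z‖/2)
      (fun w hw => (P1d w (nb z h1 h2 w hw).1 (nb z h1 h2 w hw).2.1).differentiableWithinAt)).with_val_at z 0
    have hW : ∀ w ∈ ball z (‖z‖/2), HW (fun w => (v w : ℂ) - F w - starRingEnd ℂ (F w)) (B w) (starRingEnd ℂ (B w)) w := by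
      intro w hw
      obtain ⟨a1, a2, a3⟩ := nb z h1 h2 w hw
      have := HW.of_deriv (hF w hw)
      exact (((vw w a1 a2).sub this).sub this.conj).cg (fun _ => rfl) (by rw [hP]; simp) (by rw [hP]; simp)
    have bF : ∀ w ∈ ball z (‖z‖/2), ‖Complex.exp (F w)‖ ≤ Real.exp (C + K) := by
      intro w hw
      obtain ⟨a1, a2, a3⟩ := nb z h1 h2 w hw
      have h3 := hw_mvt (L := 2 * K) hW (fun x hx => by
        obtain ⟨a1, a2, a3⟩ := nb z h1 h2 x hx
        rw [RCLike.norm_conj]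
        have h4 := Bb x a2
        have h5 : ‖x‖ ^ 3 ≤ 1 := pow_le_one₀ (norm_nonneg _) (by linarith)
        nlinarith) hw
      have e : ((v w : ℂ) - F w - starRingEnd ℂ (F w)) - ((v z : ℂ) - F z - starRingEnd ℂ (F z)) = ((v w - v z - 2 * (F w).re : ℝ) : ℂ) := by
        rw [F0]
        have := Complex.add_conj (F w)
        push_cast
        push_cast at this
        linear_combination - this + (map_zero (starRingEnd ℂ))
      rw [e, Complex.norm_real, Real.norm_eq_abs] at h3
      have h5 := (abs_le.1 h3).1
      have h6 := abs_le.1 (hC w a1 a2)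
      have h7 := abs_le.1 (hC z h1 (by linarith))
      rw [← hv] at h6 h7
      rw [Complex.norm_exp, Real.exp_le_exp]
      nlinarith
    have := cauchy_half (F := fun w => Complex.exp (F w)) (by positivity) (fun w hw => (hF w hw).cexp) bF
    simp only [F0, Complex.exp_zero, one_mul] at this
    refine this.trans (le_of_eq ?_)
    field_simp; ring
  obtain ⟨g, ga, ge⟩ := rem_bdd (f := fun z => z * (P z - 2 / z)) (ρ := ρ / 2) (M := 4 * Real.exp (C + K)) (by linarith)
    (fun z h1 h2 => differentiableAt_id.mul (P1d z h1 (by linarith))) (fun z h1 h2 => by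
      have n0 : 0 < ‖z‖ := norm_pos_iff.2 h1
      rw [norm_mul]
      have := mul_le_mul_of_nonneg_left (P1b z h1 h2) n0.le
      refine this.trans (le_of_eq ?_)
      field_simp)
  obtain ⟨p, pa, -, pe⟩ := rem_div (g := fun z => g z - g 0) (ga.sub analyticAt_const) (by simp)
  have P1e : ∀ z, z ≠ 0 → P z = 2 / z + g 0 / z + p z := by
    intro z h1
    have e1 := ge z h1
    have e2 := pe z
    rw [e1, sub_zero] at e2
    have : z * (P z - (2 / z + g 0 / z + p z)) = 0 := by
      field_simp
      field_simp at e2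
      linear_combination e2
    have := (mul_eq_zero.1 this).resolve_left h1
    linear_combination this
  -- bounded p
  obtain ⟨ρ', r0, r1, Lp, hLp⟩ : ∃ ρ' > 0, ρ' ≤ ρ / 2 ∧ ∃ L, ∀ z, ‖z‖ < ρ' → ‖p z‖ ≤ L := by
    have := pa.continuousAt.norm.eventually (gt_mem_nhds (show ‖p 0‖ < ‖p 0‖ + 1 by linarith))
    obtain ⟨e, e0, he⟩ := Metric.eventually_nhds_iff.1 this
    exact ⟨min e (ρ/2), by positivity, min_le_right _ _, ‖p 0‖ + 1, fun z hz => (he (by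
      rw [dist_zero_right]; exact hz.trans_le (min_le_left _ _))).le⟩
  have L0 : 0 ≤ Lp := (norm_nonneg _).trans (hLp 0 (by simpa using r0))
  have c0 : g 0 = 0 := by
    refine loc_c (v := v) (p := p) (B := B) (ρ := ρ') (C := C) (L := Lp + K) r0 (fun z h1 h2 => by rw [hv]; exact hC z h1 (by linarith))
      (fun z h1 h2 => ?_) (fun z h1 h2 => ?_)
    · refine (norm_add_le _ _).trans (add_le_add (hLp z h2) ?_)
      have h4 := Bb z (by linarith)
      have h5 : ‖z‖ ^ 3 ≤ 1 := pow_le_one₀ (norm_nonneg _) (by linarith)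
      nlinarith
    · have e : U z - 2 / z = g 0 / z + p z + B z := by
        have e1 := P1e z h1
        rw [hP] at e1
        linear_combination e1
      rw [← e]
      exact vw z h1 (by linarith)
  have Pe : ∀ z, z ≠ 0 → P z = 2 / z + p z := fun z hz => by rw [P1e z hz, c0]; ring
  obtain ⟨d, hd⟩ : ∃ d : ℂ → ℂ, ∀ z, d z = q z + 1 / 2 * deriv P z - 1 / 4 * P z ^ 2 := ⟨_, fun _ => rfl⟩
  have dd : ∀ z, z ≠ 0 → ‖z‖ < ρ → DifferentiableAt ℂ d z := by
    intro z h1 h2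
    have hP' : DifferentiableAt ℂ (deriv P) z := by
      have : DifferentiableOn ℂ P (ball 0 ρ \ {0}) := fun w hw =>
        (Pd w hw.2 (by simpa using hw.1)).differentiableWithinAt
      exact (this.deriv h.op).differentiableAt (h.op.mem_nhds (mem z h1 h2))
    rw [show d = _ from funext hd]
    exact ((h.dq z (mem z h1 h2)).add (hP'.const_mul _)).sub (((Pd z h1 h2).pow 2).const_mul _)
  obtain ⟨D, Da, De⟩ := rem_bdd (f := fun z => d z / z ^ 2) (ρ := ρ' / 2)
    (M := 4 * (((2 + Lp) * 4 * K + 8 * K ^ 2 + 16 * Real.exp C) + 9 * K)) (by linarith)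
    (fun z h1 h2 => (dd z h1 (by linarith)).div (differentiableAt_id.pow 2) (pow_ne_zero 2 h1)) (fun z h1 h2 => by
      have n0 : 0 < ‖z‖ := norm_pos_iff.2 h1
      have nb' := nb z h1 (by linarith)
      obtain ⟨F, F0, hF⟩ := (DifferentiableOn.isExactOn_ball (f := d) (c := z) (r := ‖z‖/2)
        (fun w hw => (dd w (nb' w hw).1 (nb' w hw).2.1).differentiableWithinAt)).with_val_at z 0
      have hW : ∀ w ∈ ball z (‖z‖/2), HW (fun w => B w + 2 * F w) (P w * B w + 1 / 2 * B w ^ 2) (-((Real.exp (u w) : ℝ) : ℂ) / 4) w := by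
        intro w hw
        obtain ⟨a1, a2, a3⟩ := nb' w hw
        refine ((BW w a1 a2).add ((HW.of_deriv (hF w hw)).cmul 2)).cg (fun _ => rfl) ?_ (by ring)
        have : U w = P w + B w := by rw [hP]; ring
        rw [hd, this]; ring
      have bF : ∀ w ∈ ball z (‖z‖/2), ‖F w‖ ≤ (((2 + Lp) * 4 * K + 8 * K ^ 2 + 16 * Real.exp C) + 9 * K) * ‖z‖ ^ 3 := by
        intro w hw
        obtain ⟨a1, a2, a3⟩ := nb' w hw
        have h3 := hw_mvt (L := ((2 + Lp) * 4 * K + 8 * K ^ 2 + 16 * Real.exp C) * ‖z‖ ^ 2) hW (fun x hx => by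
          obtain ⟨a1, a2, a3⟩ := nb' x hx
          have x0 : 0 < ‖x‖ := norm_pos_iff.2 a1
          have x1 : ‖x‖ ≤ 1 := by linarith
          have b1 := Bb x a2
          have b2 := sb x a1 a2
          have b3 : ‖P x‖ ≤ (2 + Lp) / ‖x‖ := by
            rw [Pe x a1, add_div]
            refine (norm_add_le _ _).trans (add_le_add (by simp) ?_)
            rw [le_div_iff₀ x0]
            have := hLp x (by linarith [near_norm hx])
            nlinarith [norm_nonneg (p x)]
          have x2 : ‖x‖ ^ 2 ≤ 4 * ‖z‖ ^ 2 := by nlinarith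
          have x6 : ‖x‖ ^ 6 ≤ ‖x‖ ^ 2 := pow_le_pow_of_le_one x0.le x1 (by norm_num)
          have x4 : ‖x‖ ^ 4 ≤ ‖x‖ ^ 2 := pow_le_pow_of_le_one x0.le x1 (by norm_num)
          have c1 : ‖P x * B x‖ ≤ (2 + Lp) * K * ‖x‖ ^ 2 := by
            rw [norm_mul]
            calc ‖P x‖ * ‖B x‖ ≤ ((2 + Lp) / ‖x‖) * (K * ‖x‖ ^ 3) := by gcongr
              _ = _ := by field_simp
          have c2 : ‖1 / 2 * B x ^ 2‖ ≤ K ^ 2 * ‖x‖ ^ 2 := by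
            rw [norm_mul, norm_pow]
            calc ‖(1 / 2 : ℂ)‖ * ‖B x‖ ^ 2 ≤ 1 * (K * ‖x‖ ^ 3) ^ 2 := by
                  gcongr
                  rw [norm_div]; norm_num
              _ = K ^ 2 * ‖x‖ ^ 6 := by ring
              _ ≤ _ := by gcongr
          have c3 : Real.exp C * ‖x‖ ^ 4 ≤ Real.exp C * ‖x‖ ^ 2 := by gcongr
          have c4 := norm_add_le (P x * B x) (1 / 2 * B x ^ 2)
          have c5 : ((2 + Lp) * K + K ^ 2 + Real.exp C) * ‖x‖ ^ 2 ≤ ((2 + Lp) * K + K ^ 2 + Real.exp C) * (4 * ‖z‖ ^ 2) := by gcongr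
          have c6 : 0 ≤ (4 * K ^ 2 + 12 * Real.exp C) * ‖z‖ ^ 2 := by positivity
          linarith) hw
        have b1 := Bb w a2
        have b2 := Bb z (by linarith)
        have w3 : ‖w‖ ^ 3 ≤ (2 * ‖z‖) ^ 3 := by gcongr
        have e : 2 * F w = (B w + 2 * F w - (B z + 2 * F z)) + (B z - B w) := by rw [F0]; ring
        have n2 : 2 * ‖F w‖ = ‖2 * F w‖ := by simp
        rw [e] at n2
        have n3 := norm_add_le (B w + 2 * F w - (B z + 2 * F z)) (B z - B w)
        have n4 := norm_sub_le (B z) (B w)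
        have n5 : K * ‖w‖ ^ 3 ≤ K * (2 * ‖z‖) ^ 3 := by gcongr
        have n6 : 0 ≤ ((2 + Lp) * 4 * K + 8 * K ^ 2 + 16 * Real.exp C) * ‖z‖ ^ 3 := by positivity
        have n7 : 0 ≤ K * ‖z‖ ^ 3 := by positivity
        have e7 : K * (2 * ‖z‖) ^ 3 = 8 * (K * ‖z‖ ^ 3) := by ring
        have e8 : ((2 + Lp) * 4 * K + 8 * K ^ 2 + 16 * Real.exp C) * ‖z‖ ^ 2 * (‖z‖ / 2) = 1 / 2 * (((2 + Lp) * 4 * K + 8 * K ^ 2 + 16 * Real.exp C) * ‖z‖ ^ 3) := by ring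
        rw [e8] at h3
        rw [add_mul _ (9 * K), mul_assoc 9]
        generalize ((2 + Lp) * 4 * K + 8 * K ^ 2 + 16 * Real.exp C) * ‖z‖ ^ 3 = X at *
        linarith
      have := cauchy_half (by positivity) hF bF
      rw [norm_div, norm_pow, div_le_iff₀ (by positivity)]
      refine this.trans (le_of_eq ?_)
      field_simp; ring)
  refine ⟨p, fun z => z ^ 2 * D z, pa, (analyticAt_id.pow 2).mul Da, by simp, ?_, ?_⟩
  · have := ((hasDerivAt_pow 2 (0:ℂ)).fun_mul Da.differentiableAt.hasDerivAt).deriv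
    simpa using this
  · have ev : ∀ᶠ t in 𝓝[≠] (0:ℂ), AnalyticAt ℂ p t := pa.eventually_analyticAt.filter_mono nhdsWithin_le_nhds
    filter_upwards [ev, self_mem_nhdsWithin] with t h1 h2
    have h2 : t ≠ 0 := h2
    have e1 : deriv P t = -2 / t ^ 2 + deriv p t := by
      have e2 : P =ᶠ[𝓝 t] fun z => 2 / z + p z := by
        filter_upwards [isOpen_ne.mem_nhds h2] with z hz using Pe z hz
      rw [e2.deriv_eq]
      have := (((hasDerivAt_inv h2).const_mul 2).add h1.differentiableAt.hasDerivAt)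
      have := (HasDerivAt.cg (g := fun z => 2 / z + p z) this (fun w => by simp [div_eq_mul_inv]) rfl).deriv
      rw [this]; ring
    have e3 := hd t
    have e4 := De t h2
    rw [e1, Pe t h2] at e3
    rw [e4, e3]
    field_simp
    ring

theorem CS.transl (h : CS O u U q) (ho : IsOpen O') (a : ℂ)
    (hO : ∀ z ∈ O', a + z ∈ O) :
    CS O' (fun z => u (a + z)) (fun z => U (a + z)) (fun z => q (a + z)) := by
  have hd : ∀ z, HasDerivAt (fun z => a + z) 1 z := fun z => (hasDerivAt_id z).const_add a
  refine ⟨ho, fun z hz => ?_, fun z hz => ?_, fun z hz => ?_⟩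
  · exact ((h.du (a + z) (hO z hz)).comp_right (φ := fun z => a + z) (hd z)).cg (fun _ => rfl)
      (by ring) (by simp)
  · exact ((h.dU (a + z) (hO z hz)).comp_right (φ := fun z => a + z) (hd z)).cg (fun _ => rfl)
      (by ring) (by simp)
  · exact (h.dq (a + z) (hO z hz)).comp z (hd z).differentiableAt

theorem wirt_add (hg : ∀ z, g (z + l) = g z) (z : ℂ) : wirt g (z + l) = wirt g z := by
  have e : fderiv ℝ g (z + l) = fderiv ℝ g z := by
    rw [← fderiv_comp_add_right]
    congr 1
    exact funext hg
  rw [wirt, wirt, e]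

theorem uPot_add (hu : ∀ z, u (z + l) = u z) (z : ℂ) : uPot u (z + l) = uPot u z := by
  have e := wirt_add (g := fun w => (u w : ℂ)) (l := l) (fun z => by rw [hu])
  rw [uPot, uPot, wirt_add e, e]

theorem starM_zero (k : ℕ) : starM k 0 = 1 := by simp [starM]

theorem starM_k (hk : K3 k) : ∃ j : Fin 4, (j : ℕ) = k ∧ starM k j = 1 := by
  refine ⟨⟨k, by omega⟩, rfl, by simp [starM]⟩

theorem sol_near (hk : K3 k)
    (hu : IsCurvatureSolution τ (starM k) u) (ha : a ∈ SS τ (per τ k / 2)) :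
    ∃ C ε : ℝ, 0 < ε ∧ ∀ z, z ≠ a → dist z a < ε → |u z - 4 * Real.log (dist z a)| ≤ C := by
  rcases ha with ha | ha
  · obtain ⟨C, ε, h1, h2⟩ := hu.2.2.2 0 (by rw [starM_zero]) a ha
    refine ⟨C, ε, h1, fun z hz hd => ?_⟩
    have e : per τ ((0 : Fin 4) : ℕ) / 2 + a = a := by simp [per]
    rw [e] at h2
    have := h2 z hz hd
    rw [starM_zero] at this
    simpa using this
  · obtain ⟨j, j1, j2⟩ := starM_k hk
    obtain ⟨C, ε, h1, h2⟩ := hu.2.2.2 j (by rw [j2]) _ ha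
    refine ⟨C, ε, h1, fun z hz hd => ?_⟩
    have e : per τ (j : ℕ) / 2 + (a - per τ k / 2) = a := by rw [j1]; ring
    rw [e] at h2
    have := h2 z hz hd
    rw [j2] at this
    simpa using this

theorem sol_cs (h : UP τ) (hk : K3 k)
    (hu : IsCurvatureSolution τ (starM k) u) :
    CS (SS τ (per τ k / 2))ᶜ u (wirt fun w => (u w : ℂ)) (uPot u) := by
  refine cs_of_sol (SS_closed h _).isOpen_compl (fun z hz => ?_)
  have := hu.2.2.1 z
  rw [singSet_star hk] at this
  exact this hz

theorem sol_smooth (hk : K3 k)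
    (hu : IsCurvatureSolution τ (starM k) u) (hz : z ∉ SS τ (per τ k / 2)) (n : ℕ) :
    ContDiffAt ℝ n u z := by
  have := hu.2.2.1 z
  rw [singSet_star hk] at this
  exact (this hz).1 n

theorem sol_loc (h : UP τ) (hk : K3 k)
    (hu : IsCurvatureSolution τ (starM k) u) (ha : a ∈ SS τ (per τ k / 2)) :
    ∃ p d : ℂ → ℂ, AnalyticAt ℂ p 0 ∧ AnalyticAt ℂ d 0 ∧ d 0 = 0 ∧ deriv d 0 = 0 ∧
      ∀ᶠ t in 𝓝[≠] 0, uPot u (a + t) = 2 / t ^ 2 + p t / t - 1 / 2 * deriv p t + 1 / 4 * p t ^ 2 + d t := by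
  obtain ⟨C, ε, e0, hC⟩ := sol_near hk hu ha
  have h1 := SS_punct h (per τ k / 2) a
  rw [eventually_nhdsWithin_iff] at h1
  obtain ⟨r, r0, hr⟩ := Metric.eventually_nhds_iff.1 h1
  set ρ := min (min r ε) 1 with hρ
  have ρ0 : 0 < ρ := by positivity
  have rr : ρ ≤ r := (min_le_left _ _).trans (min_le_left _ _)
  have rε : ρ ≤ ε := (min_le_left _ _).trans (min_le_right _ _)
  have out : ∀ z : ℂ, z ≠ 0 → ‖z‖ < ρ → a + z ∉ SS τ (per τ k / 2) := fun z h1 h2 =>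
    hr (by rw [dist_self_add_left]; linarith) (by simpa using h1)
  refine loc_form (u := fun z => u (a + z)) (U := fun z => wirt (fun w => (u w : ℂ)) (a + z)) (q := fun z => uPot u (a + z)) (C := C) ρ0 (min_le_right _ _) ?_ ?_ ?_
  · refine (sol_cs h hk hu).transl (isOpen_ball.sdiff isClosed_singleton) a (fun z hz => ?_)
    exact out z hz.2 (by simpa using hz.1)
  · intro z h1 h2
    exact (sol_smooth hk hu (out z h1 h2) 1).comp z (contDiffAt_const.add contDiffAt_id)
  · intro z h1 h2
    have := hC (a + z) (by simpa using h1) (by rw [dist_self_add_left]; linarith)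
    rwa [dist_self_add_left] at this

theorem loc_pole {p d : ℂ → ℂ} (hp : AnalyticAt ℂ p 0) (hd : AnalyticAt ℂ d 0)
    (he : ∀ᶠ t in 𝓝[≠] 0, q (a + t) = 2 / t ^ 2 + p t / t - 1 / 2 * deriv p t + 1 / 4 * p t ^ 2 + d t) :
    RemAt (fun w => q w - 2 / (w - a) ^ 2 - p 0 / (w - a)) a := by
  obtain ⟨p1, p1a, -, p1e⟩ := rem_div (g := fun z => p z - p 0) (a := 0) (hp.fun_sub analyticAt_const) (by simp)
  have hR : RemAt (fun t => p1 t - 1 / 2 * deriv p t + 1 / 4 * p t ^ 2 + d t) (a - a) := by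
    rw [sub_self]
    exact (((p1a.fun_sub (analyticAt_const.fun_mul hp.deriv)).fun_add (analyticAt_const.fun_mul (hp.fun_pow 2))).fun_add hd).remAt
  refine hR.comp_sub.congr ?_
  have ht := tendsto_sub_punct a a
  rw [sub_self] at ht
  filter_upwards [ht.eventually he, self_mem_nhdsWithin] with w h1 h2
  have h3 : w - a ≠ 0 := sub_ne_zero.2 h2
  rw [add_sub_cancel] at h1
  have := p1e (w - a)
  rw [sub_zero] at this
  rw [h1]
  field_simp
  linear_combination 8 * (w - a) * this

theorem q_form (h : UP τ) (hk : K3 k)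
    (hu : IsCurvatureSolution τ (starM k) u) :
    ∃ (p d : ℂ → ℂ) (e : ℂ), AnalyticAt ℂ p 0 ∧ AnalyticAt ℂ d 0 ∧ d 0 = 0 ∧ deriv d 0 = 0 ∧
      (∀ᶠ t in 𝓝[≠] 0, uPot u t = 2 / t ^ 2 + p t / t - 1 / 2 * deriv p t + 1 / 4 * p t ^ 2 + d t) ∧
      ∀ z ∉ SS τ (per τ k / 2), uPot u z = 2 * wp τ z + 2 * wp τ (z - per τ k / 2) +
        p 0 * (wzeta τ z - wzeta τ (z - per τ k / 2)) + e := by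
  obtain ⟨hω, h2⟩ := per_half h hk
  set ω := per τ k / 2 with hωd
  have hω' : 0 - ω ∉ lat τ := by rw [zero_sub, lat_neg_iff]; exact hω
  obtain ⟨p, d, pa, da, d0, d1, he⟩ := sol_loc h hk hu (a := 0) (Or.inl (lat_zero τ))
  obtain ⟨p', d', pa', da', d0', d1', he'⟩ := sol_loc h hk hu (a := ω) (Or.inr (by rw [← hωd, sub_self]; exact lat_zero τ))
  have l0 := loc_pole pa da he
  have l1 := loc_pole pa' da' he'
  simp only [zero_add] at he
  have dq := (sol_cs h hk hu).dq
  rw [← hωd] at dq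
  have qan : ∀ z ∉ SS τ ω, AnalyticAt ℂ (uPot u) z := fun z hz => by
    rw [Complex.analyticAt_iff_eventually_differentiableAt]
    filter_upwards [SS_nhds h hz] with w hw using dq w hw
  set q := uPot u with hq
  have Q1 : QP q 1 0 := fun z => Eventually.of_forall fun w => by rw [hq, uPot_add hu.1, add_zero]
  have Q2 : QP q τ 0 := fun z => Eventually.of_forall fun w => by rw [hq, uPot_add hu.2.1, add_zero]
  have wq : ∀ {l}, l ∈ lat τ → QP (wp τ) l 0 := fun {l} hl z => Eventually.of_forall fun w => by
    rw [wp_add h w hl, add_zero]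
  have q1 := ((((Q1.sub ((wq (lat_one τ)).cmul 2)).sub (((wq (lat_one τ)).shift ω).cmul 2)).sub ((zeta_qp1 h).cmul (p 0))).sub (((zeta_qp1 h).shift ω).cmul (p' 0)))
  have q2 := ((((Q2.sub ((wq (lat_tau τ)).cmul 2)).sub (((wq (lat_tau τ)).shift ω).cmul 2)).sub ((zeta_qp2 h).cmul (p 0))).sub (((zeta_qp2 h).shift ω).cmul (p' 0)))
  have an : ∀ z ∉ SS τ ω, AnalyticAt ℂ (fun z => q z - 2 * wp τ z - 2 * wp τ (z - ω) - p 0 * wzeta τ z - p' 0 * wzeta τ (z - ω)) z := by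
    intro z hz
    obtain ⟨z1, z2⟩ := notin_SS.1 hz
    exact ((((qan z hz).fun_sub (analyticAt_const.fun_mul (wp_analyticAt h z1))).fun_sub
      (analyticAt_const.fun_mul (an_sub (wp_analyticAt h z2)))).fun_sub
      (analyticAt_const.fun_mul (wzeta_analyticAt h z1))).fun_sub
      (analyticAt_const.fun_mul (an_sub (wzeta_analyticAt h z2)))
  have key := liouville h q1 q2 (ellRem {0, ω} q1 q2 ?_ ?_)
  · obtain ⟨k1, b, -, k2⟩ := key
    obtain ⟨n, hn, hn'⟩ := legendre h
    have h3 : (p 0 + p' 0) * (eta1 τ * τ - eta2 τ) = 0 := by linear_combination k1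
    have h4 : p' 0 = - p 0 := by
      rcases mul_eq_zero.1 h3 with h4 | h4
      · linear_combination h4
      · rw [hn'] at h4
        simp [hn, Real.pi_ne_zero] at h4
    refine ⟨p, d, b, pa, da, d0, d1, he, fun z hz => ?_⟩
    have a1 := an z hz
    have a2 := k2 z
    have a3 : Tendsto (fun z => q z - 2 * wp τ z - 2 * wp τ (z - ω) - p 0 * wzeta τ z - p' 0 * wzeta τ (z - ω)) (𝓝[≠] z) (𝓝 b) := by
      refine tendsto_const_nhds.congr' ?_
      filter_upwards [a2] with w hw
      rw [hw, h4]; ring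
    have a4 := tendsto_nhds_unique (a1.continuousAt.tendsto.mono_left nhdsWithin_le_nhds) a3
    rw [h4] at a4
    linear_combination a4
  · intro z hz
    exact (an z (notin_SS.2 ⟨by simpa using hz 0 (by simp), hz ω (by simp)⟩)).remAt
  · rintro a (rfl | rfl)
    · have r1 := (((AnalyticAt.fun_mul (analyticAt_const (v := (2:ℂ))) (ph_analyticAt h)).fun_add ((analyticAt_const (v := (2:ℂ))).fun_mul (an_sub (wp_analyticAt h hω')))).fun_add
        ((analyticAt_const (v := p 0)).fun_mul (zh_analyticAt h 0 fun _ => rfl))).fun_add (AnalyticAt.fun_mul (analyticAt_const (v := p' 0)) (an_sub (wzeta_analyticAt h hω')))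
      refine (l0.sub r1.remAt).congr (Eventually.of_forall fun w => ?_)
      simp only [wp_ph τ w, wzeta_eq τ w, sub_zero]
      ring
    · have e0 : ω - ω = 0 := sub_self ω
      have r1 := (((AnalyticAt.fun_mul (analyticAt_const (v := (2:ℂ))) (an_sub (f := ph τ) (a := ω) (by rw [e0]; exact ph_analyticAt h))).fun_add ((analyticAt_const (v := (2:ℂ))).fun_mul (wp_analyticAt h hω))).fun_add
        ((analyticAt_const (v := p' 0)).fun_mul (an_sub (f := zh τ) (a := ω) (by rw [e0]; exact zh_analyticAt h 0 fun _ => rfl)))).fun_add (AnalyticAt.fun_mul (analyticAt_const (v := p 0)) (wzeta_analyticAt h hω))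
      refine (l1.sub r1.remAt).congr (Eventually.of_forall fun w => ?_)
      simp only [wp_ph τ (w - ω), wzeta_eq τ (w - ω)]
      ring

theorem choose_pts (h : UP τ) (ω l : ℂ) :
    ∃ a1 a2, a1 ∉ lat τ ∧ a2 ∉ lat τ ∧ a1 + a2 ∉ lat τ ∧ wp τ a1 + wp τ a2 = 2 * wp τ ω ∧
      lam τ a1 a2 = l := by
  obtain ⟨A, hA, hA'⟩ := wp_surj h (l ^ 2 - 2 * wp τ ω)
  obtain ⟨a, ha, ha', e⟩ := exists_pair h hA (2 * wp τ ω)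
  have e1 : a + (A - a) = A := by ring
  have fs := FS h ha ha' (by rwa [e1])
  rw [e1, hA', e] at fs
  have fs2 : (lam τ a (A - a) - l) * (lam τ a (A - a) + l) = 0 := by linear_combination fs
  rcases mul_eq_zero.1 fs2 with h1 | h1
  · exact ⟨a, A - a, ha, ha', by rwa [e1], e, by linear_combination h1⟩
  · refine ⟨-a, -(A - a), by rwa [lat_neg_iff], by rwa [lat_neg_iff], ?_, ?_, ?_⟩
    · rw [← neg_add, e1, lat_neg_iff]; exact hA
    · rw [wp_neg h, wp_neg h, e]
    · rw [lam] at h1 ⊢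
      rw [← neg_add, wzeta_neg, wzeta_neg, wzeta_neg]; linear_combination -h1

theorem delta_zero {p m d : ℂ → ℂ} {δ : ℂ} (hp : AnalyticAt ℂ p 0) (hm : AnalyticAt ℂ m 0)
    (hd : AnalyticAt ℂ d 0) (d0 : d 0 = 0) (d1 : deriv d 0 = 0) (hpm : p 0 + 2 * m 0 = 0) (p0 : p 0 ≠ 0)
    (he : ∀ᶠ t in 𝓝[≠] (0:ℂ), (2 / t ^ 2 + p t / t - 1 / 2 * deriv p t + 1 / 4 * p t ^ 2 + d t)
      - (2 / t ^ 2 - 2 * m t / t + deriv m t + m t ^ 2) = δ) : δ = 0 := by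
  have hs : AnalyticAt ℂ (fun t => p t + 2 * m t) 0 := hp.fun_add (analyticAt_const.fun_mul hm)
  obtain ⟨φ, hφ, -, hφ'⟩ := rem_div hs (by simpa using hpm)
  simp only [sub_zero] at hφ'
  have hE : AnalyticAt ℂ (fun t => 1/2 * φ t - 1/2 * (t * deriv φ t) + 1/4 * ((p t - 2 * m t) * (t * φ t)) + d t) 0 :=
    (((analyticAt_const.fun_mul hφ).fun_sub (analyticAt_const.fun_mul (analyticAt_id.fun_mul hφ.deriv))).fun_add
      (analyticAt_const.fun_mul ((hp.fun_sub (analyticAt_const.fun_mul hm)).fun_mul (analyticAt_id.fun_mul hφ)))).fun_add hd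
  have ev : ∀ᶠ t in 𝓝[≠] (0:ℂ), 1/2 * φ t - 1/2 * (t * deriv φ t) + 1/4 * ((p t - 2 * m t) * (t * φ t)) + d t = δ := by
    filter_upwards [he, self_mem_nhdsWithin, hp.eventually_analyticAt.filter_mono nhdsWithin_le_nhds,
      hm.eventually_analyticAt.filter_mono nhdsWithin_le_nhds, hφ.eventually_analyticAt.filter_mono nhdsWithin_le_nhds] with t h1 h2 h3 h4 h5
    have h2 : t ≠ 0 := h2
    have e1 : HasDerivAt (fun t => p t + 2 * m t) (deriv p t + 2 * deriv m t) t :=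
      h3.differentiableAt.hasDerivAt.fun_add (h4.differentiableAt.hasDerivAt.const_mul 2)
    have e2 : HasDerivAt (fun t => p t + 2 * m t) (1 * φ t + t * deriv φ t) t :=
      ((hasDerivAt_id t).fun_mul h5.differentiableAt.hasDerivAt).cg hφ' rfl
    have e3 := e1.unique e2
    have e4 : p t / t = φ t - 2 * m t / t := by
      field_simp; linear_combination hφ' t
    have e5 := hφ' t
    rw [← h1, e4]
    linear_combination (1/2) * e3 - (1/4) * (p t - 2 * m t) * e5
  have ev2 := hE.continuousAt.eventuallyEq_nhds_iff_eventuallyEq_nhdsNE (g := fun _ => δ) continuousAt_const |>.1 ev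
  have z0 := ev2.self_of_nhds
  have z1 := ev2.deriv_eq
  simp only [deriv_const] at z1
  have hdd := (((hφ.differentiableAt.hasDerivAt.const_mul (1/2)).fun_sub (((hasDerivAt_id (0:ℂ)).fun_mul hφ.deriv.differentiableAt.hasDerivAt).const_mul (1/2))).fun_add
    (((hp.differentiableAt.hasDerivAt.fun_sub (hm.differentiableAt.hasDerivAt.const_mul 2)).fun_mul ((hasDerivAt_id (0:ℂ)).fun_mul hφ.differentiableAt.hasDerivAt)).const_mul (1/4))).fun_add hd.differentiableAt.hasDerivAt
  have z2 := hdd.deriv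
  simp only [id] at z2
  rw [z1] at z2
  simp [d0, d1] at z2 z0
  rcases z2 with h1 | h1
  · exact absurd (by linear_combination (h1 + hpm) / 2) p0
  · rw [← z0, h1]; simp

theorem ps_N (H : PS O ψ R P q) (hz : z ∈ O)
    (hy : AnalyticAt ℂ y z) (ode : deriv (deriv y) z = q z * y z) :
    HasDerivAt (fun w => y w * starRingEnd ℂ (y w) * R w - y w * starRingEnd ℂ (deriv y w) * P w
      - deriv y w * starRingEnd ℂ (y w) * starRingEnd ℂ (P w) + deriv y w * starRingEnd ℂ (deriv y w) * ψ w) 0 z := by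
  have y0 := HW.of_deriv hy.differentiableAt.hasDerivAt
  have y1 := HW.of_deriv hy.deriv.differentiableAt.hasDerivAt
  rw [ode] at y1
  have a1 := (y0.mul y0.conj).mul (H.dR z hz)
  have a2 := (y0.mul y1.conj).mul (H.dP z hz)
  have a3 := (y1.mul y0.conj).mul (H.dP z hz).conj
  have a4 := (y1.mul y1.conj).mul (H.dψ z hz)
  refine HW.hasDerivAt ((((a1.sub a2).sub a3).add a4).cg (fun w => rfl) ?_ ?_)
  all_goals
    simp only [map_mul, map_zero, Complex.conj_ofReal, Complex.conj_conj]
    ring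

theorem ps_W (H : PS O ψ R P q) (hz : z ∈ O)
    (hy : AnalyticAt ℂ y z) (ode : deriv (deriv y) z = q z * y z) :
    HasDerivAt (fun w => starRingEnd ℂ (y w) * starRingEnd ℂ (P w) - starRingEnd ℂ (deriv y w) * ψ w)
      (starRingEnd ℂ (y z) * R z - starRingEnd ℂ (deriv y z) * P z) z := by
  have y0 := HW.of_deriv hy.differentiableAt.hasDerivAt
  have y1 := HW.of_deriv hy.deriv.differentiableAt.hasDerivAt
  rw [ode] at y1
  refine HW.hasDerivAt (((y0.conj.mul (H.dP z hz).conj).sub (y1.conj.mul (H.dψ z hz))).cg (fun w => rfl) ?_ ?_)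
  all_goals
    simp only [map_mul, map_zero, Complex.conj_ofReal]
    ring

theorem ps_pos (H : PS O ψ R P q)
    (h0 : y z * starRingEnd ℂ (y z) * R z - y z * starRingEnd ℂ (deriv y z) * P z
      - deriv y z * starRingEnd ℂ (y z) * starRingEnd ℂ (P z) + deriv y z * starRingEnd ℂ (deriv y z) * ψ z = 0) :
    y z = 0 ∧ deriv y z = 0 := by
  have e : y z * starRingEnd ℂ (y z) / 8 + (y z * P z - deriv y z * ψ z) * starRingEnd ℂ (y z * P z - deriv y z * ψ z) = 0 := by
    simp only [map_mul, map_sub, Complex.conj_ofReal]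
    linear_combination ψ z * h0 - y z * starRingEnd ℂ (y z) * H.rel z
  rw [Complex.mul_conj, Complex.mul_conj] at e
  have e2 : Complex.normSq (y z) / 8 + Complex.normSq (y z * P z - deriv y z * ψ z) = 0 := by exact_mod_cast e
  have n1 := Complex.normSq_nonneg (y z)
  have n2 := Complex.normSq_nonneg (y z * P z - deriv y z * ψ z)
  have y0 : y z = 0 := Complex.normSq_eq_zero.1 (by linarith)
  have w0 : y z * P z - deriv y z * ψ z = 0 := Complex.normSq_eq_zero.1 (by linarith)
  refine ⟨y0, ?_⟩
  rw [y0] at w0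
  have : (ψ z : ℂ) ≠ 0 := by exact_mod_cast (H.pos z).ne'
  simpa [this] using w0

theorem deriv_mult (hy : ∀ z, y (z + l) = μ * y z) (z : ℂ) :
    deriv y (z + l) = μ * deriv y z := by
  rw [← deriv_comp_add_const, show (fun x => y (x + l)) = fun x => μ * y x from funext hy, deriv_const_mul_field]

noncomputable def NN (ψ R : ℂ → ℝ) (P y : ℂ → ℂ) (w : ℂ) : ℂ :=
  y w * starRingEnd ℂ (y w) * R w - y w * starRingEnd ℂ (deriv y w) * P w
      - deriv y w * starRingEnd ℂ (y w) * starRingEnd ℂ (P w) + deriv y w * starRingEnd ℂ (deriv y w) * ψ w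

theorem yd_N (h : UP τ)
    (Y : YD τ ω a1 a2 y q μ1 μ2 l ε) (H : PS (SS τ ω)ᶜ ψ R P q) :
    ∃ N0, N0 ≠ 0 ∧ ∀ z ∉ SS τ ω, NN ψ R P y z = N0 := by
  obtain ⟨z0, z1, z2, z3⟩ := ((SS_punct h ω 0).and ((off_lat_sub h a1 0).and (off_lat_sub h a2 0))).exists
  refine ⟨NN ψ R P y z0, fun e => ?_, fun z hz => ?_⟩
  · have := (ps_pos H e).1
    rw [Y.zer z0 (notin_SS.1 z1).1 (notin_SS.1 z1).2] at this
    tauto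
  · refine const_of_deriv_zero (SS_countable τ ω) (SS_closed h ω) (fun z hz => ?_) hz z1
    obtain ⟨h1, h2⟩ := notin_SS.1 hz
    exact ps_N H hz (Y.an z h1 h2) (Y.ode z h1 h2)

theorem R_per (H : PS O ψ R P q)
    (h1 : ψ (z + l) = ψ z) (h2 : P (z + l) = P z) : R (z + l) = R z := by
  have e1 := H.rel z
  have e2 := H.rel (z + l)
  rw [h1, h2] at e2
  have n : (ψ z : ℂ) ≠ 0 := by exact_mod_cast (H.pos z).ne'
  have : (ψ z : ℂ) * (R (z + l) - R z) = 0 := by linear_combination e2 - e1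
  have := (mul_eq_zero.1 this).resolve_left n
  exact_mod_cast sub_eq_zero.1 this

theorem NN_per (H : PS O ψ R P q)
    (h1 : ψ (z + l) = ψ z) (h2 : P (z + l) = P z) (hy : ∀ z, y (z + l) = μ * y z) :
    NN ψ R P y (z + l) = μ * starRingEnd ℂ μ * NN ψ R P y z := by
  simp only [NN, h1, h2, R_per H h1 h2, deriv_mult hy, hy, map_mul]
  ring

theorem dbl_pole (hy : AnalyticAt ℂ y a) (y0 : y a = 0) (y1 : deriv y a ≠ 0)
    (y2 : deriv (deriv y) a = 0) (c : ℂ) :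
    RemAt (fun z => c / y z ^ 2 - c / deriv y a ^ 2 * (1 / (z - a) ^ 2)) a := by
  obtain ⟨φ, hφ, hφ0, e⟩ := rem_div hy y0
  have d1 : deriv φ a = 0 := by
    have e1 : deriv y =ᶠ[𝓝 a] fun z => φ z + (z - a) * deriv φ z := by
      filter_upwards [hφ.eventually_analyticAt] with z hz
      have := ((((hasDerivAt_id z).sub_const a).fun_mul hz.differentiableAt.hasDerivAt).cg e rfl).deriv
      rw [this]; simp
    have e2 := e1.deriv_eq
    rw [y2] at e2
    have e3 := (hφ.differentiableAt.hasDerivAt.fun_add (((hasDerivAt_id a).sub_const a).fun_mul hφ.deriv.differentiableAt.hasDerivAt)).deriv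
    simp only [id] at e3
    rw [e3] at e2
    simp at e2
    linear_combination -e2 / 2
  have hn : φ a ≠ 0 := by rwa [hφ0]
  have hg : AnalyticAt ℂ (fun z => c / φ z ^ 2 - c / φ a ^ 2) a :=
    (analyticAt_const.fun_div (hφ.fun_pow 2) (pow_ne_zero 2 hn)).fun_sub analyticAt_const
  have hg1 : HasDerivAt (fun z => c / φ z ^ 2 - c / φ a ^ 2) 0 a := by
    have := (((hasDerivAt_const a c).fun_div (hφ.differentiableAt.hasDerivAt.fun_pow 2) (pow_ne_zero 2 hn))).sub_const (c / φ a ^ 2)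
    refine this.congr_deriv ?_
    rw [d1]; simp
  obtain ⟨g1, a1, b1, c1⟩ := rem_div hg (by simp)
  rw [hg1.deriv] at b1
  obtain ⟨g2, a2, b2, c2⟩ := rem_div a1 b1
  refine ⟨g2, a2, ?_⟩
  filter_upwards [self_mem_nhdsWithin, (hφ.continuousAt.eventually_ne hn).filter_mono nhdsWithin_le_nhds] with z hz hz2
  have hz' : z - a ≠ 0 := sub_ne_zero.2 hz
  have := c1 z
  rw [c2, sub_eq_iff_eq_add] at this
  rw [e, ← hφ0, mul_pow, mul_comm, ← div_div, this]
  field_simp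
  ring

set_option maxHeartbeats 1000000 in
theorem no_half (h : UP τ)
    (Y : YD τ ω a1 a2 y q μ1 μ2 l ε) (H : PS (SS τ ω)ᶜ ψ R P q)
    (p1 : ∀ z, ψ (z + 1) = ψ z) (p2 : ∀ z, ψ (z + τ) = ψ z) (P1 : ∀ z, P (z + 1) = P z) (P2 : ∀ z, P (z + τ) = P z)
    (s1 : μ1 = 1 ∨ μ1 = -1) (s2 : μ2 = 1 ∨ μ2 = -1) : False := by
  obtain ⟨N0, hN, hN'⟩ := yd_N h Y H
  have q1 : μ1 ^ 2 = 1 ∧ starRingEnd ℂ μ1 = μ1 ∧ μ1 ≠ 0 := by rcases s1 with rfl | rfl <;> simp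
  have q2 : μ2 ^ 2 = 1 ∧ starRingEnd ℂ μ2 = μ2 ∧ μ2 ≠ 0 := by rcases s2 with rfl | rfl <;> simp
  have h12 : a1 - a2 ∉ lat τ := fun hl => Y.xne (by
    rw [← wp_add h a2 hl]; congr 1; ring)
  have h21 : a2 - a1 ∉ lat τ := fun hl => h12 (by rw [← neg_sub, lat_neg_iff]; exact hl)
  have A1 := Y.an a1 Y.a1n Y.a1w
  have A2 := Y.an a2 Y.a2n Y.a2w
  have Z1 : y a1 = 0 := (Y.zer a1 Y.a1n Y.a1w).2 (Or.inl (by rw [sub_self]; exact lat_zero τ))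
  have Z2 : y a2 = 0 := (Y.zer a2 Y.a2n Y.a2w).2 (Or.inr (by rw [sub_self]; exact lat_zero τ))
  have D1 : deriv y a1 ≠ 0 := fun e => hN (by
    rw [← hN' a1 (notin_SS.2 ⟨Y.a1n, Y.a1w⟩), NN, Z1, e]; simp)
  have D2 : deriv y a2 ≠ 0 := fun e => hN (by
    rw [← hN' a2 (notin_SS.2 ⟨Y.a2n, Y.a2w⟩), NN, Z2, e]; simp)
  have E1 := dbl_pole A1 Z1 D1 (by rw [Y.ode a1 Y.a1n Y.a1w, Z1, mul_zero]) N0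
  have E2 := dbl_pole A2 Z2 D2 (by rw [Y.ode a2 Y.a2n Y.a2w, Z2, mul_zero]) N0
  set c1 := N0 / deriv y a1 ^ 2 with hc1
  set c2 := N0 / deriv y a2 ^ 2 with hc2
  have c1n : c1 ≠ 0 := div_ne_zero hN (pow_ne_zero 2 D1)
  set E : ℂ → ℂ := fun z => N0 / y z ^ 2 - c1 * wp τ (z - a1) - c2 * wp τ (z - a2) with hE
  have Gp : ∀ p ∈ SS τ ω, ∃ φ, AnalyticAt ℂ φ p ∧ φ p = 0 ∧ (fun z => N0 / y z ^ 2) =ᶠ[𝓝[≠] p] φ := by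
    intro p hp
    obtain ⟨G, g1, g2, g3⟩ := yd_pole Y hp
    refine ⟨fun z => N0 * (z - p) ^ 2 / G z ^ 2, ?_, by simp, ?_⟩
    · exact (analyticAt_const.fun_mul ((analyticAt_id.fun_sub analyticAt_const).fun_pow 2)).fun_div (g1.fun_pow 2) (pow_ne_zero 2 g2)
    · refine Eventually.of_forall fun z => ?_
      simp only [g3, div_pow, div_div_eq_mul_div]
  have Ean : ∀ z, z ∉ SS τ ω → z - a1 ∉ lat τ → z - a2 ∉ lat τ → AnalyticAt ℂ E z := by
    intro z h1 h2 h3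
    obtain ⟨h4, h5⟩ := notin_SS.1 h1
    have y0 : y z ≠ 0 := fun e => by
      rw [Y.zer z h4 h5] at e; tauto
    exact ((analyticAt_const.fun_div ((Y.an z h4 h5).fun_pow 2) (pow_ne_zero 2 y0)).fun_sub
      (analyticAt_const.fun_mul (an_sub (wp_analyticAt h h2)))).fun_sub (analyticAt_const.fun_mul (an_sub (wp_analyticAt h h3)))
  have Q1 : QP E 1 0 := fun z => Eventually.of_forall fun w => by
    simp only [hE, Y.per1, mul_pow, q1.1, one_mul, add_zero]
    rw [show w + 1 - a1 = w - a1 + 1 by ring, show w + 1 - a2 = w - a2 + 1 by ring, wp_add h _ (lat_one τ), wp_add h _ (lat_one τ)]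
  have Q2 : QP E τ 0 := fun z => Eventually.of_forall fun w => by
    simp only [hE, Y.per2, mul_pow, q2.1, one_mul, add_zero]
    rw [show w + τ - a1 = w - a1 + τ by ring, show w + τ - a2 = w - a2 + τ by ring, wp_add h _ (lat_tau τ), wp_add h _ (lat_tau τ)]
  have hrem := ellRem {a1, a2} Q1 Q2 ?_ ?_
  · obtain ⟨-, b, -, hb⟩ := liouville h Q1 Q2 hrem
    simp only [zero_mul, zero_add] at hb
    set T : Set ℂ := SS τ ω ∪ ({z | z - a1 ∈ lat τ} ∪ {z | z - a2 ∈ lat τ}) with hT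
    have Tn : ∀ z, z ∉ T ↔ z ∉ SS τ ω ∧ z - a1 ∉ lat τ ∧ z - a2 ∉ lat τ := by
      intro z; simp [hT]
    have Tc : T.Countable := (SS_countable τ ω).union ((coset_countable τ a1).union (coset_countable τ a2))
    have Tcl : IsClosed T := (SS_closed h ω).union ((coset_closed h a1).union (coset_closed h a2))
    set W : ℂ → ℂ := fun w => starRingEnd ℂ (y w) * starRingEnd ℂ (P w) - starRingEnd ℂ (deriv y w) * ψ w with hW
    set D : ℂ → ℂ := fun z => W z / y z + c1 * wzeta τ (z - a1) + c2 * wzeta τ (z - a2) - b * z with hD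
    have dD : ∀ z ∉ T, HasDerivAt D 0 z := by
      intro z hz
      obtain ⟨h1, h2, h3⟩ := (Tn z).1 hz
      obtain ⟨h4, h5⟩ := notin_SS.1 h1
      have y0 : y z ≠ 0 := fun e => by
        rw [Y.zer z h4 h5] at e; tauto
      have ay := Y.an z h4 h5
      have d1 := (ps_W H h1 ay (Y.ode z h4 h5)).fun_div ay.differentiableAt.hasDerivAt y0
      have d2 := ((wzeta_hasDerivAt h h2).comp_sub_const z a1).const_mul c1
      have d3 := ((wzeta_hasDerivAt h h3).comp_sub_const z a2).const_mul c2
      have d4 := (hasDerivAt_id z).const_mul b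
      have Ez : E z = b := tendsto_nhds_unique ((Ean z h1 h2 h3).continuousAt.tendsto.mono_left nhdsWithin_le_nhds)
        (tendsto_const_nhds.congr' (EventuallyEq.symm (hb z)))
      refine (((d1.fun_add d2).fun_add d3).fun_sub d4).congr_deriv ?_
      have hn := hN' z h1
      rw [NN] at hn
      rw [← Ez]
      simp only [hE]
      rw [← hn]
      field_simp
      ring
    obtain ⟨z, hz⟩ := ((SS_punct h ω 0).and ((off_lat_sub h a1 0).and (off_lat_sub h a2 0))).exists
    have per : ∀ l ∈ lat τ, z + l ∉ T := fun l hl => by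
      rw [Tn, SS_add hl, show z + l - a1 = z - a1 + l by ring, show z + l - a2 = z - a2 + l by ring, lat_add_iff hl, lat_add_iff hl]
      exact hz
    have k1 := const_of_deriv_zero Tc Tcl dD (per 1 (lat_one τ)) ((Tn z).2 hz)
    have k2 := const_of_deriv_zero Tc Tcl dD (per τ (lat_tau τ)) ((Tn z).2 hz)
    have w1 : W (z + 1) / y (z + 1) = W z / y z := by
      simp only [hW, deriv_mult Y.per1, Y.per1, P1, p1, map_mul, q1.2.1]
      rw [mul_assoc, mul_assoc, ← mul_sub, mul_div_mul_left _ _ q1.2.2]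
    have w2 : W (z + τ) / y (z + τ) = W z / y z := by
      simp only [hW, deriv_mult Y.per2, Y.per2, P2, p2, map_mul, q2.2.1]
      rw [mul_assoc, mul_assoc, ← mul_sub, mul_div_mul_left _ _ q2.2.2]
    simp only [hD] at k1 k2
    rw [w1, show z + 1 - a1 = z - a1 + 1 by ring, show z + 1 - a2 = z - a2 + 1 by ring, wzeta_add_one h hz.2.1, wzeta_add_one h hz.2.2] at k1
    rw [w2, show z + τ - a1 = z - a1 + τ by ring, show z + τ - a2 = z - a2 + τ by ring, wzeta_add_tau h hz.2.1, wzeta_add_tau h hz.2.2] at k2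
    have c12 : c1 + c2 = 0 := by
      obtain ⟨n, hn, hn'⟩ := legendre h
      have h3 : (c1 + c2) * (eta1 τ * τ - eta2 τ) = 0 := by linear_combination τ * k1 - k2
      rcases mul_eq_zero.1 h3 with h4 | h4
      · exact h4
      · rw [hn'] at h4
        simp [hn, Real.pi_ne_zero] at h4
    have b0 : b = 0 := by linear_combination eta1 τ * c12 - k1
    obtain ⟨φ, f1, f2, f3⟩ := Gp 0 (Or.inl (lat_zero τ))
    have n1 : 0 - a1 ∉ lat τ := by rw [zero_sub, lat_neg_iff]; exact Y.a1n
    have n2 : 0 - a2 ∉ lat τ := by rw [zero_sub, lat_neg_iff]; exact Y.a2n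
    have an0 : AnalyticAt ℂ (fun z => φ z - c1 * wp τ (z - a1) - c2 * wp τ (z - a2)) 0 :=
      (f1.fun_sub (analyticAt_const.fun_mul (an_sub (wp_analyticAt h n1)))).fun_sub
        (analyticAt_const.fun_mul (an_sub (wp_analyticAt h n2)))
    have lim := tendsto_nhds_unique (an0.continuousAt.tendsto.mono_left nhdsWithin_le_nhds)
      ((tendsto_const_nhds (x := b)).congr' (by
        filter_upwards [hb 0, f3] with w hw hw2
        rw [← hw, ← hw2]))
    rw [f2, b0] at lim
    simp only [zero_sub] at lim
    rw [wp_neg h, wp_neg h] at lim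
    have : c1 * (wp τ a1 - wp τ a2) = 0 := by linear_combination -lim - wp τ a2 * c12
    rcases mul_eq_zero.1 this with h4 | h4
    · exact c1n h4
    · exact Y.xne (sub_eq_zero.1 h4)
  · intro z hz
    have h1 := hz a1 (by simp)
    have h2 := hz a2 (by simp)
    by_cases hS : z ∈ SS τ ω
    · obtain ⟨φ, f1, f2, f3⟩ := Gp z hS
      exact (RemAt.sub (RemAt.sub ⟨φ, f1, f3⟩ (analyticAt_const.fun_mul (an_sub (wp_analyticAt h h1))).remAt)
        (analyticAt_const.fun_mul (an_sub (wp_analyticAt h h2))).remAt)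
    · exact (Ean z hS h1 h2).remAt
  · rintro a (rfl | rfl)
    · have e0 : a - a = 0 := sub_self a
      have r1 := (((analyticAt_const (v := c1)).fun_mul (an_sub (f := ph τ) (a := a) (by rw [e0]; exact ph_analyticAt h))).fun_add ((analyticAt_const (v := c2)).fun_mul (an_sub (wp_analyticAt h h12))))
      refine (E1.sub r1.remAt).congr (Eventually.of_forall fun w => ?_)
      simp only [hE, wp_ph τ (w - a)]
      ring
    · have e0 : a - a = 0 := sub_self a
      have r1 := (((analyticAt_const (v := c2)).fun_mul (an_sub (f := ph τ) (a := a) (by rw [e0]; exact ph_analyticAt h))).fun_add ((analyticAt_const (v := c1)).fun_mul (an_sub (wp_analyticAt h h21))))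
      refine (E2.sub r1.remAt).congr (Eventually.of_forall fun w => ?_)
      simp only [hE, wp_ph τ (w - a)]
      ring

theorem real_coord (h : UP τ) (A : ℂ) : ∃ r s : ℝ, A = r + s * τ := by
  refine ⟨A.re - A.im / τ.im * τ.re, A.im / τ.im, ?_⟩
  apply Complex.ext
  · simp
  · simp; field_simp

theorem real_zero (h : UP τ) (h1 : d.re = 0) (h2 : (d * τ).re = 0) : d = 0 := by
  rw [Complex.mul_re, h1] at h2
  have : d.im = 0 := by
    have : d.im * τ.im = 0 := by linarith
    rcases mul_eq_zero.1 this with h3 | h3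
    · exact h3
    · exact absurd h3 h.ne'
  exact Complex.ext h1 this

theorem exp_sign (n : ℤ) (e : x = Real.pi * Complex.I * n) : Complex.exp x = 1 ∨ Complex.exp x = -1 := by
  have h1 : Complex.exp x * Complex.exp x = 1 := by
    rw [← Complex.exp_add, e, show (Real.pi * Complex.I * n + Real.pi * Complex.I * n : ℂ) = n * (2 * Real.pi * Complex.I) by ring]
    exact Complex.exp_int_mul_two_pi_mul_I n
  exact mul_self_eq_one_iff.1 h1

set_option maxHeartbeats 1000000 in
theorem right_ne (h : UP τ) (hk : K3 k)
    (hu : IsCurvatureSolution τ (starM k) u) {p d : ℂ → ℂ} (hp : AnalyticAt ℂ p 0)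
    (hd : AnalyticAt ℂ d 0) (d0 : d 0 = 0) (d1 : deriv d 0 = 0)
    (hq0 : ∀ᶠ t in 𝓝[≠] (0:ℂ), uPot u t = 2 / t ^ 2 + p t / t - 1 / 2 * deriv p t + 1 / 4 * p t ^ 2 + d t)
    (hq : ∀ z ∉ SS τ (per τ k / 2), uPot u z = 2 * wp τ z + 2 * wp τ (z - per τ k / 2)
      + p 0 * (wzeta τ z - wzeta τ (z - per τ k / 2)) + e) (p0 : p 0 ≠ 0) :
    ∃ r s : ℝ, ¬ IsHalfIntPair (r : ℂ) (s : ℂ) ∧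
        heckeZ (rkr k (r : ℂ)) (rks k (s : ℂ)) τ = 0 ∧ heckeZm k (r : ℂ) (s : ℂ) τ ≠ 0 := by
  obtain ⟨hω, h2⟩ := per_half h hk
  set ω := per τ k / 2 with hωd
  obtain ⟨a1, a2, ha1, ha2, hA, he, hl⟩ := choose_pts h ω (-(p 0) / 2)
  obtain ⟨y, q, μ1, μ2, ε, Y⟩ := ydata h hω h2 ha1 ha2 hA he
  rw [hl] at Y
  have hqq : ∀ z ∉ SS τ ω, uPot u z - q z = e - ε := fun z hz => by
    rw [hq z hz, Y.qdef]; ring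
  have hδ : e - ε = 0 := by
    obtain ⟨m, m1, m2, m3⟩ := Y.q0
    refine delta_zero hp m1 hd d0 d1 (by rw [m2]; ring) p0 ?_
    filter_upwards [hq0, m3, SS_punct h ω 0] with t t1 t2 t3
    rw [← t1, ← t2, hqq t t3]
  have hqe : ∀ z ∉ SS τ ω, uPot u z = q z := fun z hz => by
    have := hqq z hz; rw [hδ] at this; exact sub_eq_zero.1 this
  have H0 := (sol_cs h hk hu).ps
  rw [← hωd] at H0
  set ψ : ℂ → ℝ := fun z => Real.exp (-1/2 * u z) with hψ
  set U : ℂ → ℂ := wirt fun w => (u w : ℂ) with hU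
  set P : ℂ → ℂ := fun z => -1/2 * U z * (ψ z : ℝ) with hP
  set R : ℂ → ℝ := fun z => (1/8 + ‖P z‖ ^ 2) / ψ z with hR
  have H : PS (SS τ ω)ᶜ ψ R P q := by
    refine ⟨H0.dψ, fun z hz => ?_, fun z hz => ?_, H0.rel, H0.pos⟩
    · have := H0.dP z hz
      rwa [hqe z hz] at this
    · have := H0.dR z hz
      rwa [hqe z hz] at this
  have pp : ∀ l, (∀ z, u (z + l) = u z) → (∀ z, ψ (z + l) = ψ z) ∧ ∀ z, P (z + l) = P z := by
    intro l hl
    have h1 : ∀ z, ψ (z + l) = ψ z := fun z => by simp only [hψ, hl]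
    refine ⟨h1, fun z => ?_⟩
    simp only [hP, h1, hU]
    rw [wirt_add (fun z => by rw [hl])]
  obtain ⟨N0, hN, hN'⟩ := yd_N h Y H
  obtain ⟨z0, z1⟩ := (SS_punct h ω 0).exists
  have nm : ∀ l ∈ lat τ, (∀ z, u (z + l) = u z) → ∀ μ, (∀ z, y (z + l) = μ * y z) → ‖μ‖ = 1 := by
    intro l hl hul μ hμ
    have e1 := NN_per H ((pp l hul).1 z0) ((pp l hul).2 z0) hμ
    rw [hN' _ z1, hN' _ (by rwa [SS_add hl]), Complex.mul_conj] at e1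
    have e2 : ((Complex.normSq μ : ℝ) : ℂ) = 1 := mul_right_cancel₀ hN (by rw [one_mul]; exact e1.symm)
    have e3 : Complex.normSq μ = 1 := by exact_mod_cast e2
    rw [Complex.normSq_eq_norm_sq] at e3
    nlinarith [norm_nonneg μ]
  have n1 := nm 1 (lat_one τ) hu.1 μ1 Y.per1
  have n2 := nm τ (lat_tau τ) hu.2.1 μ2 Y.per2
  obtain ⟨r, s, hrs⟩ := real_coord h (a1 + a2 - ω)
  have hrs' : a1 + a2 = r + s * τ + ω := by linear_combination hrs
  obtain ⟨n, hn, e1, e2⟩ := yd_mults h Y hrs'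
  rw [hωd, ← hecke_shift h hk] at e1 e2
  have f1 : (heckeZ (rkr k r) (rks k s) τ).re = 0 := by
    rw [e1, Complex.norm_exp, Real.exp_eq_one_iff] at n1
    simpa using n1
  have f2 : (heckeZ (rkr k r) (rks k s) τ * τ).re = 0 := by
    rw [e2, Complex.norm_exp, Real.exp_eq_one_iff] at n2
    rw [Complex.add_re] at n2
    have : (2 * Real.pi * Complex.I * n * r : ℂ).re = 0 := by simp
    rw [this] at n2; linarith
  have hz := real_zero h f1 f2
  have hnh : ¬ IsHalfIntPair (r : ℂ) (s : ℂ) := by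
    rintro ⟨m, j, hm, hj⟩
    rw [hz] at e1 e2
    refine no_half h Y H (pp 1 hu.1).1 (pp τ hu.2.1).1 (pp 1 hu.1).2 (pp τ hu.2.1).2 ?_ ?_
    · rw [e1]; refine exp_sign (-(n * j)) ?_
      rw [hj]; push_cast; ring
    · rw [e2]; refine exp_sign (n * m) ?_
      rw [hm]; push_cast; ring
  refine ⟨r, s, hnh, hz, ?_⟩
  rw [hecke_m h hk hz (by rw [← hωd, ← hrs']; exact hA) ?_, ← hωd, ← hrs', ← Y.lsq]
  · exact pow_ne_zero 2 (div_ne_zero (neg_ne_zero.2 p0) two_ne_zero)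
  · intro hl
    exact hnh (half_of_two h (by rw [two_mul]; exact lat_add hl hl))

theorem cs_of_ps (op : IsOpen O)
    (dψ : ∀ z ∈ O, HW (fun w => (ψ w : ℂ)) (P z) (starRingEnd ℂ (P z)) z)
    (dP : ∀ z ∈ O, HW P (q z * ψ z) (R z) z)
    (rel : ∀ z ∈ O, (ψ z * R z : ℂ) - P z * starRingEnd ℂ (P z) = 1 / 8)
    (pos : ∀ z, 0 < ψ z) (dq : ∀ z ∈ O, DifferentiableAt ℂ q z) :
    CS O (fun z => -2 * Real.log (ψ z)) (fun z => -2 * P z / ψ z) q := by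
  have ne : ∀ z, (ψ z : ℂ) ≠ 0 := fun z => by exact_mod_cast (pos z).ne'
  refine ⟨op, fun z hz => ?_, fun z hz => ?_, dq⟩
  · have hl : HasDerivAt Complex.log (ψ z : ℂ)⁻¹ ((fun w => (ψ w : ℂ)) z) :=
      Complex.hasDerivAt_log (by left; simpa using pos z)
    have := (HW.comp_left (g := fun w => (ψ w : ℂ)) hl (dψ z hz)).cmul (-2)
    refine this.cg (fun w => ?_) ?_ ?_
    · rw [← Complex.ofReal_log (pos w).le]; push_cast; ring
    · have := ne z; field_simp
    · have := ne z
      simp only [map_mul, map_div₀, map_neg, Complex.conj_ofReal]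
      rw [show starRingEnd ℂ (2:ℂ) = 2 from Complex.conj_ofReal 2]
      field_simp
  · have := ((dP z hz).div (dψ z hz) (ne z)).cmul (-2)
    have n := ne z
    refine this.cg (fun w => by ring) ?_ ?_
    · field_simp; ring
    · have e : Real.exp (-2 * Real.log (ψ z)) = 1 / ψ z ^ 2 := by
        rw [show -2 * Real.log (ψ z) = -(Real.log (ψ z ^ 2)) by rw [Real.log_pow]; push_cast; ring, Real.exp_neg, Real.exp_log (pow_pos (pos z) 2), one_div]
      rw [e]
      push_cast
      have r := rel z hz
      field_simp
      linear_combination 8 * r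

theorem log_bd {c : ℝ} (hc : 0 < c) (h1 : |u1 - L| ≤ C) (h2 : |u2 - L| ≤ C) :
    |-2 * Real.log (c * (Real.exp (-1/2 * u1) + Real.exp (-1/2 * u2))) - L| ≤ 2 * |Real.log c| + 2 * Real.log 2 + C := by
  have p1 := Real.exp_pos (-1/2 * u1)
  have p2 := Real.exp_pos (-1/2 * u2)
  rw [Real.log_mul hc.ne' (by positivity)]
  rw [abs_le] at h1 h2
  have l1 : -1/2 * u1 ≤ Real.log (Real.exp (-1/2 * u1) + Real.exp (-1/2 * u2)) := by
    conv_lhs => rw [← Real.log_exp (-1/2 * u1)]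
    exact Real.log_le_log p1 (by linarith)
  have l2 : Real.log (Real.exp (-1/2 * u1) + Real.exp (-1/2 * u2)) ≤ Real.log 2 + (-L / 2 + C / 2) := by
    rw [← Real.log_exp (-L / 2 + C / 2), ← Real.log_mul two_ne_zero (Real.exp_pos _).ne']
    refine Real.log_le_log (by positivity) ?_
    have := Real.exp_le_exp.2 (show -1/2 * u1 ≤ -L / 2 + C / 2 by linarith)
    have := Real.exp_le_exp.2 (show -1/2 * u2 ≤ -L / 2 + C / 2 by linarith)
    linarith
  have l3 := le_abs_self (Real.log c)
  have l4 := neg_abs_le (Real.log c)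
  have := Real.log_pos (show (1:ℝ) < 2 by norm_num)
  rw [abs_le]
  constructor <;> linarith

theorem ps_sum (H : PS O ψ R P q) (H' : PS O ψ' R' P' q) (hz : z ∈ O) :
    HasDerivAt (fun w => ((ψ w : ℂ) + ψ' w) * (R w + R' w) - (P w + P' w) * starRingEnd ℂ (P w + P' w)) 0 z := by
  have a1 := ((H.dψ z hz).add (H'.dψ z hz)).mul ((H.dR z hz).add (H'.dR z hz))
  have a2 := (H.dP z hz).add (H'.dP z hz)
  refine HW.hasDerivAt ((a1.sub (a2.mul a2.conj)).cg (fun w => rfl) ?_ ?_)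
  all_goals
    simp only [map_add, map_mul, Complex.conj_ofReal]
    ring

theorem ps_sum_pos (H : PS O ψ R P q) (H' : PS O ψ' R' P' q)
    (z : ℂ) : ∃ K : ℝ, 0 < K ∧
    ((ψ z : ℂ) + ψ' z) * (R z + R' z) - (P z + P' z) * starRingEnd ℂ (P z + P' z) = K := by
  have h1 := H.rel z
  have h2 := H'.rel z
  have p1 := H.pos z
  have p2 := H'.pos z
  refine ⟨1/4 + ((ψ z ^ 2 + ψ' z ^ 2) / 8 + Complex.normSq (ψ z * P' z - ψ' z * P z)) / (ψ z * ψ' z), ?_, ?_⟩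
  · have := Complex.normSq_nonneg (ψ z * P' z - ψ' z * P z)
    positivity
  · have n1 : (ψ z : ℂ) ≠ 0 := by exact_mod_cast p1.ne'
    have n2 : (ψ' z : ℂ) ≠ 0 := by exact_mod_cast p2.ne'
    push_cast
    rw [← Complex.mul_conj]
    simp only [map_add, map_sub, map_mul, Complex.conj_ofReal]
    field_simp
    linear_combination 32 * (ψ' z * ψ z + ψ' z ^ 2) * h1 + 32 * (ψ' z * ψ z + ψ z ^ 2) * h2

set_option maxHeartbeats 1000000 in
theorem even_sol (h : UP τ) (hk : K3 k)
    (hu : IsCurvatureSolution τ (starM k) u) (hq : ∀ z ∉ SS τ (per τ k / 2), uPot u (-z) = uPot u z) :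
    ∃ c : ℝ, 0 < c ∧ IsCurvatureSolution τ (starM k)
      (fun z => -2 * Real.log (c * (Real.exp (-1/2 * u z) + Real.exp (-1/2 * u (-z))))) := by
  obtain ⟨hω, h2⟩ := per_half h hk
  have C1 := sol_cs h hk hu
  have C2 := C1.reflect C1.op (fun z hz => by rw [mem_compl_iff, SS_neg h2]; exact hz)
  have H := C1.ps
  have H0 := C2.ps
  have near := fun a ha => sol_near hk hu (a := a) ha
  have sm := fun z hz n => sol_smooth hk hu (z := z) hz n
  set ω := per τ k / 2 with hωd
  set U : ℂ → ℂ := wirt fun w => (u w : ℂ) with hU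
  set q := uPot u with hqd
  set ψ : ℂ → ℝ := fun z => Real.exp (-1/2 * u z) with hψ
  set P : ℂ → ℂ := fun z => -1/2 * U z * (ψ z : ℝ) with hP
  set R : ℂ → ℝ := fun z => (1/8 + ‖P z‖ ^ 2) / ψ z with hR
  set ψ' : ℂ → ℝ := fun z => Real.exp (-1/2 * u (-z)) with hψ'
  set P' : ℂ → ℂ := fun z => -1/2 * -U (-z) * (ψ' z : ℝ) with hP'
  set R' : ℂ → ℝ := fun z => (1/8 + ‖P' z‖ ^ 2) / ψ' z with hR'
  have H' : PS (SS τ ω)ᶜ ψ' R' P' q := by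
    refine ⟨H0.dψ, fun z hz => ?_, fun z hz => ?_, H0.rel, H0.pos⟩
    · have := H0.dP z hz
      rwa [hq z hz] at this
    · have := H0.dR z hz
      rwa [hq z hz] at this
  obtain ⟨z0, z1⟩ := (SS_punct h ω 0).exists
  obtain ⟨K, Kp, hK⟩ := ps_sum_pos H H' z0
  have hK' : ∀ z ∉ SS τ ω, ((ψ z : ℂ) + ψ' z) * (R z + R' z) - (P z + P' z) * starRingEnd ℂ (P z + P' z) = K := by
    intro z hz
    rw [← hK]
    exact const_of_deriv_zero (SS_countable τ ω) (SS_closed h ω) (fun z hz => ps_sum H H' hz) hz z1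
  obtain ⟨c, cp, hc⟩ : ∃ c : ℝ, 0 < c ∧ c ^ 2 * K = 1 / 8 := by
    refine ⟨Real.sqrt (1 / (8 * K)), Real.sqrt_pos.2 (by positivity), ?_⟩
    rw [Real.sq_sqrt (by positivity)]; field_simp
  have hcc : (c : ℂ) ^ 2 * K = 1 / 8 := by
    have := congrArg (fun x : ℝ => (x : ℂ)) hc
    push_cast at this
    exact this
  refine ⟨c, cp, ?_⟩
  have CV : CS (SS τ ω)ᶜ (fun z => -2 * Real.log (c * (ψ z + ψ' z))) _ q :=
    cs_of_ps (ψ := fun z => c * (ψ z + ψ' z)) (R := fun z => c * (R z + R' z)) (P := fun z => c * (P z + P' z)) (q := q)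
      C1.op (fun z hz => (((H.dψ z hz).add (H'.dψ z hz)).cmul c).cg (fun w => by push_cast; ring) rfl (by simp))
      (fun z hz => (((H.dP z hz).add (H'.dP z hz)).cmul c).cg (fun w => rfl) (by push_cast; ring) (by push_cast; ring))
      (fun z hz => by
        have := hK' z hz
        simp only [map_mul, map_add, Complex.conj_ofReal] at this ⊢
        push_cast
        linear_combination (c:ℂ) ^ 2 * this + hcc)
      (fun z => mul_pos cp (add_pos (H.pos z) (H'.pos z))) C1.dq
  refine ⟨fun z => ?_, fun z => ?_, ?_, ?_⟩
  · have : u (-(z + 1)) = u (-z) := by rw [← hu.1 (-(z + 1))]; congr 1; ring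
    simp only [hψ, hψ', hu.1, this]
  · have : u (-(z + τ)) = u (-z) := by rw [← hu.2.1 (-(z + τ))]; congr 1; ring
    simp only [hψ, hψ', hu.2.1, this]
  · rw [singSet_star hk]
    intro z hz
    refine ⟨fun n => ?_, CV.lapl hz⟩
    have s1 := sm z hz n
    have s2 : ContDiffAt ℝ n (fun z => u (-z)) z :=
      ContDiffAt.comp (f := fun z => -z) z (sm (-z) (by rw [SS_neg h2]; exact hz) n) contDiff_neg.contDiffAt
    refine contDiffAt_const.mul (ContDiffAt.log (contDiffAt_const.mul
      ((contDiffAt_const.mul s1).exp.add (contDiffAt_const.mul s2).exp)) ?_)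
    exact (mul_pos cp (add_pos (H.pos z) (H'.pos z))).ne'
  · intro j hj l hl
    have ha : per τ (j : ℕ) / 2 + l ∈ SS τ ω := by
      rw [hωd, ← singSet_star hk]; exact ⟨j, hj, l, hl, rfl⟩
    have hj1 : starM k j = 1 := by
      unfold starM at hj ⊢; split_ifs at hj ⊢ <;> simp_all
    set a := per τ (j : ℕ) / 2 + l with had
    obtain ⟨B1, ε1, e1, b1⟩ := near a ha
    obtain ⟨B2, ε2, e2, b2⟩ := near (-a) (by rw [SS_neg h2]; exact ha)
    refine ⟨2 * |Real.log c| + 2 * Real.log 2 + max B1 B2, min ε1 ε2, lt_min e1 e2, fun z hz hd => ?_⟩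
    rw [hj1, Nat.cast_one, mul_one]
    have hd' : dist (-z) (-a) = dist z a := by rw [dist_neg_neg]
    have t1 := b1 z hz (lt_of_lt_of_le hd (min_le_left _ _))
    have t2 := b2 (-z) (fun e => hz (neg_injective e)) (by rw [hd']; exact lt_of_lt_of_le hd (min_le_right _ _))
    rw [hd'] at t2
    exact log_bd cp (t1.trans (le_max_left _ _)) (t2.trans (le_max_right _ _))

theorem der_quot {m : ℕ} (hg : AnalyticAt ℂ g p)
    (e : ∀ᶠ z in 𝓝[≠] p, h z = g z / (z - p) ^ m) :
    ∀ᶠ z in 𝓝[≠] p, deriv h z = (deriv g z * (z - p) - m * g z) / (z - p) ^ (m + 1) := by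
  have e1 := eventually_eventually_nhdsWithin.2 e
  filter_upwards [e1, hg.eventually_analyticAt.filter_mono nhdsWithin_le_nhds, self_mem_nhdsWithin] with z hz az nz
  have nz : z ≠ p := nz
  have nz' : z - p ≠ 0 := sub_ne_zero.2 nz
  rw [nhdsWithin_eq_nhds.2 (isOpen_compl_singleton.mem_nhds nz)] at hz
  rw [EventuallyEq.deriv_eq hz]
  have d1 := az.differentiableAt.hasDerivAt
  have d2 : HasDerivAt (fun w : ℂ => (w - p) ^ m) (m * (z - p) ^ (m - 1) * 1) z :=
    ((hasDerivAt_id z).sub_const p).fun_pow m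
  rw [(d1.fun_div d2 (pow_ne_zero _ nz')).deriv]
  rcases m with _ | m
  · simp; field_simp
  · simp only [Nat.add_sub_cancel]
    push_cast
    field_simp
    ring

theorem loc_h {A : ℂ → ℂ} {L : ℂ} (hm : MeromorphicAt h p) (hA : AnalyticAt ℂ A p)
    (hq : ∀ᶠ z in 𝓝[≠] p, q z = L / (z - p) ^ 2 + A z)
    (hh : ∀ᶠ z in 𝓝[≠] p, 2 * h z * deriv (deriv h) z - deriv h z ^ 2 + 1 = 4 * q z * h z ^ 2)
    (hL : L = 0 ∨ L = 2) : ∃ c : ℂ, (L = 0 → c = 0) ∧ RemAt (fun z => h z - c / (z - p) ^ 2) p := by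
  by_cases top : meromorphicOrderAt h p = ⊤
  · rw [meromorphicOrderAt_eq_top_iff] at top
    refine ⟨0, fun _ => rfl, fun _ => 0, analyticAt_const, ?_⟩
    filter_upwards [top] with z hz
    simp [hz]
  obtain ⟨n, hn⟩ := WithTop.ne_top_iff_exists.1 top
  obtain ⟨g, hg, g0, e⟩ := (meromorphicOrderAt_eq_int_iff hm).1 hn.symm
  rcases le_or_gt 0 n with h0 | h0
  · obtain ⟨m, rfl⟩ := Int.eq_ofNat_of_zero_le h0
    refine ⟨0, fun _ => rfl, fun z => (z - p) ^ m * g z, ?_, ?_⟩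
    · exact AnalyticAt.fun_mul ((analyticAt_id.fun_sub analyticAt_const).fun_pow m) hg
    · filter_upwards [e] with z hz
      simp [hz]
  obtain ⟨m, hm0⟩ := Int.eq_ofNat_of_zero_le (a := -n) (by omega)
  have mpos : 1 ≤ m := by omega
  have e0 : ∀ᶠ z in 𝓝[≠] p, h z = g z / (z - p) ^ m := by
    filter_upwards [e] with z hz
    rw [hz, show n = -(m : ℤ) by omega, zpow_neg, zpow_natCast, smul_eq_mul, div_eq_mul_inv, mul_comm]
  have an_t : AnalyticAt ℂ (fun z : ℂ => z - p) p := analyticAt_id.fun_sub analyticAt_const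
  have e1 := der_quot hg e0
  have hg1 : AnalyticAt ℂ (fun z => deriv g z * (z - p) - m * g z) p :=
    (hg.deriv.fun_mul an_t).fun_sub (analyticAt_const.fun_mul hg)
  have e2 := der_quot hg1 e1
  set g1 : ℂ → ℂ := fun z => deriv g z * (z - p) - m * g z with g1d
  have main : ∀ᶠ z in 𝓝[≠] p, 2 * g z * (deriv g1 z * (z - p) - (m + 1 : ℂ) * g1 z) - g1 z ^ 2 + (z - p) ^ (2 * m + 2)
      - 4 * (L + A z * (z - p) ^ 2) * g z ^ 2 = 0 := by
    filter_upwards [e0, e1, e2, hq, hh, self_mem_nhdsWithin] with z a0 a1 a2 a3 a4 nz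
    have nz' : z - p ≠ 0 := sub_ne_zero.2 nz
    change deriv h z = g1 z / _ at a1
    rw [a0, a1, a2, a3] at a4
    push_cast at a4
    generalize deriv g1 z * (z - p) - (m + 1 : ℂ) * g1 z = G2 at a4 ⊢
    generalize g1 z = G1 at a4 ⊢
    generalize z - p = t at a4 nz' ⊢
    have : t ^ m ≠ 0 := pow_ne_zero _ nz'
    rw [show m + 1 + 1 = m + 2 by ring, pow_add, pow_add, ] at a4
    rw [show 2 * m + 2 = m + m + 2 by ring, pow_add, pow_add]
    generalize t ^ m = T at a4 this ⊢
    field_simp at a4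
    linear_combination a4
  have anM : AnalyticAt ℂ (fun z => 2 * g z * (deriv g1 z * (z - p) - (m + 1 : ℂ) * g1 z) - g1 z ^ 2 + (z - p) ^ (2 * m + 2)
      - 4 * (L + A z * (z - p) ^ 2) * g z ^ 2) p :=
    ((((analyticAt_const.fun_mul hg).fun_mul ((hg1.deriv.fun_mul an_t).fun_sub (analyticAt_const.fun_mul hg1))).fun_sub
      (hg1.fun_pow 2)).fun_add (an_t.fun_pow _)).fun_sub ((analyticAt_const.fun_mul (analyticAt_const.fun_add
      (hA.fun_mul (an_t.fun_pow 2)))).fun_mul (hg.fun_pow 2))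
  have full := (anM.continuousAt.eventuallyEq_nhds_iff_eventuallyEq_nhdsNE (g := fun _ => (0 : ℂ)) continuousAt_const).1 main
  have v0 := full.eq_of_nhds
  simp only [g1d, sub_self, mul_zero, zero_sub] at v0
  rw [zero_pow (by omega)] at v0
  have hmm : (m : ℂ) ^ 2 + 2 * m = 4 * L := by
    apply mul_right_cancel₀ (pow_ne_zero 2 g0)
    linear_combination v0
  rcases hL with rfl | rfl
  · exfalso
    have : ((m ^ 2 + 2 * m : ℕ) : ℂ) = ((0 : ℕ) : ℂ) := by push_cast; linear_combination hmm
    have := Nat.cast_injective this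
    nlinarith
  have m2 : m = 2 := by
    have : ((m ^ 2 + 2 * m : ℕ) : ℂ) = ((8 : ℕ) : ℂ) := by push_cast; linear_combination hmm
    have := Nat.cast_injective this
    nlinarith
  subst m2
  have dg := hg.differentiableAt.hasDerivAt
  have dg' := hg.deriv.differentiableAt.hasDerivAt
  have dt : HasDerivAt (fun z : ℂ => z - p) 1 p := (hasDerivAt_id p).sub_const p
  have dg1 : HasDerivAt g1 (-deriv g p) p :=
    ((dg'.fun_mul dt).fun_sub (dg.const_mul ((2 : ℕ) : ℂ))).congr_deriv (by push_cast; ring)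
  have dg1' := hg1.deriv.differentiableAt.hasDerivAt
  have dA := hA.differentiableAt.hasDerivAt
  have dM := ((((dg.const_mul 2).fun_mul ((dg1'.fun_mul dt).fun_sub (dg1.const_mul (((2 : ℕ) : ℂ) + 1)))).fun_sub (dg1.fun_pow 2)).fun_add
    (dt.fun_pow (2 * 2 + 2))).fun_sub ((((dA.fun_mul (dt.fun_pow 2)).const_add 2).const_mul 4).fun_mul (dg.fun_pow 2))
  have z0 := dM.deriv.symm.trans (full.deriv_eq)
  have vg1 : g1 p = -2 * g p := by simp [g1d]
  rw [deriv_const, dg1.deriv, vg1] at z0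
  norm_num at z0
  have gd : deriv g p = 0 := by
    apply mul_left_cancel₀ g0
    linear_combination (-1 / 4) * z0
  refine ⟨g p, fun h => absurd h two_ne_zero, ?_⟩
  obtain ⟨φ, f1, f2, f3⟩ := rem_div (g := fun z => g z - g p) (a := p) (hg.fun_sub analyticAt_const) (sub_self _)
  have f2' : φ p = 0 := by rw [f2, deriv_sub_const, gd]
  obtain ⟨ψ, k1, k2, k3⟩ := rem_div f1 f2'
  refine ⟨ψ, k1, ?_⟩
  filter_upwards [e0, self_mem_nhdsWithin] with z a0 nz
  have nz' : z - p ≠ 0 := sub_ne_zero.2 nz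
  rw [a0, div_sub_div_same, f3, k3]
  field_simp

theorem h_ode (H : CS O u U q) (hz : z ∈ O)
    (hF : AnalyticAt ℂ f z) (h0 : deriv f z ≠ 0)
    (hu : ∀ᶠ w in 𝓝 z, u w = Real.log (8 * ‖deriv f w‖ ^ 2 / (1 + ‖f w‖ ^ 2) ^ 2)) :
    2 * (f z / deriv f z) * deriv (deriv fun w => f w / deriv f w) z - deriv (fun w => f w / deriv f w) z ^ 2 + 1
      = 4 * q z * (f z / deriv f z) ^ 2 := by
  have e := H.dev hz hF h0 hu
  have d1 : ∀ᶠ w in 𝓝 z, deriv (fun w => f w / deriv f w) w = (deriv f w * deriv f w - f w * deriv (deriv f) w) / deriv f w ^ 2 := by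
    filter_upwards [hF.eventually_analyticAt, hF.deriv.continuousAt.eventually_ne h0] with w a n
    exact (a.differentiableAt.hasDerivAt.fun_div a.deriv.differentiableAt.hasDerivAt n).deriv
  have D0 := hF.differentiableAt.hasDerivAt
  have D1 := hF.deriv.differentiableAt.hasDerivAt
  have D2 := hF.deriv.deriv.differentiableAt.hasDerivAt
  rw [EventuallyEq.deriv_eq d1, d1.self_of_nhds,
    (((D1.fun_mul D1).fun_sub (D0.fun_mul D2)).fun_div (D1.fun_pow 2) (pow_ne_zero 2 h0)).deriv, e]
  field_simp
  ring

theorem good_pts (hm : ∀ z, MeromorphicAt f z) (a0 : AnalyticAt ℂ f z0) (d0 : deriv f z0 ≠ 0)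
    (z : ℂ) : ∀ᶠ w in 𝓝[≠] z, AnalyticAt ℂ f w ∧ f w ≠ 0 ∧ deriv f w ≠ 0 := by
  have hd : MeromorphicOn (deriv f) univ := fun z _ => (hm z).deriv
  have t0 : meromorphicOrderAt (deriv f) z0 ≠ ⊤ := by
    rw [meromorphicOrderAt_ne_top_iff_eventually_ne_zero (hm z0).deriv]
    exact (a0.deriv.continuousAt.eventually_ne d0).filter_mono nhdsWithin_le_nhds
  have t1 := hd.meromorphicOrderAt_ne_top_of_isPreconnected isPreconnected_univ (mem_univ z0) (mem_univ z) t0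
  rw [meromorphicOrderAt_ne_top_iff_eventually_ne_zero (hm z).deriv] at t1
  have t2 : meromorphicOrderAt f z ≠ ⊤ := by
    intro h
    rw [meromorphicOrderAt_eq_top_iff] at h
    have : ∀ᶠ w in 𝓝[≠] z, False := by
      filter_upwards [eventually_eventually_nhdsWithin.2 h, t1, self_mem_nhdsWithin] with w h1 h2 nz
      have nz : w ≠ z := nz
      rw [nhdsWithin_eq_nhds.2 (isOpen_compl_singleton.mem_nhds nz)] at h1
      apply h2
      rw [EventuallyEq.deriv_eq h1, deriv_const]
    exact this.exists.choose_spec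
  rw [meromorphicOrderAt_ne_top_iff_eventually_ne_zero (hm z)] at t2
  filter_upwards [(hm z).eventually_analyticAt, t1, t2] with w a b c using ⟨a, c, b⟩

theorem q_loc (h : UP τ) (hω : ω ∉ lat τ) (p : ℂ) : ∃ (L : ℂ) (A : ℂ → ℂ),
    (L = 0 ∨ L = 2) ∧ (p ∉ SS τ ω → L = 0) ∧ AnalyticAt ℂ A p ∧
    ∀ z, 2 * wp τ z + 2 * wp τ (z - ω) + e = L / (z - p) ^ 2 + A z := by
  have an_p : AnalyticAt ℂ (fun z => ph τ (z - p)) p := an_sub (by rw [sub_self]; exact ph_analyticAt h)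
  by_cases h1 : p ∈ lat τ
  · have h2 : p - ω ∉ lat τ := fun h2 => hω (by simpa using lat_sub h1 h2)
    refine ⟨2, fun z => 2 * ph τ (z - p) + 2 * wp τ (z - ω) + e, Or.inr rfl, fun hp => absurd (Or.inl h1) hp, ?_, fun z => ?_⟩
    · exact ((analyticAt_const.fun_mul an_p).fun_add (analyticAt_const.fun_mul (an_sub (wp_analyticAt h h2)))).fun_add analyticAt_const
    · have := wp_add h (z - p) h1
      rw [sub_add_cancel] at this
      rw [this, wp_ph τ (z - p)]; ring
  by_cases h2 : p - ω ∈ lat τ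
  · refine ⟨2, fun z => 2 * ph τ (z - p) + 2 * wp τ z + e, Or.inr rfl, fun hp => absurd (Or.inr h2) hp, ?_, fun z => ?_⟩
    · exact ((analyticAt_const.fun_mul an_p).fun_add (analyticAt_const.fun_mul (wp_analyticAt h h1))).fun_add analyticAt_const
    · have := wp_add h (z - p) h2
      rw [show z - p + (p - ω) = z - ω by ring] at this
      rw [this, wp_ph τ (z - p)]; ring
  · refine ⟨0, fun z => 2 * wp τ z + 2 * wp τ (z - ω) + e, Or.inl rfl, fun _ => rfl, ?_, fun z => by ring⟩
    exact ((analyticAt_const.fun_mul (wp_analyticAt h h1)).fun_add (analyticAt_const.fun_mul (an_sub (wp_analyticAt h h2)))).fun_add analyticAt_const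

theorem SS_two (h2 : 2 * ω ∈ lat τ) (hp : p ∈ SS τ ω) : 2 * p ∈ lat τ := by
  rcases hp with hp | hp
  · rw [two_mul]; exact lat_add hp hp
  · have := lat_add (lat_add hp hp) h2
    rwa [show p - ω + (p - ω) + 2 * ω = 2 * p by ring] at this

theorem h_even (hτ : 0 < τ.im) (hω : ω ∉ lat τ) (h2 : 2 * ω ∈ lat τ)
    (hq : ∀ z ∉ SS τ ω, q z = 2 * wp τ z + 2 * wp τ (z - ω) + e)
    (hm : ∀ z, MeromorphicAt h z) (p1 : ∀ z, h (z + 1) = h z) (p2 : ∀ z, h (z + τ) = h z)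
    (ho : ∀ p, ∀ᶠ z in 𝓝[≠] p, 2 * h z * deriv (deriv h) z - deriv h z ^ 2 + 1 = 4 * q z * h z ^ 2)
    (z : ℂ) : ∀ᶠ w in 𝓝[≠] z, h w = h (-w) := by
  have loc : ∀ p, ∃ c : ℂ, (p ∉ SS τ ω → c = 0) ∧ RemAt (fun z => h z - c / (z - p) ^ 2) p := by
    intro p
    obtain ⟨L, A, a1, a2, a3, a4⟩ := q_loc (e := e) hτ hω p
    obtain ⟨c, c1, c2⟩ := loc_h (hm p) a3 (by
      filter_upwards [SS_punct hτ ω p] with z hz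
      rw [hq z hz, a4]) (ho p) a1
    exact ⟨c, fun hp => c1 (a2 hp), c2⟩
  have rem : ∀ p, RemAt (fun z => h z - h (-z)) p := by
    intro p
    by_cases hp : p ∈ SS τ ω
    · obtain ⟨c, -, c2⟩ := loc p
      have l2 := SS_two h2 hp
      have r1 : RemAt (fun w => (fun z => h z - c / (z - p) ^ 2) (w - (-(2 * p)))) (-p) :=
        RemAt.comp_sub (by rwa [show -p - -(2 * p) = p by ring])
      have r2 := r1.comp_neg
      refine (c2.sub r2).congr (Eventually.of_forall fun w => ?_)
      simp only
      rw [show -w - -(2 * p) = -w + 2 * p by ring, per_lat p1 p2 l2,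
        show (-w + 2 * p - p) ^ 2 = (w - p) ^ 2 by ring]
      ring
    · have hp' : -p ∉ SS τ ω := by rwa [SS_neg h2]
      obtain ⟨c, c1, c2⟩ := loc p
      obtain ⟨c', c1', c2'⟩ := loc (-p)
      rw [c1 hp] at c2
      rw [c1' hp'] at c2'
      simp only [zero_div, sub_zero] at c2 c2'
      exact c2.sub c2'.comp_neg
  have q1 : ∀ l ∈ lat τ, QP (fun z => h z - h (-z)) l 0 := by
    intro l hl z
    refine Eventually.of_forall fun w => ?_
    simp only
    rw [per_lat p1 p2 hl, neg_add, per_lat p1 p2 (lat_neg hl), add_zero]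
  obtain ⟨-, b, -, hb⟩ := liouville hτ (q1 1 (lat_one τ)) (q1 τ (lat_tau τ)) rem
  have b0 : b = 0 := by
    have e1 := hb 0
    have e2 := (tendsto_neg_punct 0).eventually (by rw [neg_zero]; exact e1)
    obtain ⟨w, w1, w2⟩ := (e1.and e2).exists
    simp only [neg_neg] at w1 w2
    linear_combination (-w1 - w2) / 2
  filter_upwards [hb z] with w hw
  rw [b0] at hw
  linear_combination hw

theorem bad_closed {P : ℂ → Prop} (hP : ∀ z, ∀ᶠ w in 𝓝[≠] z, P w) : IsClosed {w | ¬ P w} := by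
  rw [← isOpen_compl_iff, isOpen_iff_mem_nhds]
  intro x hx
  have hx : P x := not_not.1 hx
  have := eventually_nhdsWithin_iff.1 (hP x)
  filter_upwards [this] with w hw
  simp only [mem_compl_iff, mem_setOf_eq, not_not]
  by_cases e : w = x
  · rwa [e]
  · exact hw e

theorem bad_countable {P : ℂ → Prop} (hP : ∀ z, ∀ᶠ w in 𝓝[≠] z, P w) : {w | ¬ P w}.Countable := by
  have : ∀ x, {w | P w ∨ w = x} ∈ 𝓝 x := by
    intro x
    filter_upwards [eventually_nhdsWithin_iff.1 (hP x)] with w hw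
    by_cases e : w = x
    · exact Or.inr e
    · exact Or.inl (hw e)
  obtain ⟨s, hs, hu⟩ := TopologicalSpace.countable_cover_nhds this
  refine hs.mono fun w hw => ?_
  have : w ∈ ⋃ x ∈ s, {w | P w ∨ w = x} := by rw [hu]; trivial
  simp only [mem_iUnion] at this
  obtain ⟨x, xs, h | rfl⟩ := this
  · exact absurd h hw
  · exact xs

theorem exp_half {a b : ℝ} (hb : 0 < b) :
    Real.log (8 * b ^ 2 / (1 + a ^ 2) ^ 2) = -2 * Real.log ((1 + a ^ 2) / (√8 * b)) := by
  have h8 : (√8 : ℝ) ^ 2 = 8 := Real.sq_sqrt (by norm_num)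
  have : (8 * b ^ 2 / (1 + a ^ 2) ^ 2) = ((1 + a ^ 2) / (√8 * b)) ^ (-2 : ℤ) := by
    rw [zpow_neg, zpow_ofNat, div_pow, mul_pow, h8, inv_div]
  rw [this, Real.log_zpow]; norm_num

theorem even_form {a b a' b' E c : ℝ} (ha : 0 < a) (hb : 0 < b) (hK : 0 < K) (hE : 0 < E) (hc : 0 < c)
    (hEK : E ^ 2 * K = 1) (h1 : a * a' = K) (h2 : b * a' = a * b') :
    -2 * Real.log (c * (Real.exp (-1 / 2 * Real.log (8 * b ^ 2 / (1 + a ^ 2) ^ 2)) +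
      Real.exp (-1 / 2 * Real.log (8 * b' ^ 2 / (1 + a' ^ 2) ^ 2)))) =
    Real.log (8 * (E * b) ^ 2 / (1 + (E * a) ^ 2) ^ 2) + -2 * Real.log (c * (1 + K) * E) := by
  have ha' : a' = K / a := by field_simp; linarith
  have hb' : b' = b * K / a ^ 2 := by
    field_simp; rw [ha'] at h2; field_simp at h2; linarith
  have pb' : 0 < b' := by rw [hb']; positivity
  have s8 : 0 < √(8 : ℝ) := by positivity
  rw [exp_half hb, exp_half pb', exp_half (mul_pos hE hb)]
  rw [show ∀ x : ℝ, -1 / 2 * (-2 * x) = x by intro x; ring, show ∀ x : ℝ, -1 / 2 * (-2 * x) = x by intro x; ring]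
  rw [Real.exp_log (by positivity), Real.exp_log (by positivity), ← mul_add, ← Real.log_mul (by positivity) (by positivity)]
  congr 2
  rw [ha', hb']
  have : K = 1 / E ^ 2 := by field_simp; linarith
  rw [this]
  field_simp
  ring

theorem const_zero (H : CS O v U q) (hz : z ∈ O)
    (hF : AnalyticAt ℂ F z) (h0 : deriv F z ≠ 0)
    (hv : ∀ᶠ w in 𝓝 z, v w = Real.log (8 * ‖deriv F w‖ ^ 2 / (1 + ‖F w‖ ^ 2) ^ 2) + C) : C = 0 := by
  obtain ⟨h1, h2⟩ := dev_cs (u := fun w => Real.log (8 * ‖deriv F w‖ ^ 2 / (1 + ‖F w‖ ^ 2) ^ 2)) hF h0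
    (Eventually.of_forall fun _ => rfl)
  have e : ∀ᶠ w in 𝓝 z, U w = deriv (deriv F) w / deriv F w - 2 * deriv F w * starRingEnd ℂ (F w) / (1 + F w * starRingEnd ℂ (F w)) := by
    filter_upwards [h1, H.op.mem_nhds hz, hv.eventually_nhds] with w hw hO hvw
    have a := (hw.add (hw_const (C : ℂ) w)).congr (f := fun w => (v w : ℂ)) (by
      filter_upwards [hvw] with x hx
      rw [hx]; push_cast; rfl)
    have := ((H.du w hO).unique a).1
    rw [this, add_zero]
  have h3 := ((H.dU z hz).unique (h2.congr e)).2
  have h4 : Real.exp (v z) = Real.exp (Real.log (8 * ‖deriv F z‖ ^ 2 / (1 + ‖F z‖ ^ 2) ^ 2)) := by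
    have h3 : ((Real.exp (v z) : ℝ) : ℂ) = ((Real.exp (Real.log (8 * ‖deriv F z‖ ^ 2 / (1 + ‖F z‖ ^ 2) ^ 2)) : ℝ) : ℂ) := by
      linear_combination (-4) * h3
    exact_mod_cast h3
  have h5 := Real.exp_injective h4
  have h6 := hv.self_of_nhds
  linarith

theorem dev_all (hk : K3 k)
    (hv : IsCurvatureSolution τ (starM k) v) (hF : AnalyticAt ℂ F z) (h0 : deriv F z ≠ 0)
    (e : ∀ᶠ w in 𝓝[≠] z, v w = Real.log (8 * ‖deriv F w‖ ^ 2 / (1 + ‖F w‖ ^ 2) ^ 2)) :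
    v z = Real.log (8 * ‖deriv F z‖ ^ 2 / (1 + ‖F z‖ ^ 2) ^ 2) := by
  have n0 : 0 < ‖deriv F z‖ := norm_pos_iff.2 h0
  have cF : ContinuousAt (fun w => Real.log (8 * ‖deriv F w‖ ^ 2 / (1 + ‖F w‖ ^ 2) ^ 2)) z := by
    have c1 := hF.continuousAt.norm
    have c2 := hF.deriv.continuousAt.norm
    refine ContinuousAt.log ?_ (by positivity)
    exact ContinuousAt.div₀ (continuousAt_const.mul (c2.pow 2)) ((continuousAt_const.add (c1.pow 2)).pow 2) (by positivity)
  have t1 : Tendsto v (𝓝[≠] z) (𝓝 (Real.log (8 * ‖deriv F z‖ ^ 2 / (1 + ‖F z‖ ^ 2) ^ 2))) :=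
    (cF.tendsto.mono_left nhdsWithin_le_nhds).congr' (by filter_upwards [e] with w hw using hw.symm)
  by_cases hz : z ∈ SS τ (per τ k / 2)
  · exfalso
    obtain ⟨C, ε, he, hC⟩ := sol_near hk hv hz
    have t2 : Tendsto (fun w => C + 4 * Real.log ‖w - z‖) (𝓝[≠] z) atBot :=
      tendsto_atBot_add_const_left _ _ ((Real.tendsto_log_nhdsGT_zero.comp (tendsto_norm_sub_self_nhdsNE z)).const_mul_atBot (by norm_num))
    refine not_tendsto_nhds_of_tendsto_atBot (tendsto_atBot_mono' _ ?_ t2) _ t1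
    filter_upwards [self_mem_nhdsWithin, nhdsWithin_le_nhds (ball_mem_nhds z he)] with w n b
    have := hC w n b
    rw [dist_eq_norm] at this
    have := (abs_le.1 this).2
    linarith
  · exact tendsto_nhds_unique ((sol_smooth hk hv hz 1).continuousAt.tendsto.mono_left nhdsWithin_le_nhds) t1

set_option maxHeartbeats 1000000 in
theorem fam_even (h : UP τ) (hk : K3 k)
    (hu : IsCurvatureSolution τ (starM k) u) (hf : IsDevelopingMapOf u f) (hII : IsTypeII τ f)
    (hq : ∀ z ∉ SS τ (per τ k / 2), uPot u z = 2 * wp τ z + 2 * wp τ (z - per τ k / 2) + e) :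
    FamilyHasEven τ (starM k) f := by
  obtain ⟨hω, h2⟩ := per_half h hk
  have qe : ∀ z ∉ SS τ (per τ k / 2), uPot u (-z) = uPot u z := by
    intro z hz
    rw [hq z hz, hq (-z) (by rwa [SS_neg h2]), wp_neg h]
    have := wp_add h (z - per τ k / 2) h2
    rw [show z - per τ k / 2 + 2 * (per τ k / 2) = -(-z - per τ k / 2) by ring, wp_neg h] at this
    rw [this]
  obtain ⟨c, hc, hv⟩ := even_sol h hk hu qe
  set v : ℂ → ℝ := fun z => -2 * Real.log (c * (Real.exp (-1/2 * u z) + Real.exp (-1/2 * u (-z)))) with vd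
  have vev : ∀ z, v (-z) = v z := by
    intro z; simp only [vd]; rw [neg_neg, add_comm]
  have dF : ∀ (b : ℝ) (z : ℂ), deriv (fun z => (Real.exp b : ℂ) * f z) z = (Real.exp b : ℂ) * deriv f z := fun b z =>
    deriv_const_mul_field _
  have bne : ∀ b : ℝ, (Real.exp b : ℂ) ≠ 0 := fun b => by exact_mod_cast (Real.exp_pos b).ne'
  have aF : ∀ (b : ℝ) (z : ℂ), AnalyticAt ℂ (fun z => (Real.exp b : ℂ) * f z) z → AnalyticAt ℂ f z := by
    intro b z hz
    have := (analyticAt_const (v := (Real.exp b : ℂ)⁻¹)).fun_mul hz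
    refine this.congr (Eventually.of_forall fun w => ?_)
    simp only
    rw [inv_mul_cancel_left₀ (bne b)]
  have mF : ∀ (b : ℝ) (z : ℂ), MeromorphicAt (fun z => (Real.exp b : ℂ) * f z) z := fun b z =>
    (MeromorphicAt.const _ z).fun_mul (hf.1 z)
  by_cases vac : ∃ z0, AnalyticAt ℂ f z0 ∧ deriv f z0 ≠ 0
  swap
  · refine ⟨0, v, hv, ⟨mF 0, fun z hz hd => ?_⟩, vev⟩
    refine absurd ⟨z, aF 0 z hz, fun h => hd ?_⟩ vac
    rw [dF, h, mul_zero]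
  obtain ⟨z0, a0, d0⟩ := vac
  have good := good_pts hf.1 a0 d0
  obtain ⟨θ1, θ2, p1, p2⟩ := hII
  set H : ℂ → ℂ := fun w => f w / deriv f w with Hd
  have cs := sol_cs h hk hu
  have Hper : ∀ {l μ : ℂ}, μ ≠ 0 → (∀ z, f (z + l) = μ * f z) → ∀ z, H (z + l) = H z := by
    intro l μ hμ hl z
    simp only [Hd]
    rw [hl, deriv_mult hl, mul_div_mul_left _ _ hμ]
  have udev : ∀ z, AnalyticAt ℂ f z → deriv f z ≠ 0 → ∀ᶠ w in 𝓝 z, u w = Real.log (8 * ‖deriv f w‖ ^ 2 / (1 + ‖f w‖ ^ 2) ^ 2) := by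
    intro z az dz
    filter_upwards [az.eventually_analyticAt, az.deriv.continuousAt.eventually_ne dz] with w a b using hf.2 w a b
  have hev := h_even h hω h2 hq (h := H) (fun z => (hf.1 z).fun_div (hf.1 z).deriv)
    (Hper (Complex.exp_ne_zero _) p1) (Hper (Complex.exp_ne_zero _) p2) (by
      intro p
      filter_upwards [good p, SS_punct h (per τ k / 2) p] with z hz hS
      exact h_ode cs hS hz.1 hz.2.2 (udev z hz.1 hz.2.2))
  let P : ℂ → Prop := fun w => (AnalyticAt ℂ f w ∧ f w ≠ 0 ∧ deriv f w ≠ 0) ∧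
    (AnalyticAt ℂ f (-w) ∧ f (-w) ≠ 0 ∧ deriv f (-w) ≠ 0) ∧ w ∉ SS τ (per τ k / 2) ∧ H w = H (-w)
  have hP : ∀ z, ∀ᶠ w in 𝓝[≠] z, P w := by
    intro z
    filter_upwards [good z, (tendsto_neg_punct z).eventually (good (-z)), SS_punct h (per τ k / 2) z, hev z] with w a b c d
      using ⟨a, b, c, d⟩
  have Pd : ∀ w, P w → deriv f w * f (-w) = f w * deriv f (-w) := by
    rintro w ⟨⟨-, -, a⟩, ⟨-, -, b⟩, -, c⟩
    simp only [Hd] at c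
    rw [div_eq_div_iff a b] at c
    linear_combination -c
  obtain ⟨w0, P0⟩ := (hP 0).exists
  have kap : ∀ w, P w → f w * f (-w) = f w0 * f (-w0) := by
    intro w hw
    refine const_of_deriv_zero (f := fun w => f w * f (-w)) (bad_countable hP) (bad_closed hP) (fun z hz => ?_)
      (not_not.2 hw) (not_not.2 P0)
    have hz : P z := not_not.1 hz
    have d1 := hz.1.1.differentiableAt.hasDerivAt
    have d2 : HasDerivAt (fun w => f (-w)) (deriv f (-z) * -1) z :=
      HasDerivAt.comp z (h₂ := f) hz.2.1.1.differentiableAt.hasDerivAt (hasDerivAt_neg z)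
    exact (d1.fun_mul d2).congr_deriv (by rw [Pd z hz]; ring)
  set κ := f w0 * f (-w0) with κd
  have kne : κ ≠ 0 := mul_ne_zero P0.1.2.1 P0.2.1.2.1
  have Kpos : 0 < ‖κ‖ := norm_pos_iff.2 kne
  set β : ℝ := -(1 / 2) * Real.log ‖κ‖ with βd
  have hE : Real.exp β ^ 2 * ‖κ‖ = 1 := by
    rw [← Real.exp_nat_mul, show ((2 : ℕ) : ℝ) * β = -Real.log ‖κ‖ by rw [βd]; push_cast; ring, Real.exp_neg, Real.exp_log Kpos,
      inv_mul_cancel₀ Kpos.ne']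
  have nF : ∀ x : ℂ, ‖(Real.exp β : ℂ) * x‖ = Real.exp β * ‖x‖ := by
    intro x; rw [norm_mul, Complex.norm_real, Real.norm_of_nonneg (Real.exp_pos β).le]
  have vform : ∀ w, P w → v w = Real.log (8 * ‖deriv (fun z => (Real.exp β : ℂ) * f z) w‖ ^ 2 /
      (1 + ‖(Real.exp β : ℂ) * f w‖ ^ 2) ^ 2) + -2 * Real.log (c * (1 + ‖κ‖) * Real.exp β) := by
    intro w hw
    rw [dF, nF, nF, ← even_form (a := ‖f w‖) (b := ‖deriv f w‖) (a' := ‖f (-w)‖) (b' := ‖deriv f (-w)‖) (norm_pos_iff.2 hw.1.2.1)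
      (norm_pos_iff.2 hw.1.2.2) Kpos (Real.exp_pos β) hc hE (by rw [← norm_mul, kap w hw])
      (by rw [← norm_mul, ← norm_mul, Pd w hw])]
    simp only [vd]
    rw [hf.2 w hw.1.1 hw.1.2.2, hf.2 (-w) hw.2.1.1 hw.2.1.2.2]
  have C0 := const_zero (F := fun z => (Real.exp β : ℂ) * f z) (sol_cs h hk hv) (z := w0) P0.2.2.1
    (analyticAt_const.fun_mul P0.1.1) (by rw [dF]; exact mul_ne_zero (bne β) P0.1.2.2) (by
      filter_upwards [(bad_closed hP).isOpen_compl.mem_nhds (not_not.2 P0)] with w hw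
      exact vform w (not_not.1 hw))
  rw [C0] at vform
  refine ⟨β, v, hv, ⟨mF β, fun z hz hd => ?_⟩, vev⟩
  refine dev_all hk hv hz hd ?_
  filter_upwards [hP z] with w hw
  rw [vform w hw, add_zero]

end

/-- **Theorem (Statement 5).** For `τ₀ ∈ ℍ` and `k ∈ {1,2,3}`, equation `(★_k)` on `E_{τ₀}`
has a non-even family of solutions iff there is `(r,s) ∈ ℝ² ∖ (1/2)ℤ²` with
`Z(r_k,s_k,τ₀) = 0` and `Z^{(𝐦_k)}(r,s,τ₀) ≠ 0`. -/
theorem statement5 (τ₀ : ℂ) (hτ₀ : 0 < τ₀.im) (k : ℕ) (hk : k = 1 ∨ k = 2 ∨ k = 3) :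
    HasNonEvenFamily τ₀ (starM k) ↔
      ∃ r s : ℝ, ¬ IsHalfIntPair (r : ℂ) (s : ℂ) ∧
        heckeZ (rkr k (r : ℂ)) (rks k (s : ℂ)) τ₀ = 0 ∧
        heckeZm k (r : ℂ) (s : ℂ) τ₀ ≠ 0 := by
  constructor
  · rintro ⟨u, f, hu, hf, hII, hne⟩
    obtain ⟨p, d, e, hp, hd, d0, d1, hq0, hq⟩ := q_form hτ₀ hk hu
    by_cases p0 : p 0 = 0
    · exact absurd (fam_even hτ₀ hk hu hf hII (e := e) (fun z hz => by rw [hq z hz, p0]; ring)) hne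
    · exact right_ne hτ₀ hk hu hp hd d0 d1 hq0 hq p0
  · rintro ⟨r, s, hrs, hz, hzm⟩
    exact left_dir hτ₀ hk hrs hz hzm
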